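/- Fix a positive integer n. The multiplicative Horn cone C_B is a polyhedral cone: there exist a natural number m and linear functionals f_1, …, f_m on ℝ^{3n} such that C_B = {x ∈ ℝ^{3n} : f_j(x) ≥ 0 for all j = 1, …, m}. -/

import Mathlib

open Matrix

/-- The eigenvalues of a Hermitian matrix, listed in decreasing order:
`eigsDesc hA 0 = λ₁ ≥ eigsDesc hA 1 = λ₂ ≥ …`. -/
noncomputable def eigsDesc {n : ℕ} {A : Matrix (Fin n) (Fin n) ℂ} (hA : A.IsHermitian) :
    Fin n → ℝ :=
  fun i => hA.eigenvalues (Tuple.sort hA.eigenvalues i.rev)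

/-- `lMap hA i = λ₁ + … + λ_{i+1}`, the partial sums of the decreasingly ordered
eigenvalues of a Hermitian matrix (`i : Fin n` represents the index `i+1`). -/
noncomputable def lMap {n : ℕ} {A : Matrix (Fin n) (Fin n) ℂ} (hA : A.IsHermitian) :
    Fin n → ℝ :=
  fun i => ∑ j ∈ Finset.Iic i, eigsDesc hA j


/-- The set `B` of upper-triangular complex matrices with positive real diagonal
entries. -/
def UpperTriPos (n : ℕ) : Set (Matrix (Fin n) (Fin n) ℂ) :=
  {A | (∀ i j : Fin n, j < i → A i j = 0) ∧ ∀ i : Fin n, 0 < (A i i).re ∧ (A i i).im = 0}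

/-- `lB A i = (1/2)(log λ₁(AA*) + … + log λ_{i+1}(AA*))`, where the `λ`'s are the
decreasingly ordered eigenvalues of `A * Aᴴ` (`i : Fin n` represents the index `i+1`). -/
noncomputable def lB {n : ℕ} (A : Matrix (Fin n) (Fin n) ℂ) : Fin n → ℝ :=
  fun i => (1 / 2) * ∑ j ∈ Finset.Iic i,
    Real.log (eigsDesc (Matrix.isHermitian_mul_conjTranspose_self A) j)

/-- The multiplicative Horn cone: triples `(r, s, t)` such that there exist
`A, C ∈ B` with `lB A = r`, `lB C = s`, `lB (A * C) = t`. -/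
def HornConeB (n : ℕ) : Set ((Fin n → ℝ) × (Fin n → ℝ) × (Fin n → ℝ)) :=
  {rst | ∃ A C : Matrix (Fin n) (Fin n) ℂ, A ∈ UpperTriPos n ∧ C ∈ UpperTriPos n ∧
    lB A = rst.1 ∧ lB C = rst.2.1 ∧ lB (A * C) = rst.2.2}


namespace Horn

open Polynomial in
/-- `S` has spectrum `a` (with multiplicity). -/
def HasSpec {n : ℕ} (S : Matrix (Fin n) (Fin n) ℂ) (a : Fin n → ℝ) : Prop :=
  S.charpoly = ∏ i, (X - C ((a i : ℝ) : ℂ))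

/-- `(A, C)` lies over the triple `x` of logarithmic singular values. -/
def Over {n : ℕ} (A C : Matrix (Fin n) (Fin n) ℂ)
    (x : (Fin n → ℝ) × (Fin n → ℝ) × (Fin n → ℝ)) : Prop :=
  HasSpec (A * Aᴴ) (fun i => Real.exp (2 * x.1 i)) ∧
  HasSpec (C * Cᴴ) (fun i => Real.exp (2 * x.2.1 i)) ∧
  HasSpec ((A * C) * (A * C)ᴴ) (fun i => Real.exp (2 * x.2.2 i))

/-- The cone in terms of logarithmic singular values. -/
def Cone (n : ℕ) : Set ((Fin n → ℝ) × (Fin n → ℝ) × (Fin n → ℝ)) :=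
  {x | Antitone x.1 ∧ Antitone x.2.1 ∧ Antitone x.2.2 ∧ ∃ A C, Over A C x}

end Horn


namespace Horn
open Polynomial

lemma antitone_unique {n : ℕ} {a b : Fin n → ℝ} (ha : Antitone a) (hb : Antitone b)
    (h : Finset.univ.val.map a = Finset.univ.val.map b) : a = b := by
  rw [Fin.univ_val_map, Fin.univ_val_map, Multiset.coe_eq_coe] at h
  apply List.ofFn_injective
  refine h.eq_of_pairwise (le := fun x y => y ≤ x) (fun x y _ _ h1 h2 => le_antisymm h2 h1) ?_ ?_
  · rw [List.pairwise_ofFn]; exact fun i j hij => ha hij.le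
  · rw [List.pairwise_ofFn]; exact fun i j hij => hb hij.le

lemma HasSpec.roots {n : ℕ} {S : Matrix (Fin n) (Fin n) ℂ} {a : Fin n → ℝ} (h : HasSpec S a) :
    S.charpoly.roots = (Finset.univ.val.map a).map (fun x : ℝ => (x : ℂ)) := by
  rw [h]
  have := Polynomial.roots_multiset_prod_X_sub_C (Finset.univ.val.map (fun i => ((a i : ℝ) : ℂ)))
  rw [Multiset.map_map] at this
  rw [Multiset.map_map]
  exact this

lemma HasSpec.multiset_eq {n : ℕ} {S : Matrix (Fin n) (Fin n) ℂ} {a b : Fin n → ℝ}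
    (h : HasSpec S a) (h' : HasSpec S b) :
    Finset.univ.val.map a = Finset.univ.val.map b := by
  have := h.roots.symm.trans h'.roots
  exact Multiset.map_injective Complex.ofReal_injective this

lemma HasSpec.unique {n : ℕ} {S : Matrix (Fin n) (Fin n) ℂ} {a b : Fin n → ℝ}
    (h : HasSpec S a) (h' : HasSpec S b) (ha : Antitone a) (hb : Antitone b) : a = b :=
  antitone_unique ha hb (h.multiset_eq h')

lemma hasSpec_of_multiset {n : ℕ} {S : Matrix (Fin n) (Fin n) ℂ} {a b : Fin n → ℝ}
    (h : HasSpec S a) (hab : Finset.univ.val.map a = Finset.univ.val.map b) : HasSpec S b := by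
  unfold HasSpec at *
  rw [h]
  have e : ∀ c : Fin n → ℝ, ∏ i, (X - C ((c i : ℝ) : ℂ)) =
    ((Finset.univ.val.map c).map (fun x : ℝ => (X - C (x : ℂ)))).prod := by
    intro c; rw [Multiset.map_map]; rfl
  rw [e, e, hab]

lemma hasSpec_eigenvalues {n : ℕ} {S : Matrix (Fin n) (Fin n) ℂ} (hS : S.IsHermitian) :
    HasSpec S hS.eigenvalues := hS.charpoly_eq

lemma hasSpec_perm {n : ℕ} {S : Matrix (Fin n) (Fin n) ℂ} {a : Fin n → ℝ} (h : HasSpec S a)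
    (e : Equiv.Perm (Fin n)) : HasSpec S (a ∘ e) := by
  unfold HasSpec at *
  rw [h]
  exact (Equiv.prod_comp e (fun i => (X - C ((a i : ℝ) : ℂ)))).symm

lemma hasSpec_eigsDesc {n : ℕ} {S : Matrix (Fin n) (Fin n) ℂ} (hS : S.IsHermitian) :
    HasSpec S (eigsDesc hS) := by
  have := hasSpec_perm (hasSpec_eigenvalues hS) (Fin.revPerm.trans (Tuple.sort hS.eigenvalues))
  exact this

lemma eigsDesc_antitone {n : ℕ} {S : Matrix (Fin n) (Fin n) ℂ} (hS : S.IsHermitian) :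
    Antitone (eigsDesc hS) := by
  intro i j hij
  exact Tuple.monotone_sort hS.eigenvalues (Fin.rev_le_rev.mpr hij)

lemma diag_pow_conj {n : ℕ} (U D : Matrix (Fin n) (Fin n) ℂ) (V : Matrix (Fin n) (Fin n) ℂ)
    (h : V * U = 1) (h' : U * V = 1) (k : ℕ) : (U * D * V) ^ k = U * D ^ k * V := by
  induction k with
  | zero => simp [h']
  | succ k ih =>
    rw [pow_succ, ih]
    rw [show U * D ^ k * V * (U * D * V) = U * D ^ k * (V * U) * D * V by
        simp only [Matrix.mul_assoc], h, pow_succ]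
    simp [Matrix.mul_assoc]

/-- spectral decomposition in convenient form -/
lemma exists_diag {n : ℕ} {S : Matrix (Fin n) (Fin n) ℂ} (hS : S.IsHermitian) :
    ∃ U : Matrix (Fin n) (Fin n) ℂ, U * Uᴴ = 1 ∧ Uᴴ * U = 1 ∧
      S = U * Matrix.diagonal (fun i => (hS.eigenvalues i : ℂ)) * Uᴴ := by
  refine ⟨hS.eigenvectorUnitary, ?_, ?_, ?_⟩
  · exact Unitary.mul_star_self_of_mem hS.eigenvectorUnitary.2
  · exact Unitary.star_mul_self_of_mem hS.eigenvectorUnitary.2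
  · exact hS.spectral_theorem

/-- spectral decomposition for a given spectrum -/
lemma exists_diag' {n : ℕ} {S : Matrix (Fin n) (Fin n) ℂ} (hS : S.IsHermitian) {a : Fin n → ℝ}
    (h : HasSpec S a) (ha : Antitone a) :
    ∃ U : Matrix (Fin n) (Fin n) ℂ, U * Uᴴ = 1 ∧ Uᴴ * U = 1 ∧
      S = U * Matrix.diagonal (fun i => (a i : ℂ)) * Uᴴ := by
  obtain ⟨U, h1, h2, h3⟩ := exists_diag hS
  have e := (hasSpec_eigsDesc hS).unique h (eigsDesc_antitone hS) ha
  set σ : Equiv.Perm (Fin n) := Fin.revPerm.trans (Tuple.sort hS.eigenvalues) with hσ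
  have e' : a = hS.eigenvalues ∘ σ := by rw [← e]; rfl
  refine ⟨U.submatrix id σ, ?_, ?_, ?_⟩
  · rw [Matrix.conjTranspose_submatrix, Matrix.submatrix_mul_equiv, h1]; simp
  · rw [Matrix.conjTranspose_submatrix,
      ← Matrix.submatrix_mul _ _ _ (id : Fin n → Fin n) _ Function.bijective_id, h2]
    simp
  · conv_lhs => rw [h3]
    have : Matrix.diagonal (fun i => (a i : ℂ)) =
      (Matrix.diagonal (fun i => (hS.eigenvalues i : ℂ))).submatrix σ σ := by
      rw [Matrix.submatrix_diagonal_equiv, e']; rfl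
    rw [this, Matrix.conjTranspose_submatrix, Matrix.submatrix_mul_equiv,
      Matrix.submatrix_mul_equiv]
    simp

lemma trace_pow_eigenvalues {n : ℕ} {S : Matrix (Fin n) (Fin n) ℂ} (hS : S.IsHermitian) (k : ℕ) :
    (S ^ k).trace = ∑ i, ((hS.eigenvalues i ^ k : ℝ) : ℂ) := by
  obtain ⟨U, h1, h2, h3⟩ := exists_diag hS
  conv_lhs => rw [h3]
  rw [diag_pow_conj _ _ _ h2 h1]
  rw [Matrix.trace_mul_cycle, h2, Matrix.diagonal_pow, one_mul, Matrix.trace_diagonal]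
  simp

lemma HasSpec.trace_pow {n : ℕ} {S : Matrix (Fin n) (Fin n) ℂ} (hS : S.IsHermitian)
    {a : Fin n → ℝ} (h : HasSpec S a) (k : ℕ) :
    (S ^ k).trace = ((∑ i, a i ^ k : ℝ) : ℂ) := by
  rw [trace_pow_eigenvalues hS]
  have e := (hasSpec_eigenvalues hS).multiset_eq h
  have : ∑ i, hS.eigenvalues i ^ k = ∑ i, a i ^ k := by
    have := congrArg (fun m => (m.map (fun x : ℝ => x ^ k)).sum) e
    simp only [Multiset.map_map] at this
    exact this
  rw [← this]; push_cast; rfl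

lemma HasSpec.det {n : ℕ} {S : Matrix (Fin n) (Fin n) ℂ}
    {a : Fin n → ℝ} (h : HasSpec S a) : S.det = ((∏ i, a i : ℝ) : ℂ) := by
  rw [Matrix.det_eq_prod_roots_charpoly, h.roots, Multiset.map_map]
  push_cast; rfl

lemma esymm_eq {n m : ℕ} {a b : Fin n → ℝ} (h : ∀ k, 1 ≤ k → k ≤ m → ∑ i, a i ^ k = ∑ i, b i ^ k) :
    ∀ k ≤ m, (Finset.univ.val.map a).esymm k = (Finset.univ.val.map b).esymm k := by
  intro k
  induction k using Nat.strong_induction_on with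
  | _ k ih =>
    intro hk
    rcases Nat.eq_zero_or_pos k with rfl | hk0
    · simp [Multiset.esymm, -Fin.univ_val_map]
    have ha := congrArg (MvPolynomial.aeval a) (MvPolynomial.mul_esymm_eq_sum (Fin n) ℝ k)
    have hb := congrArg (MvPolynomial.aeval b) (MvPolynomial.mul_esymm_eq_sum (Fin n) ℝ k)
    simp only [map_mul, map_natCast, MvPolynomial.aeval_esymm_eq_multiset_esymm, map_pow, map_neg,
      map_one, map_sum, MvPolynomial.psum, MvPolynomial.aeval_X] at ha hb
    have : (k : ℝ) * (Finset.univ.val.map a).esymm k = k * (Finset.univ.val.map b).esymm k := by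
      rw [ha, hb]
      congr 1
      apply Finset.sum_congr rfl
      intro p hp
      simp only [Finset.mem_filter, Finset.HasAntidiagonal.mem_antidiagonal] at hp
      rw [ih p.1 hp.2 (by omega), h p.2 (by omega) (by omega)]
    exact mul_left_cancel₀ (by positivity) this

lemma multiset_eq_of_esymm {n : ℕ} {a b : Fin n → ℝ}
    (h : ∀ k ≤ n, (Finset.univ.val.map a).esymm k = (Finset.univ.val.map b).esymm k) :
    Finset.univ.val.map a = Finset.univ.val.map b := by
  rw [← Polynomial.roots_multiset_prod_X_sub_C (Finset.univ.val.map a),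
    ← Polynomial.roots_multiset_prod_X_sub_C (Finset.univ.val.map b)]
  congr 1
  rw [Multiset.prod_X_sub_X_eq_sum_esymm, Multiset.prod_X_sub_X_eq_sum_esymm]
  simp only [Multiset.card_map, Finset.card_val, Finset.card_univ, Fintype.card_fin]
  apply Finset.sum_congr rfl
  intro j hj
  rw [h j (by simpa [Nat.lt_succ_iff] using hj)]

lemma esymm_card {n : ℕ} (a : Fin n → ℝ) : (Finset.univ.val.map a).esymm n = ∏ i, a i := by
  rw [← MvPolynomial.aeval_esymm_eq_multiset_esymm (Fin n) ℝ, MvPolynomial.esymm]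
  have : Finset.powersetCard n (Finset.univ : Finset (Fin n)) = {Finset.univ} := by
    have := Finset.powersetCard_self (Finset.univ : Finset (Fin n))
    simpa using this
  rw [this]; simp

lemma hasSpec_of_trace {n : ℕ} {S : Matrix (Fin n) (Fin n) ℂ} (hS : S.IsHermitian)
    {a : Fin n → ℝ} (h : ∀ k, 1 ≤ k → k ≤ n → (S ^ k).trace.re = ∑ i, a i ^ k) : HasSpec S a := by
  apply hasSpec_of_multiset (hasSpec_eigenvalues hS)
  apply multiset_eq_of_esymm
  apply esymm_eq
  intro k h1 h2
  rw [← h k h1 h2, trace_pow_eigenvalues hS, ← Complex.ofReal_sum, Complex.ofReal_re]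

lemma hasSpec_of_trace_det {n : ℕ} {S : Matrix (Fin n) (Fin n) ℂ} (hS : S.IsHermitian)
    {a : Fin n → ℝ} (h : ∀ k, 1 ≤ k → k < n → (S ^ k).trace.re = ∑ i, a i ^ k)
    (hdet : S.det = ((∏ i, a i : ℝ) : ℂ)) : HasSpec S a := by
  apply hasSpec_of_multiset (hasSpec_eigenvalues hS)
  apply multiset_eq_of_esymm
  intro k hk
  rcases hk.lt_or_eq with hk | rfl
  · refine esymm_eq (m := n - 1) ?_ k (by omega)
    intro k h1 h2
    rw [← h k h1 (by omega), trace_pow_eigenvalues hS, ← Complex.ofReal_sum, Complex.ofReal_re]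
  · rw [esymm_card, esymm_card]
    have := (hasSpec_eigenvalues hS).det.symm.trans hdet
    exact_mod_cast this

end Horn


namespace Horn

/-- Fourier–Motzkin elimination of a finitely generated space of directions. -/
lemma fourierMotzkin {E : Type*} [AddCommGroup E] [Module ℝ E] (W : Submodule ℝ E) (hW : W.FG) :
    ∀ (ι : Type) [Fintype ι] (g : ι → E →ₗ[ℝ] ℝ), ∃ (κ : Type) (_ : Fintype κ) (c : κ → ι → ℝ),
      (∀ j i, 0 ≤ c j i) ∧ (∀ j, ∀ w ∈ W, ∑ i, c j i * g i w = 0) ∧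
      ∀ x, (∀ j, 0 ≤ ∑ i, c j i * g i x) → ∃ w ∈ W, ∀ i, 0 ≤ g i (x + w) := by
  classical
  induction W, hW using Submodule.fg_induction with
  | singleton d =>
    intro ι _ g
    refine ⟨ι ⊕ (ι × ι), inferInstance, Sum.elim
      (fun j i => if g j d = 0 ∧ i = j then 1 else 0)
      (fun p i => if 0 < g p.1 d ∧ g p.2 d < 0 then
        (if i = p.1 then - g p.2 d else 0) + (if i = p.2 then g p.1 d else 0) else 0), ?_, ?_, ?_⟩
    · rintro (j | p) i
      · simp only [Sum.elim_inl]; split_ifs <;> norm_num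
      · simp only [Sum.elim_inr]
        split_ifs <;> linarith
    · intro j w hw
      obtain ⟨t, rfl⟩ := Submodule.mem_span_singleton.mp hw
      rcases j with j | p
      · simp only [Sum.elim_inl]
        apply Finset.sum_eq_zero
        intro i _
        split_ifs with h
        · rw [h.2]; simp [h.1]
        · simp
      · simp only [Sum.elim_inr]
        split_ifs with h
        · simp only [add_mul, Finset.sum_add_distrib, ite_mul, zero_mul, Finset.sum_ite_eq',
            Finset.mem_univ, if_true, map_smul, smul_eq_mul]
          ring
        · simp
    · intro x hx
      have hz : ∀ j, g j d = 0 → 0 ≤ g j x := by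
        intro j hj
        have := hx (Sum.inl j)
        simpa [hj] using this
      have hpn : ∀ i j, 0 < g i d → g j d < 0 → 0 ≤ - g j d * g i x + g i d * g j x := by
        intro i j hi hj
        have := hx (Sum.inr (i, j))
        simpa [hi, hj, add_mul, Finset.sum_add_distrib] using this
      obtain ⟨u, hu⟩ : ∃ u : ℝ, (∀ i, 0 < g i d → - g i x / g i d ≤ u) ∧
          (∀ j, g j d < 0 → u ≤ - g j x / g j d) := by
        have key : ∀ i j, 0 < g i d → g j d < 0 → - g i x / g i d ≤ - g j x / g j d := by
          intro i j hi hj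
          have h0 := hpn i j hi hj
          rw [← neg_div_neg_eq (- g j x), div_le_div_iff₀ hi (by linarith)]
          nlinarith
        let P : Finset ι := Finset.univ.filter (fun i => 0 < g i d)
        let N : Finset ι := Finset.univ.filter (fun i => g i d < 0)
        by_cases hP : P.Nonempty
        · refine ⟨P.sup' hP (fun i => - g i x / g i d), ?_, ?_⟩
          · intro i hi
            exact Finset.le_sup' (fun i => - g i x / g i d) (by simpa [P] using hi)
          · intro j hj
            apply Finset.sup'_le
            intro i hi
            exact key i j (by simpa [P] using hi) hj
        · have hP' : ∀ i, ¬ 0 < g i d := by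
            intro i hi; exact hP ⟨i, by simpa [P] using hi⟩
          by_cases hN : N.Nonempty
          · refine ⟨N.inf' hN (fun i => - g i x / g i d), fun i hi => absurd hi (hP' i), ?_⟩
            intro j hj
            exact Finset.inf'_le (fun i => - g i x / g i d) (by simpa [N] using hj)
          · exact ⟨0, fun i hi => absurd hi (hP' i),
              fun j hj => absurd ⟨j, by simpa [N] using hj⟩ hN⟩
      refine ⟨u • d, Submodule.smul_mem _ _ (Submodule.mem_span_singleton_self d), ?_⟩
      intro i
      rw [map_add, map_smul, smul_eq_mul]
      rcases lt_trichotomy (g i d) 0 with h | h | h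
      · have := hu.2 i h
        rw [← neg_div_neg_eq, le_div_iff₀ (by linarith)] at this
        linarith
      · rw [h]; simpa using hz i h
      · have := hu.1 i h
        rw [div_le_iff₀ h] at this
        linarith
  | sup W₁ W₂ _ _ h1 h2 =>
    intro ι _ g
    obtain ⟨κ₁, _, c₁, p₁, v₁, e₁⟩ := h1 ι g
    obtain ⟨κ₂, _, c₂, p₂, v₂, e₂⟩ := h2 κ₁ (fun j => ∑ i, c₁ j i • g i)
    have key : ∀ k x, ∑ i, (∑ j, c₂ k j * c₁ j i) * g i x =
        ∑ j, c₂ k j * (∑ i, c₁ j i • g i) x := by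
      intro k x
      simp only [LinearMap.sum_apply, LinearMap.smul_apply, smul_eq_mul, Finset.mul_sum,
        Finset.sum_mul]
      rw [Finset.sum_comm]
      simp only [mul_assoc]
    refine ⟨κ₂, inferInstance, fun k i => ∑ j, c₂ k j * c₁ j i, ?_, ?_, ?_⟩
    · intro k i
      exact Finset.sum_nonneg fun j _ => mul_nonneg (p₂ k j) (p₁ j i)
    · intro k w hw
      obtain ⟨w₁, hw₁, w₂, hw₂, rfl⟩ := Submodule.mem_sup.mp hw
      rw [key]
      simp only [map_add, mul_add, Finset.sum_add_distrib]
      rw [v₂ k w₂ hw₂, add_zero]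
      apply Finset.sum_eq_zero
      intro j _
      simp only [LinearMap.sum_apply, LinearMap.smul_apply, smul_eq_mul]
      rw [v₁ j w₁ hw₁, mul_zero]
    · intro x hx
      obtain ⟨w₂, hw₂, h⟩ := e₂ x (fun k => by rw [← key]; exact hx k)
      obtain ⟨w₁, hw₁, h'⟩ := e₁ (x + w₂) (fun j => by
        simpa only [LinearMap.sum_apply, LinearMap.smul_apply, smul_eq_mul] using h j)
      refine ⟨w₁ + w₂, Submodule.add_mem_sup hw₁ hw₂, ?_⟩
      intro i
      have := h' i
      rwa [show x + w₂ + w₁ = x + (w₁ + w₂) by abel] at this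

/-- The form used later: a projection of a polyhedral cone, together with control of slack. -/
lemma projection_polyhedral {E F : Type*} [AddCommGroup E] [Module ℝ E] [AddCommGroup F]
    [Module ℝ F] [FiniteDimensional ℝ F] (ι : Type) [Fintype ι] (g : ι → (E × F) →ₗ[ℝ] ℝ) :
    ∃ (m : ℕ) (f : Fin m → E →ₗ[ℝ] ℝ),
      (∀ x, (∀ j, 0 ≤ f j x) → ∃ h, ∀ i, 0 ≤ g i (x, h)) ∧
      (∀ K : ℝ, ∃ K' : ℝ, ∀ x, (∃ h, ∀ i, -K ≤ g i (x, h)) → ∀ j, -K' ≤ f j x) := by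
  classical
  have hfg : (LinearMap.range (LinearMap.inr ℝ E F)).FG := by
    rw [LinearMap.range_eq_map]
    exact Submodule.FG.map _ (Module.Finite.fg_top)
  obtain ⟨κ, _, c, p, v, e⟩ := fourierMotzkin (LinearMap.range (LinearMap.inr ℝ E F)) hfg ι g
  let f : κ → E →ₗ[ℝ] ℝ := fun j => (∑ i, c j i • g i) ∘ₗ LinearMap.inl ℝ E F
  have hf : ∀ j x, f j x = ∑ i, c j i * g i (x, 0) := by
    intro j x
    simp [f, LinearMap.sum_apply]
  have hf' : ∀ j x h, f j x = ∑ i, c j i * g i (x, h) := by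
    intro j x h
    have := v j (0, h) ⟨h, by simp⟩
    rw [hf, ← add_zero (∑ i, c j i * g i (x, 0)), ← this, ← Finset.sum_add_distrib]
    apply Finset.sum_congr rfl
    intro i _
    rw [← mul_add, ← map_add]; simp
  refine ⟨Fintype.card κ, fun j => f ((Fintype.equivFin κ).symm j), ?_, ?_⟩
  · intro x hx
    have hx' : ∀ j, 0 ≤ f j x := by
      intro j; simpa using hx (Fintype.equivFin κ j)
    obtain ⟨w, ⟨h, rfl⟩, hw⟩ := e (x, 0) (fun j => by rw [← hf]; exact hx' j)
    exact ⟨h, fun i => by simpa using hw i⟩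
  · intro K
    refine ⟨∑ j, ∑ i, c j i * |K|, ?_⟩
    rintro x ⟨h, hh⟩ j
    rw [hf' _ x h]
    have h1 : ∀ j, 0 ≤ ∑ i, c j i * |K| := fun j =>
      Finset.sum_nonneg fun i _ => mul_nonneg (p j i) (abs_nonneg _)
    have h2 : ∑ i, c ((Fintype.equivFin κ).symm j) i * |K| ≤ ∑ j, ∑ i, c j i * |K| :=
      Finset.single_le_sum (f := fun j => ∑ i, c j i * |K|) (fun j _ => h1 j) (Finset.mem_univ _)
    have h3 : -(∑ i, c ((Fintype.equivFin κ).symm j) i * |K|) ≤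
        ∑ i, c ((Fintype.equivFin κ).symm j) i * g i (x, h) := by
      rw [← Finset.sum_neg_distrib]
      apply Finset.sum_le_sum
      intro i _
      have := hh i
      have hk := le_abs_self K
      nlinarith [p ((Fintype.equivFin κ).symm j) i]
    linarith

end Horn


namespace Horn
open scoped ComplexOrder

lemma posDef_mul_conj {n : ℕ} {A : Matrix (Fin n) (Fin n) ℂ} (h : A.det ≠ 0) :
    (A * Aᴴ).PosDef := by
  apply Matrix.PosDef.mul_conjTranspose_self
  rw [Matrix.vecMul_injective_iff_isUnit, Matrix.isUnit_iff_isUnit_det]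
  exact h.isUnit

lemma posDef_conj_mul {n : ℕ} {A : Matrix (Fin n) (Fin n) ℂ} (h : A.det ≠ 0) :
    (Aᴴ * A).PosDef := by
  apply Matrix.PosDef.conjTranspose_mul_self
  rw [Matrix.mulVec_injective_iff_isUnit, Matrix.isUnit_iff_isUnit_det]
  exact h.isUnit

lemma posDef_conj_same {n : ℕ} {S A : Matrix (Fin n) (Fin n) ℂ} (hS : S.PosDef) (h : A.det ≠ 0) :
    (A * S * Aᴴ).PosDef := by
  apply hS.mul_mul_conjTranspose_same
  rw [Matrix.vecMul_injective_iff_isUnit, Matrix.isUnit_iff_isUnit_det]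
  exact h.isUnit

lemma det_ne_zero_of_hasSpec {n : ℕ} {A : Matrix (Fin n) (Fin n) ℂ} {a : Fin n → ℝ}
    (h : HasSpec (A * Aᴴ) (fun i => Real.exp (a i))) : A.det ≠ 0 := by
  intro h0
  have := h.det
  rw [Matrix.det_mul, h0, zero_mul] at this
  have h2 : (0:ℝ) < ∏ i, Real.exp (a i) := Finset.prod_pos fun i _ => Real.exp_pos _
  have h3 : (∏ i, Real.exp (a i)) = 0 := by exact_mod_cast this.symm
  linarith

lemma hasSpec_mul_comm {n : ℕ} {A B : Matrix (Fin n) (Fin n) ℂ} {a : Fin n → ℝ} :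
    HasSpec (A * B) a ↔ HasSpec (B * A) a := by
  unfold HasSpec; rw [Matrix.charpoly_mul_comm]

lemma HasSpec.pos {n : ℕ} {S : Matrix (Fin n) (Fin n) ℂ} (hS : S.PosDef) {a : Fin n → ℝ}
    (h : HasSpec S a) (i : Fin n) : 0 < a i := by
  have e := (hasSpec_eigenvalues hS.1).multiset_eq h
  have : a i ∈ Finset.univ.val.map hS.1.eigenvalues := by
    rw [e]; exact Multiset.mem_map_of_mem _ (Finset.mem_univ i)
  obtain ⟨j, _, hj⟩ := Multiset.mem_map.mp this
  rw [← hj]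
  exact hS.eigenvalues_pos j

/-- every positive definite matrix has logarithmic spectrum -/
lemma exists_log_spec {n : ℕ} {S : Matrix (Fin n) (Fin n) ℂ} (hS : S.PosDef) :
    ∃ a : Fin n → ℝ, Antitone a ∧ HasSpec S (fun i => Real.exp (2 * a i)) ∧
      a = fun i => (1/2) * Real.log (eigsDesc hS.1 i) := by
  have hp : ∀ i, 0 < eigsDesc hS.1 i := fun i => (hasSpec_eigsDesc hS.1).pos hS i
  refine ⟨fun i => (1/2) * Real.log (eigsDesc hS.1 i), ?_, ?_, rfl⟩
  · intro i j hij
    have := Real.log_le_log (hp j) (eigsDesc_antitone hS.1 hij)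
    simp only; linarith
  · convert hasSpec_eigsDesc hS.1 using 2 with i
    rw [show 2 * ((1/2) * Real.log (eigsDesc hS.1 i)) = Real.log (eigsDesc hS.1 i) by ring,
      Real.exp_log (hp i)]

lemma log_eigs_eq {n : ℕ} {S : Matrix (Fin n) (Fin n) ℂ} (hS : S.IsHermitian)
    {a : Fin n → ℝ} (ha : Antitone a) (h : HasSpec S (fun i => Real.exp (2 * a i))) (i : Fin n) :
    Real.log (eigsDesc hS i) = 2 * a i := by
  have := (hasSpec_eigsDesc hS).unique h (eigsDesc_antitone hS) (by
    intro i j hij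
    exact Real.exp_le_exp.mpr (by linarith [ha hij]))
  rw [this, Real.log_exp]

/-- phases -/
lemma exists_phase {n : ℕ} (T : Matrix (Fin n) (Fin n) ℂ) (hT : ∀ i j : Fin n, j < i → T i j = 0)
    (hd : T.det ≠ 0) : ∃ T' ∈ UpperTriPos n, T'ᴴ * T' = Tᴴ * T := by
  have hd' : ∀ i, T i i ≠ 0 := by
    rw [Matrix.det_of_isUpperTriangular (fun i j h => hT i j h)] at hd
    intro i; exact Finset.prod_ne_zero_iff.mp hd i (Finset.mem_univ i)
  let φ : Fin n → ℂ := fun i => (starRingEnd ℂ (T i i)) / ‖T i i‖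
  refine ⟨Matrix.diagonal φ * T, ⟨?_, ?_⟩, ?_⟩
  · intro i j h
    rw [Matrix.diagonal_mul, hT i j h, mul_zero]
  · intro i
    have h0 : (0:ℝ) < ‖T i i‖ := norm_pos_iff.mpr (hd' i)
    have : (Matrix.diagonal φ * T) i i = (‖T i i‖ : ℂ) := by
      rw [Matrix.diagonal_mul]
      simp only [φ]
      rw [div_mul_eq_mul_div, div_eq_iff (by exact_mod_cast h0.ne'), mul_comm, Complex.mul_conj,
        Complex.normSq_eq_norm_sq]
      push_cast; ring
    rw [this]
    exact ⟨by simpa using h0, by simp⟩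
  · have hφ : (Matrix.diagonal φ)ᴴ * Matrix.diagonal φ = 1 := by
      rw [Matrix.diagonal_conjTranspose, Matrix.diagonal_mul_diagonal, ← Matrix.diagonal_one]
      congr 1
      ext i
      have h0 : (0:ℝ) < ‖T i i‖ := norm_pos_iff.mpr (hd' i)
      have h0' : (‖T i i‖ : ℂ) ≠ 0 := by exact_mod_cast h0.ne'
      simp only [φ, Pi.star_apply, star_div₀]
      have e1 : star (starRingEnd ℂ (T i i)) = T i i := by simp
      have e2 : star (‖T i i‖ : ℂ) = ‖T i i‖ := by simp
      rw [e1, e2, div_mul_div_comm, Complex.mul_conj, Complex.normSq_eq_norm_sq]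
      push_cast; field_simp
    rw [Matrix.conjTranspose_mul, Matrix.mul_assoc, ← Matrix.mul_assoc _ _ T, hφ, Matrix.one_mul]

lemma cholesky {n : ℕ} {S : Matrix (Fin n) (Fin n) ℂ} (hS : S.PosDef) :
    ∃ T ∈ UpperTriPos n, Tᴴ * T = S := by
  have hM : IsUnit (LDL.lowerInv hS).det := by
    rw [← Matrix.isUnit_iff_isUnit_det]; exact isUnit_of_invertible _
  have hD : (LDL.diag hS).PosDef := by
    rw [LDL.diag_eq_lowerInv_conj]
    exact posDef_conj_same hS hM.ne_zero
  have hd : ∀ i, 0 < LDL.diagEntries hS i := by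
    rw [LDL.diag, Matrix.posDef_diagonal_iff] at hD
    exact hD
  have hL : (LDL.lower hS)ᵀ.IsUpperTriangular := by
    have h1 : (LDL.lowerInv hS)ᵀ.IsUpperTriangular := by
      intro i j h
      exact LDL.lowerInv_triangular hS h
    rw [LDL.lower, Matrix.transpose_nonsing_inv]
    exact Matrix.blockTriangular_inv_of_blockTriangular h1
  let s : Fin n → ℂ := fun i => (Real.sqrt (LDL.diagEntries hS i).re : ℂ)
  have hs : ∀ i, star (s i) * s i = LDL.diagEntries hS i := by
    intro i
    have h1 := Complex.pos_iff.mp (hd i)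
    have e : star (s i) = s i := by simp [s]
    rw [e]
    simp only [s]
    rw [← Complex.ofReal_mul, Real.mul_self_sqrt h1.1.le]
    apply Complex.ext
    · simp
    · simp [h1.2.symm]
  have key : (Matrix.diagonal s * (LDL.lower hS)ᴴ)ᴴ * (Matrix.diagonal s * (LDL.lower hS)ᴴ) = S := by
    rw [Matrix.conjTranspose_mul, Matrix.conjTranspose_conjTranspose,
      Matrix.diagonal_conjTranspose, Matrix.mul_assoc, ← Matrix.mul_assoc (Matrix.diagonal _),
      Matrix.diagonal_mul_diagonal]
    conv_rhs => rw [← LDL.lower_conj_diag hS, LDL.diag, Matrix.mul_assoc]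
    simp only [Pi.star_apply, hs]
  obtain ⟨T', h1, h2⟩ := exists_phase (Matrix.diagonal s * (LDL.lower hS)ᴴ) (by
    intro i j h
    rw [Matrix.diagonal_mul, Matrix.conjTranspose_apply]
    have : LDL.lower hS j i = 0 := hL h
    rw [this]; simp) (by
    intro h0
    have h3 := congrArg Matrix.det key
    rw [Matrix.det_mul, h0, mul_zero] at h3
    exact hS.det_pos.ne h3)
  exact ⟨T', h1, h2.trans key⟩

lemma cholesky' {n : ℕ} {S : Matrix (Fin n) (Fin n) ℂ} (hS : S.PosDef) :
    ∃ T ∈ UpperTriPos n, T * Tᴴ = S := by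
  have h1 : (S.submatrix Fin.rev Fin.rev).PosDef := hS.submatrix Fin.rev_injective
  obtain ⟨T, hT, h⟩ := cholesky h1
  refine ⟨(T.submatrix Fin.revPerm Fin.revPerm)ᴴ, ⟨?_, ?_⟩, ?_⟩
  · intro i j hij
    simp only [Matrix.conjTranspose_apply, Matrix.submatrix_apply, Fin.revPerm_apply]
    rw [hT.1 _ _ (by simpa using hij)]; simp
  · intro i
    have := hT.2 i.rev
    simp [this]
  · rw [Matrix.conjTranspose_conjTranspose, Matrix.conjTranspose_submatrix,
      Matrix.submatrix_mul_equiv, h]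
    ext i j; simp

/-- The partial sum map. -/
noncomputable def psum (n : ℕ) : (Fin n → ℝ) →ₗ[ℝ] (Fin n → ℝ) where
  toFun a := fun i => ∑ j ∈ Finset.Iic i, a j
  map_add' a b := by ext i; simp [Finset.sum_add_distrib]
  map_smul' c a := by ext i; simp [Finset.mul_sum]

lemma psum_injective (n : ℕ) : Function.Injective (psum n) := by
  rw [injective_iff_map_eq_zero]
  intro a ha
  have h : ∀ i, ∑ j ∈ Finset.Iic i, a j = 0 := fun i => congrFun ha i
  ext i
  induction i using WellFoundedLT.induction with
  | _ i ih =>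
    have := h i
    rw [← Finset.Iio_insert i, Finset.sum_insert (by simp), Finset.sum_eq_zero] at this
    · simpa using this
    · intro j hj; exact ih j (by simpa using hj)

/-- psum as an equivalence on triples -/
noncomputable def psumEquiv (n : ℕ) : ((Fin n → ℝ) × (Fin n → ℝ) × (Fin n → ℝ)) ≃ₗ[ℝ]
    ((Fin n → ℝ) × (Fin n → ℝ) × (Fin n → ℝ)) :=
  let e := LinearEquiv.ofInjectiveEndo (psum n) (psum_injective n)
  e.prodCongr (e.prodCongr e)

lemma psumEquiv_apply {n : ℕ} (x : (Fin n → ℝ) × (Fin n → ℝ) × (Fin n → ℝ)) :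
    psumEquiv n x = (psum n x.1, psum n x.2.1, psum n x.2.2) := rfl

lemma lB_eq {n : ℕ} {A : Matrix (Fin n) (Fin n) ℂ} {a : Fin n → ℝ} (ha : Antitone a)
    (h : HasSpec (A * Aᴴ) (fun i => Real.exp (2 * a i))) : lB A = psum n a := by
  ext i
  simp only [lB, psum, LinearMap.coe_mk, AddHom.coe_mk]
  rw [Finset.mul_sum]
  apply Finset.sum_congr rfl
  intro j _
  rw [log_eigs_eq _ ha h]; ring

lemma UpperTriPos.det_ne_zero {n : ℕ} {A : Matrix (Fin n) (Fin n) ℂ} (hA : A ∈ UpperTriPos n) :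
    A.det ≠ 0 := by
  rw [Matrix.det_of_isUpperTriangular (fun i j h => hA.1 i j h)]
  apply Finset.prod_ne_zero_iff.mpr
  intro i _ h
  have := (hA.2 i).1
  rw [h] at this; simp at this

lemma mem_hornCone_iff {n : ℕ} (x : (Fin n → ℝ) × (Fin n → ℝ) × (Fin n → ℝ)) :
    psumEquiv n x ∈ HornConeB n ↔ x ∈ Cone n := by
  constructor
  · rintro ⟨A, C, hA, hC, h1, h2, h3⟩
    have dA := UpperTriPos.det_ne_zero hA
    have dC := UpperTriPos.det_ne_zero hC
    have dAC : (A * C).det ≠ 0 := by rw [Matrix.det_mul]; exact mul_ne_zero dA dC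
    obtain ⟨a, ha, ha', -⟩ := exists_log_spec (posDef_mul_conj dA)
    obtain ⟨c, hc, hc', -⟩ := exists_log_spec (posDef_mul_conj dC)
    obtain ⟨t, ht, ht', -⟩ := exists_log_spec (posDef_mul_conj dAC)
    rw [lB_eq ha ha', psumEquiv_apply] at h1
    rw [lB_eq hc hc', psumEquiv_apply] at h2
    rw [lB_eq ht ht', psumEquiv_apply] at h3
    have e1 := psum_injective n h1
    have e2 := psum_injective n h2
    have e3 := psum_injective n h3
    subst e1 e2 e3
    exact ⟨ha, hc, ht, A, C, ha', hc', ht'⟩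
  · rintro ⟨ha, hc, ht, A, C, hA, hC, hAC⟩
    obtain ⟨A', hA', eA⟩ := cholesky (posDef_conj_mul (det_ne_zero_of_hasSpec hA))
    obtain ⟨C', hC', eC⟩ := cholesky' (posDef_mul_conj (det_ne_zero_of_hasSpec hC))
    refine ⟨A', C', hA', hC', ?_, ?_, ?_⟩
    · rw [psumEquiv_apply]
      apply lB_eq ha
      rw [hasSpec_mul_comm, eA, hasSpec_mul_comm]; exact hA
    · rw [psumEquiv_apply]
      apply lB_eq hc
      rw [eC]; exact hC
    · rw [psumEquiv_apply]
      apply lB_eq ht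
      rw [Matrix.conjTranspose_mul, Matrix.mul_assoc, hasSpec_mul_comm, Matrix.mul_assoc,
        Matrix.mul_assoc, eA, ← Matrix.mul_assoc, eC, ← Matrix.mul_assoc, hasSpec_mul_comm]
      rw [Matrix.conjTranspose_mul, Matrix.mul_assoc, hasSpec_mul_comm] at hAC
      rw [hasSpec_mul_comm]
      simpa only [Matrix.mul_assoc] using hAC

end Horn


namespace Horn
open Filter Topology
open scoped ComplexOrder

lemma sum_sq_le_of_hasSpec {n : ℕ} {S : Matrix (Fin n) (Fin n) ℂ} (hS : S.IsHermitian)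
    {a : Fin n → ℝ} (h : HasSpec S a) (i : Fin n) : a i ^ 2 ≤ (S ^ 2).trace.re := by
  rw [h.trace_pow hS, Complex.ofReal_re]
  exact Finset.single_le_sum (f := fun i => a i ^ 2) (fun j _ => sq_nonneg _) (Finset.mem_univ i)

lemma continuous_trace_pow {n : ℕ} (k : ℕ) :
    Continuous (fun S : Matrix (Fin n) (Fin n) ℂ => (S ^ k).trace.re) := by
  refine Complex.continuous_re.comp ?_
  exact Continuous.matrix_trace (continuous_pow k)

lemma hasSpec_of_tendsto {n : ℕ} {S : ℕ → Matrix (Fin n) (Fin n) ℂ} {S₀ : Matrix (Fin n) (Fin n) ℂ}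
    {a : ℕ → Fin n → ℝ} {a₀ : Fin n → ℝ} (hS : ∀ m, (S m).IsHermitian) (hS₀ : S₀.IsHermitian)
    (h : ∀ m, HasSpec (S m) (a m)) (hl : Tendsto S atTop (𝓝 S₀)) (ha : Tendsto a atTop (𝓝 a₀)) :
    HasSpec S₀ a₀ := by
  apply hasSpec_of_trace hS₀
  intro k _ _
  have h1 := (continuous_trace_pow k).continuousAt.tendsto.comp hl
  have h2 : Tendsto (fun m => ∑ i, a m i ^ k) atTop (𝓝 (∑ i, a₀ i ^ k)) := by
    apply tendsto_finsetSum
    intro i _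
    exact (tendsto_pi_nhds.mp ha i).pow k
  refine tendsto_nhds_unique h1 (h2.congr ?_)
  intro m
  simp only [Function.comp]
  rw [(h m).trace_pow (hS m), Complex.ofReal_re]

lemma isClosed_antitone (n : ℕ) : IsClosed {a : Fin n → ℝ | Antitone a} := by
  have : {a : Fin n → ℝ | Antitone a} = ⋂ i, ⋂ j, ⋂ (_ : i ≤ j), {a | a j ≤ a i} := by
    ext a; simp [Antitone]
  rw [this]
  refine isClosed_iInter fun i => isClosed_iInter fun j => isClosed_iInter fun _ => ?_
  exact isClosed_le (continuous_apply j) (continuous_apply i)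

lemma spec_tendsto {n : ℕ} {S : ℕ → Matrix (Fin n) (Fin n) ℂ} {S₀ : Matrix (Fin n) (Fin n) ℂ}
    {a : ℕ → Fin n → ℝ} {a₀ : Fin n → ℝ} (hS : ∀ m, (S m).IsHermitian) (hS₀ : S₀.IsHermitian)
    (h : ∀ m, HasSpec (S m) (a m)) (h₀ : HasSpec S₀ a₀)
    (ha : ∀ m, Antitone (a m)) (ha₀ : Antitone a₀)
    (hl : Tendsto S atTop (𝓝 S₀)) : Tendsto a atTop (𝓝 a₀) := by
  have hb := ((continuous_trace_pow 2).continuousAt.tendsto.comp hl).bddAbove_range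
  obtain ⟨R, hR⟩ := hb
  have hbd : ∀ m, a m ∈ Set.pi Set.univ (fun _ : Fin n => Set.Icc (-(R+1)) (R+1)) := by
    intro m i _
    have h1 := sum_sq_le_of_hasSpec (hS m) (h m) i
    have h2 : ((S m)^2).trace.re ≤ R := hR ⟨m, rfl⟩
    constructor <;> nlinarith [sq_nonneg (a m i - 1), sq_nonneg (a m i + 1), sq_nonneg (a m i)]
  have hc : IsCompact (Set.pi Set.univ (fun _ : Fin n => Set.Icc (-(R+1)) (R+1))) :=
    isCompact_univ_pi fun _ => isCompact_Icc
  apply tendsto_of_subseq_tendsto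
  intro ns hns
  obtain ⟨b, _, φ, hφ, hb⟩ := hc.tendsto_subseq (x := fun m => a (ns m)) (fun m => hbd _)
  refine ⟨φ, ?_⟩
  have h1 : HasSpec S₀ b := hasSpec_of_tendsto (S := fun m => S (ns (φ m)))
    (fun m => hS _) hS₀ (fun m => h _) (hl.comp (hns.comp hφ.tendsto_atTop)) hb
  have h2 : Antitone b := (isClosed_antitone n).mem_of_tendsto hb
    (Eventually.of_forall fun m => ha _)
  rw [h₀.unique h1 ha₀ h2]
  exact hb

lemma log_spec_tendsto {n : ℕ} {S : ℕ → Matrix (Fin n) (Fin n) ℂ}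
    {S₀ : Matrix (Fin n) (Fin n) ℂ}
    {a : ℕ → Fin n → ℝ} {a₀ : Fin n → ℝ} (hS : ∀ m, (S m).IsHermitian) (hS₀ : S₀.IsHermitian)
    (h : ∀ m, HasSpec (S m) (fun i => Real.exp (2 * a m i)))
    (h₀ : HasSpec S₀ (fun i => Real.exp (2 * a₀ i)))
    (ha : ∀ m, Antitone (a m)) (ha₀ : Antitone a₀)
    (hl : Tendsto S atTop (𝓝 S₀)) : Tendsto a atTop (𝓝 a₀) := by
  have mono : ∀ {b : Fin n → ℝ}, Antitone b → Antitone (fun i => Real.exp (2 * b i)) := by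
    intro b hb i j hij
    exact Real.exp_le_exp.mpr (by linarith [hb hij])
  have := spec_tendsto hS hS₀ h h₀ (fun m => mono (ha m)) (mono ha₀) hl
  rw [tendsto_pi_nhds] at this ⊢
  intro i
  have h1 := ((Real.continuousAt_log (Real.exp_pos (2 * a₀ i)).ne').tendsto.comp (this i)).const_mul
    (1/2 : ℝ)
  simpa [Function.comp_def] using h1

lemma entry_bound {n : ℕ} {A : Matrix (Fin n) (Fin n) ℂ} {a : Fin n → ℝ}
    (h : HasSpec (A * Aᴴ) a) (i j : Fin n) : ‖A i j‖ ^ 2 ≤ ∑ i, a i := by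
  have h1 := h.trace_pow (Matrix.isHermitian_mul_conjTranspose_self A) 1
  simp only [pow_one] at h1
  have h2 : (A * Aᴴ).trace = ((∑ i, ∑ j, ‖A i j‖ ^ 2 : ℝ) : ℂ) := by
    simp only [Matrix.trace, Matrix.diag, Matrix.mul_apply, Matrix.conjTranspose_apply]
    push_cast
    refine Finset.sum_congr rfl fun i _ => Finset.sum_congr rfl fun j _ => ?_
    exact Complex.mul_conj' (A i j)
  rw [h2] at h1
  have h3 : ∑ i, ∑ j, ‖A i j‖ ^ 2 = ∑ i, a i := by exact_mod_cast h1
  rw [← h3]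
  calc ‖A i j‖ ^ 2 ≤ ∑ j, ‖A i j‖ ^ 2 :=
        Finset.single_le_sum (f := fun j => ‖A i j‖ ^ 2) (fun j _ => sq_nonneg _) (Finset.mem_univ j)
    _ ≤ _ := Finset.single_le_sum (f := fun i => ∑ j, ‖A i j‖ ^ 2)
        (fun j _ => Finset.sum_nonneg fun _ _ => sq_nonneg _) (Finset.mem_univ i)

lemma matrix_subseq {n : ℕ} {A : ℕ → Matrix (Fin n) (Fin n) ℂ} {R : ℝ}
    (h : ∀ m i j, ‖A m i j‖ ≤ R) : ∃ (A₀ : Matrix (Fin n) (Fin n) ℂ) (φ : ℕ → ℕ), StrictMono φ ∧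
      Tendsto (A ∘ φ) atTop (𝓝 A₀) := by
  have hc : IsCompact (Set.pi Set.univ (fun _ : Fin n => Set.pi Set.univ
      (fun _ : Fin n => Metric.closedBall (0:ℂ) R))) :=
    isCompact_univ_pi fun _ => isCompact_univ_pi fun _ => isCompact_closedBall _ _
  obtain ⟨b, _, φ, hφ, hb⟩ := IsCompact.tendsto_subseq (X := Fin n → Fin n → ℂ) hc
    (x := fun m i j => A m i j)
    (fun m i _ j _ => by simpa using h m i j)
  exact ⟨b, φ, hφ, hb⟩

lemma isClosed_cone (n : ℕ) : IsClosed (Cone n) := by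
  apply IsSeqClosed.isClosed
  intro x x₀ hx hl
  choose ha hc ht A C hAC using hx
  have l1 : Tendsto (fun m => (x m).1) atTop (𝓝 x₀.1) := hl.fst_nhds
  have l2 : Tendsto (fun m => (x m).2.1) atTop (𝓝 x₀.2.1) := hl.snd_nhds.fst_nhds
  have l3 : Tendsto (fun m => (x m).2.2) atTop (𝓝 x₀.2.2) := hl.snd_nhds.snd_nhds
  have bd : ∀ (B : ℕ → Matrix (Fin n) (Fin n) ℂ) (b : ℕ → Fin n → ℝ) (b₀ : Fin n → ℝ),
      Tendsto b atTop (𝓝 b₀) → (∀ m, HasSpec (B m * (B m)ᴴ) (fun i => Real.exp (2 * b m i))) →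
      ∃ R, ∀ m i j, ‖B m i j‖ ≤ R := by
    intro B b b₀ hb hB
    have : Tendsto (fun m => ∑ i, Real.exp (2 * b m i)) atTop (𝓝 (∑ i, Real.exp (2 * b₀ i))) := by
      apply tendsto_finsetSum
      intro i _
      exact (Real.continuous_exp.tendsto _).comp ((tendsto_pi_nhds.mp hb i).const_mul 2)
    obtain ⟨R, hR⟩ := this.bddAbove_range
    refine ⟨R + 1, fun m i j => ?_⟩
    have h1 := entry_bound (hB m) i j
    have h2 : ∑ i, Real.exp (2 * b m i) ≤ R := hR ⟨m, rfl⟩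
    nlinarith [sq_nonneg (‖B m i j‖ - 1), norm_nonneg (B m i j)]
  obtain ⟨R, hR⟩ := bd A _ _ l1 (fun m => (hAC m).1)
  obtain ⟨A₀, φ, hφ, hA⟩ := matrix_subseq hR
  obtain ⟨R', hR'⟩ := bd C _ _ l2 (fun m => (hAC m).2.1)
  obtain ⟨C₀, ψ, hψ, hC⟩ := matrix_subseq (A := C ∘ φ) (fun m => hR' (φ m))
  have hA' : Tendsto (fun m => A (φ (ψ m))) atTop (𝓝 A₀) := hA.comp hψ.tendsto_atTop
  have hC' : Tendsto (fun m => C (φ (ψ m))) atTop (𝓝 C₀) := hC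
  have lim : Tendsto (fun m => φ (ψ m)) atTop atTop := hφ.tendsto_atTop.comp hψ.tendsto_atTop
  have hexp : ∀ {b : ℕ → Fin n → ℝ} {b₀ : Fin n → ℝ}, Tendsto b atTop (𝓝 b₀) →
      Tendsto (fun m i => Real.exp (2 * b (φ (ψ m)) i)) atTop (𝓝 (fun i => Real.exp (2 * b₀ i))) := by
    intro b b₀ hb
    rw [tendsto_pi_nhds]
    intro i
    exact (Real.continuous_exp.tendsto _).comp
      (((tendsto_pi_nhds.mp hb i).comp lim).const_mul 2)
  have hct : ∀ {B : ℕ → Matrix (Fin n) (Fin n) ℂ} {B₀ : Matrix (Fin n) (Fin n) ℂ},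
      Tendsto B atTop (𝓝 B₀) → Tendsto (fun m => B m * (B m)ᴴ) atTop (𝓝 (B₀ * B₀ᴴ)) := by
    intro B B₀ hB
    have : Continuous (fun M : Matrix (Fin n) (Fin n) ℂ => M * Mᴴ) := by fun_prop
    exact (this.tendsto B₀).comp hB
  refine ⟨(isClosed_antitone n).mem_of_tendsto l1 (Eventually.of_forall ha),
    (isClosed_antitone n).mem_of_tendsto l2 (Eventually.of_forall hc),
    (isClosed_antitone n).mem_of_tendsto l3 (Eventually.of_forall ht), A₀, C₀, ?_, ?_, ?_⟩
  · exact hasSpec_of_tendsto (fun m => Matrix.isHermitian_mul_conjTranspose_self _)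
      (Matrix.isHermitian_mul_conjTranspose_self _) (fun m => (hAC (φ (ψ m))).1) (hct hA') (hexp l1)
  · exact hasSpec_of_tendsto (fun m => Matrix.isHermitian_mul_conjTranspose_self _)
      (Matrix.isHermitian_mul_conjTranspose_self _) (fun m => (hAC (φ (ψ m))).2.1) (hct hC')
      (hexp l2)
  · exact hasSpec_of_tendsto (fun m => Matrix.isHermitian_mul_conjTranspose_self _)
      (Matrix.isHermitian_mul_conjTranspose_self _) (fun m => (hAC (φ (ψ m))).2.2)
      (hct (hA'.mul hC')) (hexp l3)

lemma cone_trace {n : ℕ} {x : (Fin n → ℝ) × (Fin n → ℝ) × (Fin n → ℝ)}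
    {A C : Matrix (Fin n) (Fin n) ℂ} (h : Over A C x) :
    ∑ i, x.2.2 i = ∑ i, x.1 i + ∑ i, x.2.1 i := by
  have h1 := h.1.det
  have h2 := h.2.1.det
  have h3 := h.2.2.det
  have : ((∏ i, Real.exp (2 * x.2.2 i) : ℝ) : ℂ) = (∏ i, Real.exp (2 * x.1 i) : ℝ) *
      (∏ i, Real.exp (2 * x.2.1 i) : ℝ) := by
    rw [← h1, ← h2, ← h3]
    simp only [Matrix.det_mul, Matrix.conjTranspose_mul]; ring
  have h4 : ∏ i, Real.exp (2 * x.2.2 i) = (∏ i, Real.exp (2 * x.1 i)) *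
      (∏ i, Real.exp (2 * x.2.1 i)) := by exact_mod_cast this
  rw [← Real.exp_sum, ← Real.exp_sum, ← Real.exp_sum, ← Real.exp_add, Real.exp_eq_exp,
    ← Finset.mul_sum, ← Finset.mul_sum, ← Finset.mul_sum] at h4
  linarith

end Horn


namespace Horn
open Filter Topology
section diff
attribute [local instance] Matrix.linftyOpNormedRing Matrix.linftyOpNormedAlgebra

/-- real part of traces of powers -/
noncomputable def tau {n : ℕ} (T : Matrix (Fin n) (Fin n) ℂ) (k : ℕ) : ℝ :=
  ((T * Tᴴ) ^ (k + 1)).trace.re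

/-- conjugate transpose as a continuous linear map -/
noncomputable def ctL (n : ℕ) : Matrix (Fin n) (Fin n) ℂ →L[ℝ] Matrix (Fin n) (Fin n) ℂ :=
  LinearMap.toContinuousLinearMap (Matrix.conjTransposeLinearEquiv (Fin n) (Fin n) ℝ ℂ).toLinearMap

/-- real part of the trace as a continuous linear map -/
noncomputable def trL (n : ℕ) : Matrix (Fin n) (Fin n) ℂ →L[ℝ] ℝ :=
  LinearMap.toContinuousLinearMap (Complex.reLm ∘ₗ (Matrix.traceLinearMap (Fin n) ℝ ℂ))

lemma trL_apply {n : ℕ} (M : Matrix (Fin n) (Fin n) ℂ) : trL n M = M.trace.re := rfl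
lemma ctL_apply {n : ℕ} (M : Matrix (Fin n) (Fin n) ℂ) : ctL n M = Mᴴ := rfl

lemma contDiff_tau {n : ℕ} (k : ℕ) :
    ContDiff ℝ 1 (fun T : Matrix (Fin n) (Fin n) ℂ => tau T k) := by
  have h : ContDiff ℝ 1 (fun T : Matrix (Fin n) (Fin n) ℂ => trL n ((T * ctL n T) ^ (k + 1))) := by
    fun_prop
  exact h

lemma hasDerivAt_pow_matrix {n : ℕ} {M : ℝ → Matrix (Fin n) (Fin n) ℂ}
    {M' : Matrix (Fin n) (Fin n) ℂ} {t : ℝ} (h : HasDerivAt M M' t) (k : ℕ) :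
    HasDerivAt (fun s => M s ^ (k + 1))
      (∑ i ∈ Finset.range (k + 1), M t ^ i * M' * M t ^ (k - i)) t := by
  induction k with
  | zero => simpa using h
  | succ k ih =>
    have := ih.mul h
    have e : (fun s => M s ^ (k + 1)) * M = fun s => M s ^ (k + 1 + 1) := by
      ext1 s; simp [pow_succ]
    rw [e] at this
    refine this.congr_deriv ?_
    symm
    rw [Finset.sum_range_succ, Finset.sum_mul]
    congr 1
    · apply Finset.sum_congr rfl
      intro i hi
      have : k + 1 - i = (k - i) + 1 := by
        have := Finset.mem_range.mp hi
        omega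
      rw [this, pow_succ, Matrix.mul_assoc, Matrix.mul_assoc, Matrix.mul_assoc]
    · simp

lemma tau_deriv {n : ℕ} (T ξ : Matrix (Fin n) (Fin n) ℂ) (k : ℕ) :
    HasDerivAt (fun t : ℝ => tau (T + t • (ξ * T)) k)
      (2 * (k + 1) * (ξ * (T * Tᴴ) ^ (k + 1)).trace.re) 0 := by
  have h1 : HasDerivAt (fun t : ℝ => T + t • (ξ * T)) (ξ * T) 0 := by
    have := ((hasDerivAt_id (0:ℝ)).smul_const (ξ * T)).const_add T
    rw [one_smul] at this
    exact this
  have h2 : HasDerivAt (fun t : ℝ => ctL n (T + t • (ξ * T))) (ctL n (ξ * T)) 0 :=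
    (ctL n).hasFDerivAt.comp_hasDerivAt 0 h1
  have h3 := h1.mul h2
  have h4 := hasDerivAt_pow_matrix h3 k
  have h5 := (trL n).hasFDerivAt.comp_hasDerivAt 0 h4
  refine h5.congr_deriv ?_
  change (Matrix.trace (∑ i ∈ Finset.range (k + 1),
    ((T + (0:ℝ) • (ξ * T)) * (T + (0:ℝ) • (ξ * T))ᴴ) ^ i *
      (ξ * T * (T + (0:ℝ) • (ξ * T))ᴴ + (T + (0:ℝ) • (ξ * T)) * (ξ * T)ᴴ) *
      ((T + (0:ℝ) • (ξ * T)) * (T + (0:ℝ) • (ξ * T))ᴴ) ^ (k - i))).re = _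
  rw [zero_smul, add_zero, Matrix.trace_sum, Complex.re_sum]
  set S := T * Tᴴ with hS
  have hSh : Sᴴ = S := by rw [hS, Matrix.conjTranspose_mul, Matrix.conjTranspose_conjTranspose]
  have key : ∀ i ∈ Finset.range (k + 1), (S ^ i * (ξ * T * Tᴴ + T * (ξ * T)ᴴ) * S ^ (k - i)).trace.re
      = 2 * (ξ * S ^ (k + 1)).trace.re := by
    intro i hi
    have hik : i + (k - i) = k := by have := Finset.mem_range.mp hi; omega
    have e1 : ξ * T * Tᴴ = ξ * S := by rw [hS, Matrix.mul_assoc]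
    have e2 : T * (ξ * T)ᴴ = S * ξᴴ := by
      rw [Matrix.conjTranspose_mul, hS, Matrix.mul_assoc]
    rw [e1, e2, Matrix.trace_mul_cycle, Matrix.mul_add, Matrix.trace_add, Complex.add_re,
      ← pow_add, show k - i + i = k by omega]
    have e3 : (S ^ k * (ξ * S)).trace = (ξ * S ^ (k + 1)).trace := by
      rw [Matrix.trace_mul_comm, Matrix.mul_assoc, ← pow_succ']
    have e4 : (S ^ k * (S * ξᴴ)).trace = star (ξ * S ^ (k + 1)).trace := by
      rw [← Matrix.trace_conjTranspose, Matrix.conjTranspose_mul, Matrix.conjTranspose_pow, hSh,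
        ← Matrix.mul_assoc, ← pow_succ]
    rw [e3, e4]
    simp; ring
  rw [Finset.sum_congr rfl key]
  simp only [Finset.sum_const, Finset.card_range, nsmul_eq_mul]
  push_cast; ring

/-- The condition guaranteeing that the spectral map is a submersion. -/
def Good {n : ℕ} (A C : Matrix (Fin n) (Fin n) ℂ) : Prop :=
  A.det ≠ 0 ∧ C.det ≠ 0 ∧ LinearIndependent ℝ (fun j : Fin n => (A * Aᴴ) ^ (j : ℕ)) ∧
  LinearIndependent ℝ (fun j : Fin n => (Cᴴ * C) ^ (j : ℕ)) ∧
  LinearIndependent ℝ (fun j : Fin (n - 1) => ((A * C) * (A * C)ᴴ) ^ ((j : ℕ) + 1) * (A * Aᴴ)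
    - (A * Aᴴ) * ((A * C) * (A * C)ᴴ) ^ ((j : ℕ) + 1))

/-- the spectral map -/
noncomputable def Psi {n : ℕ} (p : Matrix (Fin n) (Fin n) ℂ × Matrix (Fin n) (Fin n) ℂ) :
    (Fin n → ℝ) × (Fin n → ℝ) × (Fin (n - 1) → ℝ) :=
  (fun k => tau p.1 k, fun k => tau p.2ᴴ k, fun k => tau (p.1 * p.2) k)

lemma contDiff_Psi {n : ℕ} : ContDiff ℝ 1 (Psi (n := n)) := by
  refine ContDiff.prodMk ?_ (ContDiff.prodMk ?_ ?_)
  · rw [contDiff_pi]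
    intro k
    exact (contDiff_tau k).comp contDiff_fst
  · rw [contDiff_pi]
    intro k
    exact (contDiff_tau k).comp ((ctL n).contDiff.comp contDiff_snd)
  · rw [contDiff_pi]
    intro k
    exact (contDiff_tau k).comp (contDiff_fst.mul contDiff_snd)

lemma eq_zero_of_trace {n : ℕ} {W : Matrix (Fin n) (Fin n) ℂ}
    (h : ∀ ξ : Matrix (Fin n) (Fin n) ℂ, (ξ * W).trace.re = 0) : W = 0 := by
  have h1 := h Wᴴ
  have h2 : (Wᴴ * W).trace = ((∑ i, ∑ j, ‖W j i‖ ^ 2 : ℝ) : ℂ) := by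
    simp only [Matrix.trace, Matrix.diag, Matrix.mul_apply, Matrix.conjTranspose_apply]
    push_cast
    refine Finset.sum_congr rfl fun i _ => Finset.sum_congr rfl fun j _ => ?_
    exact Complex.conj_mul' (W j i)
  rw [h2, Complex.ofReal_re] at h1
  ext i j
  have h3 := (Finset.sum_eq_zero_iff_of_nonneg
    (fun i _ => Finset.sum_nonneg fun _ _ => sq_nonneg _)).mp h1 j (Finset.mem_univ _)
  have h4 := (Finset.sum_eq_zero_iff_of_nonneg (fun _ _ => sq_nonneg _)).mp h3 i (Finset.mem_univ _)
  simpa using h4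

lemma linInd_succ_pow {n : ℕ} {S : Matrix (Fin n) (Fin n) ℂ} (hS : S.det ≠ 0)
    (h : LinearIndependent ℝ (fun j : Fin n => S ^ (j : ℕ))) {c : Fin n → ℝ}
    (hc : ∑ j, c j • S ^ ((j : ℕ) + 1) = 0) : c = 0 := by
  have h1 : S * ∑ j, c j • S ^ (j : ℕ) = 0 := by
    rw [Finset.mul_sum, ← hc]
    refine Finset.sum_congr rfl fun j _ => ?_
    rw [Matrix.mul_smul, ← pow_succ']
  have h2 : ∑ j, c j • S ^ (j : ℕ) = 0 := by
    have := congrArg (fun M => S⁻¹ * M) h1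
    simpa [← Matrix.mul_assoc, Matrix.nonsing_inv_mul S hS.isUnit] using this
  ext j
  exact Fintype.linearIndependent_iff.mp h c h2 j

lemma fderiv_Psi_surj {n : ℕ} {A C : Matrix (Fin n) (Fin n) ℂ} (hg : Good A C)
    {f' : (Matrix (Fin n) (Fin n) ℂ × Matrix (Fin n) (Fin n) ℂ) →L[ℝ]
      (Fin n → ℝ) × (Fin n → ℝ) × (Fin (n - 1) → ℝ)} (hf : HasFDerivAt Psi f' (A, C)) :
    LinearMap.range f'.toLinearMap = ⊤ := by
  obtain ⟨dA, dC, g1, g2, g3⟩ := hg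
  by_contra hne
  obtain ⟨φ, hφ0, hφ⟩ := Submodule.exists_le_ker_of_lt_top _ (lt_top_iff_ne_top.mpr hne)
  have hφ' : ∀ v, φ (f' v) = 0 := fun v => hφ ⟨v, rfl⟩
  let φ1 : Fin n → ℝ := fun k => φ (Pi.single k 1, 0, 0)
  let φ2 : Fin n → ℝ := fun k => φ (0, Pi.single k 1, 0)
  let φ3 : Fin (n - 1) → ℝ := fun k => φ (0, 0, Pi.single k 1)
  have hrep : ∀ y, φ y = ∑ k, φ1 k * y.1 k + ∑ k, φ2 k * y.2.1 k + ∑ k, φ3 k * y.2.2 k := by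
    rintro ⟨y1, y2, y3⟩
    have e1 : ∀ (m : ℕ) (L : (Fin m → ℝ) →ₗ[ℝ] ℝ) (y : Fin m → ℝ),
        L y = ∑ k, L (Pi.single k 1) * y k := by
      intro m L y
      conv_lhs => rw [pi_eq_sum_univ' y, map_sum]
      refine Finset.sum_congr rfl fun k _ => ?_
      rw [map_smul, smul_eq_mul, mul_comm]
    have e2 : (y1, y2, y3) = LinearMap.inl ℝ _ _ y1 + (LinearMap.inr ℝ (Fin n → ℝ) _
      (LinearMap.inl ℝ _ _ y2) + LinearMap.inr ℝ (Fin n → ℝ) _ (LinearMap.inr ℝ (Fin n → ℝ) _ y3)) := by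
      simp
    have a1 := e1 n (φ ∘ₗ LinearMap.inl ℝ _ _) y1
    have a2 := e1 n (φ ∘ₗ LinearMap.inr ℝ (Fin n → ℝ) _ ∘ₗ LinearMap.inl ℝ _ _) y2
    have a3 := e1 (n-1) (φ ∘ₗ LinearMap.inr ℝ (Fin n → ℝ) _ ∘ₗ LinearMap.inr ℝ (Fin n → ℝ) _) y3
    simp only [LinearMap.comp_apply] at a1 a2 a3
    conv_lhs => rw [e2, map_add, map_add, a1, a2, a3]
    simp only [φ1, φ2, φ3, add_assoc]
    rfl
  -- derivative of Psi along lines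
  have line : ∀ v, HasDerivAt (fun t : ℝ => Psi ((A, C) + t • v)) (f' v) 0 := by
    intro v
    have h1 : HasDerivAt (fun t : ℝ => (A, C) + t • v) v 0 := by
      have := ((hasDerivAt_id (0:ℝ)).smul_const v).const_add (A, C)
      rw [one_smul] at this
      exact this
    have h2 : HasFDerivAt Psi f' ((A, C) + (0:ℝ) • v) := by simpa using hf
    exact h2.comp_hasDerivAt 0 h1
  set S := A * Aᴴ with hS
  set P := (A * C) * (A * C)ᴴ with hP
  -- first family of directions
  have d1 : ∀ ξ : Matrix (Fin n) (Fin n) ℂ, f' (ξ * A, 0) =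
      (fun k : Fin n => 2 * ((k:ℕ) + 1) * (ξ * S ^ ((k:ℕ) + 1)).trace.re, 0,
       fun k : Fin (n - 1) => 2 * ((k:ℕ) + 1) * (ξ * P ^ ((k:ℕ) + 1)).trace.re) := by
    intro ξ
    refine (line (ξ * A, 0)).unique ?_
    refine HasDerivAt.prodMk ?_ (HasDerivAt.prodMk ?_ ?_)
    · rw [hasDerivAt_pi]
      intro k
      exact tau_deriv A ξ k
    · rw [hasDerivAt_pi]
      intro k
      have := hasDerivAt_const (0:ℝ) (tau Cᴴ k)
      simpa using this
    · rw [hasDerivAt_pi]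
      intro k
      have := tau_deriv (A * C) ξ k
      have e : (fun t : ℝ => tau ((A + t • (ξ * A)) * (C + t • (0 : Matrix (Fin n) (Fin n) ℂ))) k) =
          fun t : ℝ => tau (A * C + t • (ξ * (A * C))) k := by
        ext t
        rw [smul_zero, add_zero, Matrix.add_mul, Matrix.smul_mul, Matrix.mul_assoc ξ]
      rw [← e] at this
      exact this
  let W1 : Matrix (Fin n) (Fin n) ℂ := ∑ k : Fin n, (φ1 k * ((k:ℕ) + 1)) • S ^ ((k:ℕ) + 1)
  let W3 : Matrix (Fin n) (Fin n) ℂ := ∑ k : Fin (n - 1), (φ3 k * ((k:ℕ) + 1)) • P ^ ((k:ℕ) + 1)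
  have hW : W1 + W3 = 0 := by
    apply eq_zero_of_trace
    intro ξ
    have := hφ' (ξ * A, 0)
    rw [d1, hrep] at this
    simp only [W1, W3, Matrix.mul_add, Matrix.trace_add, Finset.mul_sum, Matrix.trace_sum,
      Complex.add_re, Complex.re_sum, Matrix.mul_smul, Matrix.trace_smul, Complex.smul_re,
      smul_eq_mul]
    simp only [Pi.zero_apply, mul_zero, Finset.sum_const_zero, add_zero] at this
    have e : ∀ (m : ℕ) (u v : Fin m → ℝ), ∑ k, u k * (2 * ((k:ℕ) + 1) * v k) =
        2 * ∑ k, u k * ((k:ℕ) + 1) * v k := by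
      intro m u v
      rw [Finset.mul_sum]
      exact Finset.sum_congr rfl fun k _ => by ring
    rw [e, e] at this
    linarith
  have hW1 : W1 * S = S * W1 := by
    simp only [W1, Finset.mul_sum, Finset.sum_mul, Matrix.mul_smul, Matrix.smul_mul]
    exact Finset.sum_congr rfl fun k _ => by rw [← pow_succ, ← pow_succ']
  have hW3 : W3 = - W1 := eq_neg_of_add_eq_zero_right hW
  have hcomm : W3 * S - S * W3 = 0 := by rw [hW3]; simp [hW1]
  have p3 : ∀ k, φ3 k = 0 := by
    have := Fintype.linearIndependent_iff.mp g3 (fun k => φ3 k * ((k:ℕ) + 1)) (by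
      rw [← hcomm]
      simp only [W3, Finset.mul_sum, Finset.sum_mul, Matrix.mul_smul, Matrix.smul_mul, smul_sub,
        Finset.sum_sub_distrib])
    intro k
    have h := this k
    have : ((k:ℕ):ℝ) + 1 ≠ 0 := by positivity
    simpa [this] using h
  have hW3' : W3 = 0 := by simp [W3, p3]
  have p1 : ∀ k, φ1 k = 0 := by
    have h1 : W1 = 0 := by rw [hW3'] at hW; simpa using hW
    have := linInd_succ_pow (S := S) (by
      rw [hS, Matrix.det_mul, Matrix.det_conjTranspose]
      exact mul_ne_zero dA (star_ne_zero.mpr dA)) g1 h1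
    intro k
    have h := congrFun this k
    have : ((k:ℕ):ℝ) + 1 ≠ 0 := by positivity
    simpa [this] using h
  -- second family
  have d2 : ∀ ξ : Matrix (Fin n) (Fin n) ℂ, (f' (0, (ξ * Cᴴ)ᴴ)).2.1 =
      (fun k : Fin n => 2 * ((k:ℕ) + 1) * (ξ * (Cᴴ * C) ^ ((k:ℕ) + 1)).trace.re) := by
    intro ξ
    have h1 : HasDerivAt (fun t : ℝ => (Psi ((A, C) + t • ((0 : Matrix (Fin n) (Fin n) ℂ),
        (ξ * Cᴴ)ᴴ))).2.1) (f' (0, (ξ * Cᴴ)ᴴ)).2.1 0 :=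
      ((ContinuousLinearMap.fst ℝ _ _).comp (ContinuousLinearMap.snd ℝ (Fin n → ℝ)
        ((Fin n → ℝ) × (Fin (n - 1) → ℝ)))).hasFDerivAt.comp_hasDerivAt 0 (line _)
    refine h1.unique ?_
    rw [hasDerivAt_pi]
    intro k
    have := tau_deriv Cᴴ ξ k
    rw [Matrix.conjTranspose_conjTranspose] at this
    have e : (fun t : ℝ => tau (C + t • (ξ * Cᴴ)ᴴ)ᴴ k) =
        fun t : ℝ => tau (Cᴴ + t • (ξ * Cᴴ)) k := by
      ext t
      rw [Matrix.conjTranspose_add, Matrix.conjTranspose_smul, Matrix.conjTranspose_conjTranspose,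
        star_trivial]
    rw [← e] at this
    exact this
  have p2 : ∀ k, φ2 k = 0 := by
    have h1 : ∑ k : Fin n, (φ2 k * ((k:ℕ) + 1)) • (Cᴴ * C) ^ ((k:ℕ) + 1) = 0 := by
      apply eq_zero_of_trace
      intro ξ
      have := hφ' (0, (ξ * Cᴴ)ᴴ)
      rw [hrep, d2] at this
      simp only [Finset.mul_sum, Matrix.trace_sum,
        Complex.re_sum, Matrix.mul_smul, Matrix.trace_smul, Complex.smul_re, smul_eq_mul]
      simp only [p1, p3, zero_mul, Finset.sum_const_zero, add_zero, zero_add] at this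
      have e : ∀ (m : ℕ) (u v : Fin m → ℝ), ∑ k, u k * (2 * ((k:ℕ) + 1) * v k) =
          2 * ∑ k, u k * ((k:ℕ) + 1) * v k := by
        intro m u v
        rw [Finset.mul_sum]
        exact Finset.sum_congr rfl fun k _ => by ring
      rw [e] at this
      linarith
    have := linInd_succ_pow (S := Cᴴ * C) (by
      rw [Matrix.det_mul, Matrix.det_conjTranspose]
      exact mul_ne_zero (star_ne_zero.mpr dC) dC) g2 h1
    intro k
    have h := congrFun this k
    have : ((k:ℕ):ℝ) + 1 ≠ 0 := by positivity
    simpa [this] using h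
  apply hφ0
  ext y
  all_goals simp [hrep, p1, p2, p3]

/-- the target of the spectral map as a function of the log spectra -/
noncomputable def Phi {n : ℕ} (x : (Fin n → ℝ) × (Fin n → ℝ) × (Fin n → ℝ)) :
    (Fin n → ℝ) × (Fin n → ℝ) × (Fin (n - 1) → ℝ) :=
  (fun k => ∑ i, Real.exp (2 * x.1 i) ^ ((k:ℕ) + 1),
    fun k => ∑ i, Real.exp (2 * x.2.1 i) ^ ((k:ℕ) + 1),
    fun k => ∑ i, Real.exp (2 * x.2.2 i) ^ ((k:ℕ) + 1))

lemma continuous_Phi {n : ℕ} : Continuous (Phi (n := n)) := by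
  unfold Phi; fun_prop

lemma Psi_eq_Phi {n : ℕ} {A C : Matrix (Fin n) (Fin n) ℂ}
    {x : (Fin n → ℝ) × (Fin n → ℝ) × (Fin n → ℝ)} (h : Over A C x) : Psi (A, C) = Phi x := by
  have h2 : HasSpec (Cᴴ * Cᴴᴴ) (fun i => Real.exp (2 * x.2.1 i)) := by
    rw [Matrix.conjTranspose_conjTranspose, hasSpec_mul_comm]; exact h.2.1
  refine Prod.ext ?_ (Prod.ext ?_ ?_)
  · ext k
    simp only [Psi, Phi, tau]
    rw [h.1.trace_pow (Matrix.isHermitian_mul_conjTranspose_self _), Complex.ofReal_re]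
  · ext k
    simp only [Psi, Phi, tau]
    rw [h2.trace_pow (Matrix.isHermitian_mul_conjTranspose_self _), Complex.ofReal_re]
  · ext k
    simp only [Psi, Phi, tau]
    rw [h.2.2.trace_pow (Matrix.isHermitian_mul_conjTranspose_self _), Complex.ofReal_re]

lemma over_of_Psi_eq_Phi {n : ℕ} {A C : Matrix (Fin n) (Fin n) ℂ}
    {x : (Fin n → ℝ) × (Fin n → ℝ) × (Fin n → ℝ)} (h : Psi (A, C) = Phi x)
    (ht : ∑ i, x.2.2 i = ∑ i, x.1 i + ∑ i, x.2.1 i) : Over A C x := by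
  have h1 : HasSpec (A * Aᴴ) (fun i => Real.exp (2 * x.1 i)) := by
    apply hasSpec_of_trace (Matrix.isHermitian_mul_conjTranspose_self _)
    intro k hk hk'
    have := congrFun (congrArg Prod.fst h) ⟨k - 1, by omega⟩
    simp only [Psi, Phi, tau] at this
    rwa [Nat.sub_add_cancel hk] at this
  have h2 : HasSpec (C * Cᴴ) (fun i => Real.exp (2 * x.2.1 i)) := by
    have : HasSpec (Cᴴ * Cᴴᴴ) (fun i => Real.exp (2 * x.2.1 i)) := by
      apply hasSpec_of_trace (Matrix.isHermitian_mul_conjTranspose_self _)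
      intro k hk hk'
      have := congrFun (congrArg (fun p => p.2.1) h) ⟨k - 1, by omega⟩
      simp only [Psi, Phi, tau] at this
      rwa [Nat.sub_add_cancel hk] at this
    rw [Matrix.conjTranspose_conjTranspose, hasSpec_mul_comm] at this
    exact this
  refine ⟨h1, h2, ?_⟩
  apply hasSpec_of_trace_det (Matrix.isHermitian_mul_conjTranspose_self _)
  · intro k hk hk'
    have := congrFun (congrArg (fun p => p.2.2) h) ⟨k - 1, by omega⟩
    simp only [Psi, Phi, tau] at this
    rwa [Nat.sub_add_cancel hk] at this
  · have e1 := h1.det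
    have e2 := h2.det
    have : ((A * C) * (A * C)ᴴ).det = (A * Aᴴ).det * (C * Cᴴ).det := by
      simp only [Matrix.det_mul, Matrix.conjTranspose_mul]; ring
    rw [this, e1, e2, ← Complex.ofReal_mul, ← Real.exp_sum, ← Real.exp_sum, ← Real.exp_sum,
      ← Real.exp_add, ← Finset.mul_sum, ← Finset.mul_sum, ← Finset.mul_sum, ht]
    congr 2; ring

/-- openness at good points -/
lemma open_of_good {n : ℕ} {A C : Matrix (Fin n) (Fin n) ℂ}
    {x : (Fin n → ℝ) × (Fin n → ℝ) × (Fin n → ℝ)} (h : Over A C x) (hg : Good A C) :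
    ∀ᶠ y in 𝓝 x, Antitone y.1 → Antitone y.2.1 → Antitone y.2.2 →
      ∑ i, y.2.2 i = ∑ i, y.1 i + ∑ i, y.2.1 i → y ∈ Cone n := by
  have hs : HasStrictFDerivAt Psi (fderiv ℝ Psi (A, C)) (A, C) :=
    (contDiff_Psi.contDiffAt).hasStrictFDerivAt (by norm_num)
  have hr := fderiv_Psi_surj hg hs.hasFDerivAt
  have hm := @HasStrictFDerivAt.map_nhds_eq_of_surj _ _ _ _ _ _ _ _
    (FiniteDimensional.complete ℝ _) _ _ _ _ hs hr
  have : Set.range (Psi (n := n)) ∈ 𝓝 (Psi (A, C)) := by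
    rw [← hm]; exact Filter.range_mem_map
  rw [Psi_eq_Phi h] at this
  have h2 := (continuous_Phi.tendsto x) this
  filter_upwards [h2] with y hy h1 h2 h3 h4
  obtain ⟨⟨A', C'⟩, hA'⟩ := hy
  exact ⟨h1, h2, h3, A', C', over_of_Psi_eq_Phi hA' h4⟩

end diff
end Horn


namespace Horn

/-- generic triples: regular, off all the walls -/
def Gen {n : ℕ} (x : (Fin n → ℝ) × (Fin n → ℝ) × (Fin n → ℝ)) : Prop :=
  StrictAnti x.1 ∧ StrictAnti x.2.1 ∧ StrictAnti x.2.2 ∧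
  ∀ I J K : Finset (Fin n), K.Nonempty → K ≠ Finset.univ →
    ∑ i ∈ K, x.2.2 i ≠ ∑ i ∈ I, x.1 i + ∑ i ∈ J, x.2.1 i

open Polynomial in
lemma block_det {n : ℕ} {M : Matrix (Fin n) (Fin n) ℂ} {a : Fin n → ℝ} (h : HasSpec M a)
    (p : Fin n → Prop) [DecidablePred p] (hp : ∀ i, ¬ p i → ∀ j, p j → M i j = 0) :
    ∃ I : Finset (Fin n), (M.toSquareBlockProp p).det = ((∏ i ∈ I, a i : ℝ) : ℂ) := by
  have h1 : M.charpoly = (M.toSquareBlockProp p).charpoly *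
      (M.toSquareBlockProp fun i => ¬ p i).charpoly := by
    unfold Matrix.charpoly
    rw [Matrix.twoBlockTriangular_det M.charmatrix p]
    · congr 2
      · ext1 i j
        simp [Matrix.toSquareBlockProp, Matrix.charmatrix, Matrix.scalar_apply,
          Matrix.diagonal_apply, Subtype.ext_iff]
      · ext1 i j
        simp [Matrix.toSquareBlockProp, Matrix.charmatrix, Matrix.scalar_apply,
          Matrix.diagonal_apply, Subtype.ext_iff]
    · intro i hi j hj
      have : i ≠ j := by rintro rfl; exact hi hj
      simp [Matrix.charmatrix, this, hp i hi j hj]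
  rw [h] at h1
  obtain ⟨t, u, b, c, -, -, hbc, hx, -⟩ := mul_eq_mul_prime_prod (R := ℂ[X])
    (s := Finset.univ) (p := fun i => X - C ((a i : ℝ) : ℂ)) (a := 1)
    (fun i _ => Polynomial.prime_X_sub_C _) (h1.symm.trans (one_mul _).symm)
  have hm := Matrix.charpoly_monic (M.toSquareBlockProp p)
  have hm2 : (∏ i ∈ t, (X - C ((a i : ℝ) : ℂ))).Monic :=
    Polynomial.monic_prod_of_monic _ _ fun i _ => Polynomial.monic_X_sub_C _
  have hb : b = 1 := by
    have hu : IsUnit b := IsUnit.of_mul_eq_one c hbc.symm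
    obtain ⟨r, hr, hr2⟩ := Polynomial.isUnit_iff.mp hu
    have := congrArg Polynomial.leadingCoeff hx
    rw [hm.leadingCoeff, Polynomial.leadingCoeff_mul, hm2.leadingCoeff, ← hr2] at this
    simp at this
    rw [← hr2, ← this, C_1]
  rw [hb, one_mul] at hx
  refine ⟨t, ?_⟩
  have hd : Fintype.card {i // p i} = t.card := by
    have := congrArg Polynomial.natDegree hx
    rw [Matrix.charpoly_natDegree_eq_dim, Polynomial.natDegree_prod_of_monic _ _
      (fun i _ => Polynomial.monic_X_sub_C _)] at this
    simpa using this
  rw [Matrix.det_eq_sign_charpoly_coeff, hx, hd, Polynomial.coeff_zero_eq_eval_zero,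
    Polynomial.eval_prod]
  simp [Finset.prod_neg, ← mul_assoc, ← mul_pow]

lemma block_det' {n : ℕ} {M : Matrix (Fin n) (Fin n) ℂ} {a : Fin n → ℝ} (h : HasSpec M a)
    (K : Finset (Fin n)) (hp : ∀ i, i ∉ K → ∀ j, j ∈ K → M i j = 0) :
    ∃ I : Finset (Fin n), (M.submatrix (Subtype.val : {i // i ∈ K} → Fin n)
      (Subtype.val : {i // i ∈ K} → Fin n)).det = ((∏ i ∈ I, a i : ℝ) : ℂ) := by
  obtain ⟨I, hI⟩ := block_det h (fun i => i ∈ K) hp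
  refine ⟨I, ?_⟩
  rw [← hI]
  convert rfl
  rfl

lemma block_prod {n : ℕ} (S Q : Matrix (Fin n) (Fin n) ℂ) (δ : Fin n → ℝ) (K : Finset (Fin n))
    (h : S * Q = Matrix.diagonal (fun i => (δ i : ℂ)))
    (hz : ∀ i, i ∈ K → ∀ k, k ∉ K → S i k = 0) :
    (S.submatrix (Subtype.val : {i // i ∈ K} → Fin n)
      (Subtype.val : {i // i ∈ K} → Fin n)).det * (Q.submatrix (Subtype.val : {i // i ∈ K} → Fin n)
      (Subtype.val : {i // i ∈ K} → Fin n)).det = ((∏ i ∈ K, δ i : ℝ) : ℂ) := by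
  rw [← Matrix.det_mul]
  have : (S.submatrix (Subtype.val : {i // i ∈ K} → Fin n)
      (Subtype.val : {i // i ∈ K} → Fin n)) * (Q.submatrix (Subtype.val : {i // i ∈ K} → Fin n)
      (Subtype.val : {i // i ∈ K} → Fin n)) =
      Matrix.diagonal (fun i : {i // i ∈ K} => ((δ i : ℝ) : ℂ)) := by
    ext i j
    have h1 : (S * Q) i j = Matrix.diagonal (fun i => (δ i : ℂ)) i j := by rw [h]
    have h2 : ∑ k, S i k * Q k j = ∑ k ∈ K, S i k * Q k j := by
      symm
      apply Finset.sum_subset (Finset.subset_univ K)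
      intro k _ hk
      rw [hz i i.2 k hk, zero_mul]
    rw [Matrix.mul_apply, h2, Finset.sum_subtype K (fun k => Iff.rfl)] at h1
    rw [Matrix.mul_apply]
    refine Eq.trans h1 ?_
    simp only [Matrix.diagonal_apply, Subtype.ext_iff]
  rw [this, Matrix.det_diagonal]
  push_cast
  exact (Finset.prod_subtype K (fun k => Iff.rfl) (fun k => ((δ k : ℝ) : ℂ))).symm

lemma linInd_pow_of_spec {n : ℕ} {S : Matrix (Fin n) (Fin n) ℂ} (hS : S.IsHermitian)
    {a : Fin n → ℝ} (h : HasSpec S (fun i => Real.exp (2 * a i))) (ha : StrictAnti a) :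
    LinearIndependent ℝ (fun j : Fin n => S ^ (j : ℕ)) := by
  obtain ⟨U, h1, h2, h3⟩ := exists_diag' hS h
    (fun i j hij => Real.exp_le_exp.mpr (by linarith [ha.antitone hij]))
  rw [Fintype.linearIndependent_iff]
  intro c hc
  have hinj : Function.Injective (fun i => Real.exp (2 * a i)) := by
    intro i j hij
    apply ha.injective
    have := Real.exp_injective hij
    linarith
  have key : ∀ i, ∑ j : Fin n, Real.exp (2 * a i) ^ (j:ℕ) * c j = 0 := by
    intro i
    have h4 : Uᴴ * (∑ j, c j • S ^ (j:ℕ)) * U = ∑ j : Fin n, c j •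
        (Matrix.diagonal (fun i => ((Real.exp (2 * a i) : ℝ) : ℂ))) ^ (j:ℕ) := by
      rw [Finset.mul_sum, Finset.sum_mul]
      refine Finset.sum_congr rfl fun j _ => ?_
      rw [h3, diag_pow_conj _ _ _ h2 h1, Matrix.mul_smul, Matrix.smul_mul]
      congr 1
      rw [← Matrix.mul_assoc, ← Matrix.mul_assoc, h2, Matrix.one_mul, Matrix.mul_assoc, h2,
        Matrix.mul_one]
    rw [hc, Matrix.mul_zero, Matrix.zero_mul] at h4
    have h5 := congrFun (congrFun h4 i) i
    simp only [Matrix.diagonal_pow, Matrix.sum_apply, Matrix.smul_apply,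
      Matrix.diagonal_apply_eq, Matrix.zero_apply, Pi.pow_apply] at h5
    have h6 := congrArg Complex.re h5
    rw [Complex.re_sum] at h6
    simp only [Complex.zero_re] at h6
    rw [h6]
    refine Finset.sum_congr rfl fun j _ => ?_
    rw [← Complex.ofReal_pow, Complex.smul_re, Complex.ofReal_re, smul_eq_mul, mul_comm]
  have := Matrix.eq_zero_of_forall_index_sum_pow_mul_eq_zero hinj key
  intro i; rw [this]; rfl

set_option maxHeartbeats 2000000 in
lemma comm_linInd {n : ℕ} {A C : Matrix (Fin n) (Fin n) ℂ}
    {x : (Fin n → ℝ) × (Fin n → ℝ) × (Fin n → ℝ)} (h : Over A C x) (hx : Gen x) :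
    LinearIndependent ℝ (fun j : Fin (n - 1) => ((A * C) * (A * C)ᴴ) ^ ((j : ℕ) + 1) * (A * Aᴴ)
    - (A * Aᴴ) * ((A * C) * (A * C)ᴴ) ^ ((j : ℕ) + 1)) := by
  obtain ⟨hA, hC, hAC⟩ := h
  obtain ⟨x1, x2, x3, hw⟩ := hx
  have dA := det_ne_zero_of_hasSpec hA
  obtain ⟨U, h1, h2, h3⟩ := exists_diag' (Matrix.isHermitian_mul_conjTranspose_self (A * C)) hAC
    (fun i j hij => Real.exp_le_exp.mpr (by linarith [x3.antitone hij]))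
  set P := (A * C) * (A * C)ᴴ with hP
  set δ : Fin n → ℝ := fun i => Real.exp (2 * x.2.2 i) with hδ
  have hinj : Function.Injective δ := by
    intro i j hij
    apply x3.injective
    have := Real.exp_injective hij
    linarith
  set D : Matrix (Fin n) (Fin n) ℂ := Matrix.diagonal (fun i => (δ i : ℂ)) with hD
  rw [Fintype.linearIndependent_iff]
  intro c hc
  set p : ℝ → ℝ := fun t => ∑ j : Fin (n - 1), c j * t ^ ((j:ℕ) + 1) with hp
  set S' := Uᴴ * (A * Aᴴ) * U with hS'
  have hcomm : ∀ a b, ((p (δ a) - p (δ b) : ℝ) : ℂ) * S' a b = 0 := by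
    intro a b
    have h4 : Uᴴ * (∑ j, c j • (P ^ ((j : ℕ) + 1) * (A * Aᴴ) - (A * Aᴴ) * P ^ ((j : ℕ) + 1))) * U
        = ∑ j : Fin (n - 1), c j • (D ^ ((j:ℕ) + 1) * S' - S' * D ^ ((j:ℕ) + 1)) := by
      rw [Finset.mul_sum, Finset.sum_mul]
      refine Finset.sum_congr rfl fun j _ => ?_
      have e : P ^ ((j:ℕ) + 1) = U * D ^ ((j:ℕ) + 1) * Uᴴ := by
        rw [h3, diag_pow_conj _ _ _ h2 h1]
      rw [e, Matrix.mul_smul, Matrix.smul_mul]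
      congr 1
      rw [Matrix.mul_sub, Matrix.sub_mul, hS']
      congr 1
      · simp only [← Matrix.mul_assoc]; rw [h2, Matrix.one_mul]
      · simp only [Matrix.mul_assoc]; rw [h2, Matrix.mul_one]
    rw [hc, Matrix.mul_zero, Matrix.zero_mul] at h4
    have h5 := congrFun (congrFun h4 a) b
    simp only [hD, Matrix.diagonal_pow, Matrix.sum_apply, Matrix.smul_apply, Matrix.sub_apply,
      Matrix.diagonal_mul, Matrix.mul_diagonal, Matrix.zero_apply, Pi.pow_apply] at h5
    rw [h5, hp]
    push_cast
    rw [← Finset.sum_sub_distrib, Finset.sum_mul]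
    refine Finset.sum_congr rfl fun j _ => ?_
    rw [Complex.real_smul]; ring
  rcases n with _ | n
  · intro i; exact absurd i.2 (by simp)
  classical
  set K : Finset (Fin (n+1)) := Finset.univ.filter (fun i => p (δ i) = p (δ 0)) with hK
  by_cases hKu : K = Finset.univ
  · have hall : ∀ i, p (δ i) = p (δ 0) := by
      intro i
      have : i ∈ K := by rw [hKu]; exact Finset.mem_univ i
      exact (Finset.mem_filter.mp this).2
    let v : Fin (n+1) → ℝ := Fin.cons (- p (δ 0)) c
    have hv : v = 0 := by
      apply Matrix.eq_zero_of_forall_index_sum_mul_pow_eq_zero hinj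
      intro j
      rw [Fin.sum_univ_succ]
      simp only [v, Fin.cons_zero, Fin.cons_succ, Fin.val_zero, pow_zero, mul_one, Fin.val_succ]
      have := hall j
      simp only [hp] at this ⊢
      have e : ∑ i : Fin n, c i * δ j ^ ((i:ℕ) + 1) = ∑ i : Fin n, c i * δ 0 ^ ((i:ℕ) + 1) := this
      exact neg_add_eq_zero.mpr e.symm
    intro i
    have := congrFun hv (Fin.succ i)
    simpa [v] using this
  · exfalso
    have h0 : (0 : Fin (n+1)) ∈ K := by simp [hK]
    let q : Fin (n+1) → Prop := fun i => i ∈ K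
    -- matrix Q
    have dU : U.det ≠ 0 := by
      intro h0
      have := congrArg Matrix.det h1
      rw [Matrix.det_mul, h0, zero_mul, Matrix.det_one] at this
      exact zero_ne_one this
    set W := Aᴴ * U with hW
    have dW : IsUnit W.det := by
      rw [hW, Matrix.det_mul, Matrix.det_conjTranspose]
      exact (mul_ne_zero (star_ne_zero.mpr dA) dU).isUnit
    have eS : S' = Wᴴ * W := by
      rw [hS', hW, Matrix.conjTranspose_mul, Matrix.conjTranspose_conjTranspose]
      simp only [Matrix.mul_assoc]
    set Q := W⁻¹ * (C * Cᴴ) * W with hQ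
    have sQ : HasSpec Q (fun i => Real.exp (2 * x.2.1 i)) := by
      rw [hQ, Matrix.mul_assoc, hasSpec_mul_comm, Matrix.mul_assoc, Matrix.mul_nonsing_inv _ dW,
        Matrix.mul_one]
      exact hC
    have sS : HasSpec S' (fun i => Real.exp (2 * x.1 i)) := by
      rw [hS', Matrix.mul_assoc, hasSpec_mul_comm, Matrix.mul_assoc, h1,
        Matrix.mul_one]
      exact hA
    have eD : S' * Q = D := by
      have e1 : S' * Q = Wᴴ * (C * Cᴴ) * W := by
        rw [eS, hQ]
        simp only [Matrix.mul_assoc]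
        rw [← Matrix.mul_assoc W, Matrix.mul_nonsing_inv _ dW, Matrix.one_mul]
      rw [e1, hW, Matrix.conjTranspose_mul, Matrix.conjTranspose_conjTranspose]
      have e2 : D = Uᴴ * P * U := by
        rw [h3]
        simp only [Matrix.mul_assoc]
        rw [h2, Matrix.mul_one, ← Matrix.mul_assoc, h2, Matrix.one_mul]
      rw [e2, hP, Matrix.conjTranspose_mul]
      simp only [Matrix.mul_assoc]
    let E : Matrix (Fin (n+1)) (Fin (n+1)) ℂ := Matrix.diagonal (fun i => ((p (δ i) : ℝ) : ℂ))
    have cS : E * S' = S' * E := by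
      ext a b
      simp only [E, Matrix.diagonal_mul, Matrix.mul_diagonal]
      have := hcomm a b
      push_cast at this
      linear_combination this
    have cQ : E * Q = Q * E := by
      have e1 : S' * (E * Q) = S' * (Q * E) := by
        rw [← Matrix.mul_assoc, ← cS, Matrix.mul_assoc, eD, ← Matrix.mul_assoc, eD]
        simp only [E, hD, Matrix.diagonal_mul_diagonal]
        congr 1; ext i; ring
      have dS : IsUnit S'.det := by
        rw [eS, Matrix.det_mul, Matrix.det_conjTranspose]
        exact (mul_ne_zero (star_ne_zero.mpr dW.ne_zero) dW.ne_zero).isUnit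
      have := congrArg (fun M => S'⁻¹ * M) e1
      simpa [← Matrix.mul_assoc, Matrix.nonsing_inv_mul _ dS] using this
    have zero_of : ∀ M : Matrix (Fin (n+1)) (Fin (n+1)) ℂ, E * M = M * E →
        ∀ i j, ¬ (q i ↔ q j) → M i j = 0 := by
      intro M hM i j hij
      have := congrFun (congrFun hM i) j
      simp only [E, Matrix.diagonal_mul, Matrix.mul_diagonal] at this
      have h2 : (((p (δ i) : ℝ) : ℂ) - ((p (δ j) : ℝ) : ℂ)) * M i j = 0 := by
        linear_combination this
      rcases mul_eq_zero.mp h2 with h3 | h3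
      · exfalso
        have h4 : p (δ i) = p (δ j) := by
          have := sub_eq_zero.mp h3
          exact_mod_cast this
        apply hij
        simp only [q, hK, Finset.mem_filter, Finset.mem_univ, true_and, h4]
      · exact h3
    obtain ⟨I, hI⟩ := block_det' sS K (fun i hi j hj => zero_of _ cS i j (by tauto))
    obtain ⟨J, hJ⟩ := block_det' sQ K (fun i hi j hj => zero_of _ cQ i j (by tauto))
    have hdet := block_prod S' Q δ K eD (fun i hi k hk => zero_of _ cS i k (by tauto))
    rw [hI, hJ, ← Complex.ofReal_mul] at hdet
    have hfin := Complex.ofReal_injective hdet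
    rw [hδ, ← Real.exp_sum, ← Real.exp_sum, ← Real.exp_sum, ← Real.exp_add] at hfin
    have := Real.exp_injective hfin
    rw [← Finset.mul_sum, ← Finset.mul_sum, ← Finset.mul_sum] at this
    exact hw I J K ⟨0, h0⟩ hKu (by linarith)

lemma good_of_gen {n : ℕ} {A C : Matrix (Fin n) (Fin n) ℂ}
    {x : (Fin n → ℝ) × (Fin n → ℝ) × (Fin n → ℝ)} (h : Over A C x) (hx : Gen x) : Good A C := by
  refine ⟨det_ne_zero_of_hasSpec h.1, det_ne_zero_of_hasSpec h.2.1,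
    linInd_pow_of_spec (Matrix.isHermitian_mul_conjTranspose_self _) h.1 hx.1,
    linInd_pow_of_spec (Matrix.isHermitian_conjTranspose_mul_self _)
      (hasSpec_mul_comm.mp h.2.1) hx.2.1, comm_linInd h hx⟩

end Horn


namespace Horn
open Filter Topology
section dens
attribute [local instance] Matrix.linftyOpNormedRing Matrix.linftyOpNormedAlgebra

lemma dense_linInd {E W : Type} [NormedAddCommGroup E] [NormedSpace ℝ E] [NormedAddCommGroup W]
    [NormedSpace ℝ W] [FiniteDimensional ℝ W] {m : ℕ} (v : E → Fin m → W)
    (hv' : ∀ i x y, AnalyticOnNhd ℝ (fun s : ℝ => v (x + s • y) i) Set.univ)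
    {e₀ : E} (he : LinearIndependent ℝ (v e₀)) : Dense {x | LinearIndependent ℝ (v x)} := by
  classical
  obtain ⟨g, hg⟩ := LinearMap.exists_leftInverse_of_injective
    (Fintype.linearCombination ℝ (v e₀)) (by
      rw [LinearMap.ker_eq_bot]
      exact he.fintypeLinearCombination_injective)
  let G : W →L[ℝ] (Fin m → ℝ) := LinearMap.toContinuousLinearMap g
  intro x
  let f : ℝ → ℝ := fun s => (Matrix.of fun i j => G (v (x + s • (e₀ - x)) i) j).det
  have hf : AnalyticOnNhd ℝ f Set.univ := by
    intro s _
    simp only [f, Matrix.det_apply]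
    apply Finset.analyticAt_fun_sum
    intro σ _
    have : AnalyticAt ℝ (fun s : ℝ => ∏ i, (Matrix.of fun i j => G (v (x + s • (e₀ - x)) i) j) (σ i) i) s := by
      apply Finset.analyticAt_fun_prod
      intro i _
      have h1 := hv' (σ i) x (e₀ - x) s (Set.mem_univ s)
      have h2 := (((ContinuousLinearMap.proj (R := ℝ) (φ := fun _ : Fin m => ℝ) i).comp G)).analyticAt
        (v (x + s • (e₀ - x)) (σ i))
      exact AnalyticAt.fun_comp (f := fun s : ℝ => v (x + s • (e₀ - x)) (σ i)) h2 h1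
    have h3 := (analyticAt_const (v := ((Equiv.Perm.sign σ : ℤ) : ℝ))).mul this
    refine h3.congr (Eventually.of_forall fun s => ?_)
    simp [Units.smul_def]
  have h1 : f 1 = 1 := by
    have : (Matrix.of fun i j => G (v (x + (1:ℝ) • (e₀ - x)) i) j) = 1 := by
      ext i j
      have h2 := LinearMap.congr_fun hg (Pi.single i 1)
      simp only [LinearMap.comp_apply, Fintype.linearCombination_apply_single, one_smul,
        LinearMap.id_apply] at h2
      have h3 : x + (1:ℝ) • (e₀ - x) = e₀ := by rw [one_smul]; abel
      rw [Matrix.of_apply, h3]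
      change g (v e₀ i) j = _
      rw [h2, Matrix.one_apply, Pi.single_apply]
      simp [eq_comm]
    simp only [f]
    rw [this, Matrix.det_one]
  have h2 : ∀ᶠ s in 𝓝[≠] (0:ℝ), f s ≠ 0 := by
    rcases (hf 0 (Set.mem_univ _)).eventually_eq_zero_or_eventually_ne_zero with h | h
    · exfalso
      have := hf.eqOn_zero_of_preconnected_of_eventuallyEq_zero isPreconnected_univ
        (Set.mem_univ (0:ℝ)) h (Set.mem_univ (1:ℝ))
      rw [h1] at this
      exact one_ne_zero this
    · exact h
  have h3 : Tendsto (fun s : ℝ => x + s • (e₀ - x)) (𝓝[≠] 0) (𝓝 x) := by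
    have : Continuous (fun s : ℝ => x + s • (e₀ - x)) := by fun_prop
    have h4 := this.tendsto 0
    simp only [zero_smul, add_zero] at h4
    exact h4.mono_left nhdsWithin_le_nhds
  refine mem_closure_of_tendsto h3 (h2.mono fun s hs => ?_)
  have := Matrix.linearIndependent_rows_of_det_ne_zero hs
  exact LinearIndependent.of_comp G.toLinearMap this

/-- the analytic line -/
lemma analytic_line {n : ℕ} (A B : Matrix (Fin n) (Fin n) ℂ) (s : ℝ) :
    AnalyticAt ℝ (fun s : ℝ => A + s • B) s := by fun_prop

lemma analytic_ct {n : ℕ} {f : ℝ → Matrix (Fin n) (Fin n) ℂ} {s : ℝ} (h : AnalyticAt ℝ f s) :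
    AnalyticAt ℝ (fun s : ℝ => (f s)ᴴ) s :=
  AnalyticAt.fun_comp ((ctL n).analyticAt (f s)) h

lemma dense_a (n : ℕ) : Dense {p : Matrix (Fin n) (Fin n) ℂ × Matrix (Fin n) (Fin n) ℂ |
    LinearIndependent ℝ (fun j : Fin n => (p.1 * p.1ᴴ) ^ (j : ℕ))} := by
  refine dense_linInd (fun (p : Matrix (Fin n) (Fin n) ℂ × Matrix (Fin n) (Fin n) ℂ) (j : Fin n) =>
    (p.1 * p.1ᴴ) ^ (j : ℕ)) ?_
    (e₀ := (Matrix.diagonal (fun i => ((Real.exp (-(i:ℕ)) : ℝ) : ℂ)), 1)) ?_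
  · intro i x y s _
    exact ((analytic_line x.1 y.1 s).mul (analytic_ct (analytic_line x.1 y.1 s))).pow _
  · refine linInd_pow_of_spec (a := fun i : Fin n => -((i:ℕ):ℝ))
      (Matrix.isHermitian_mul_conjTranspose_self _) ?_ ?_
    · dsimp only
      rw [Matrix.diagonal_conjTranspose, Matrix.diagonal_mul_diagonal]
      unfold HasSpec
      rw [Matrix.charpoly_diagonal]
      refine Finset.prod_congr rfl fun i _ => ?_
      congr 2
      simp only [Pi.star_apply, RCLike.star_def, Complex.conj_ofReal]
      rw [← Complex.ofReal_mul, ← Real.exp_add]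
      congr 2; ring
    · intro i j hij
      have : ((i:ℕ):ℝ) < (j:ℕ) := by exact_mod_cast hij
      simpa using this

lemma dense_b (n : ℕ) : Dense {p : Matrix (Fin n) (Fin n) ℂ × Matrix (Fin n) (Fin n) ℂ |
    LinearIndependent ℝ (fun j : Fin n => (p.2ᴴ * p.2) ^ (j : ℕ))} := by
  refine dense_linInd (fun (p : Matrix (Fin n) (Fin n) ℂ × Matrix (Fin n) (Fin n) ℂ) (j : Fin n) =>
    (p.2ᴴ * p.2) ^ (j : ℕ)) ?_
    (e₀ := (1, Matrix.diagonal (fun i => ((Real.exp (-(i:ℕ)) : ℝ) : ℂ)))) ?_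
  · intro i x y s _
    exact ((analytic_ct (analytic_line x.2 y.2 s)).mul (analytic_line x.2 y.2 s)).pow _
  · refine linInd_pow_of_spec (a := fun i : Fin n => -((i:ℕ):ℝ))
      (Matrix.isHermitian_conjTranspose_mul_self _) ?_ ?_
    · dsimp only
      rw [Matrix.diagonal_conjTranspose, Matrix.diagonal_mul_diagonal]
      unfold HasSpec
      rw [Matrix.charpoly_diagonal]
      refine Finset.prod_congr rfl fun i _ => ?_
      congr 2
      simp only [Pi.star_apply, RCLike.star_def, Complex.conj_ofReal]
      rw [← Complex.ofReal_mul, ← Real.exp_add]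
      congr 2; ring
    · intro i j hij
      have : ((i:ℕ):ℝ) < (j:ℕ) := by exact_mod_cast hij
      simpa using this

lemma example_d {n : ℕ} : ∃ A C : Matrix (Fin n) (Fin n) ℂ,
    LinearIndependent ℝ (fun j : Fin (n - 1) => ((A * C) * (A * C)ᴴ) ^ ((j : ℕ) + 1) * (A * Aᴴ)
    - (A * Aᴴ) * ((A * C) * (A * C)ᴴ) ^ ((j : ℕ) + 1)) := by
  rcases n with _ | n
  · refine ⟨1, 1, ?_⟩
    rw [Fintype.linearIndependent_iff]
    intro _ _ i; exact absurd i.2 (by simp)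
  let A : Matrix (Fin (n+1)) (Fin (n+1)) ℂ := fun i j => if j ≤ i then 1 else 0
  have hdet : A.det = 1 := by
    rw [Matrix.det_of_isLowerTriangular A]
    · simp [A]
    · intro i j hij
      have : i < j := hij
      simp [A, this]
  let D : Matrix (Fin (n+1)) (Fin (n+1)) ℂ := Matrix.diagonal (fun i => (((i:ℕ) + 1 : ℝ) : ℂ))
  have hAC : A * (A⁻¹ * D) = D := by
    rw [← Matrix.mul_assoc, Matrix.mul_nonsing_inv _ (by rw [hdet]; exact isUnit_one),
      Matrix.one_mul]
  refine ⟨A, A⁻¹ * D, ?_⟩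
  rw [hAC]
  let δ : Fin (n+1) → ℝ := fun i => ((i:ℕ) + 1 : ℝ) ^ 2
  have hinj : Function.Injective δ := by
    intro i j hij
    have := (sq_eq_sq₀ (by positivity) (by positivity)).mp hij
    have h2 : ((i:ℕ):ℝ) = (j:ℕ) := by linarith
    exact Fin.ext (by exact_mod_cast h2)
  have hD : D * Dᴴ = Matrix.diagonal (fun i => ((δ i : ℝ) : ℂ)) := by
    simp only [D]
    rw [Matrix.diagonal_conjTranspose, Matrix.diagonal_mul_diagonal]
    congr 1
    ext i
    simp only [Pi.star_apply, RCLike.star_def, Complex.conj_ofReal]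
    rw [← Complex.ofReal_mul, ← sq]
  have hA : ∀ i, (A * Aᴴ) 0 i = 1 := by
    intro i
    rw [Matrix.mul_apply, Finset.sum_eq_single 0]
    · rw [Matrix.conjTranspose_apply]; simp [A]
    · intro b _ hb
      have : ¬ b ≤ 0 := by simpa using hb
      simp [A, this]
    · simp
  rw [hD, Fintype.linearIndependent_iff]
  intro c hc
  have key : ∀ i, ∑ j : Fin n, c j * δ i ^ ((j:ℕ) + 1) = ∑ j : Fin n, c j * δ 0 ^ ((j:ℕ) + 1) := by
    intro i
    have h5 := congrFun (congrFun hc 0) i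
    simp only [Matrix.diagonal_pow, Matrix.sum_apply, Matrix.smul_apply, Matrix.sub_apply,
      Matrix.diagonal_mul, Matrix.mul_diagonal, Matrix.zero_apply, Pi.pow_apply, hA, mul_one,
      one_mul] at h5
    have h6 := congrArg Complex.re h5
    rw [Complex.re_sum] at h6
    simp only [Complex.smul_re, Complex.sub_re, ← Complex.ofReal_pow, Complex.ofReal_re,
      Complex.zero_re, smul_eq_mul, mul_sub] at h6
    rw [Finset.sum_sub_distrib] at h6
    exact (sub_eq_zero.mp h6).symm
  let v : Fin (n+1) → ℝ := Fin.cons (- ∑ j : Fin n, c j * δ 0 ^ ((j:ℕ) + 1)) c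
  have hv : v = 0 := by
    apply Matrix.eq_zero_of_forall_index_sum_mul_pow_eq_zero hinj
    intro j
    rw [Fin.sum_univ_succ]
    simp only [v, Fin.cons_zero, Fin.cons_succ, Fin.val_zero, pow_zero, mul_one, Fin.val_succ]
    exact neg_add_eq_zero.mpr (key j).symm
  intro i
  have := congrFun hv (Fin.succ i)
  simpa [v] using this

lemma dense_d (n : ℕ) : Dense {p : Matrix (Fin n) (Fin n) ℂ × Matrix (Fin n) (Fin n) ℂ |
    LinearIndependent ℝ (fun j : Fin (n - 1) => ((p.1 * p.2) * (p.1 * p.2)ᴴ) ^ ((j : ℕ) + 1) *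
      (p.1 * p.1ᴴ) - (p.1 * p.1ᴴ) * ((p.1 * p.2) * (p.1 * p.2)ᴴ) ^ ((j : ℕ) + 1))} := by
  obtain ⟨A, C, hAC⟩ := example_d (n := n)
  refine dense_linInd (fun (p : Matrix (Fin n) (Fin n) ℂ × Matrix (Fin n) (Fin n) ℂ)
    (j : Fin (n - 1)) => ((p.1 * p.2) * (p.1 * p.2)ᴴ) ^ ((j : ℕ) + 1) *
      (p.1 * p.1ᴴ) - (p.1 * p.1ᴴ) * ((p.1 * p.2) * (p.1 * p.2)ᴴ) ^ ((j : ℕ) + 1)) ?_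
    (e₀ := (A, C)) hAC
  intro i x y s _
  have a1 := analytic_line x.1 y.1 s
  have a2 := analytic_line x.2 y.2 s
  have a3 := a1.mul (analytic_ct a1)
  have a4 := ((a1.mul a2).mul (analytic_ct (a1.mul a2))).pow ((i:ℕ) + 1)
  exact (a4.mul a3).sub (a3.mul a4)

lemma isOpen_linInd {n m : ℕ} {v : Matrix (Fin n) (Fin n) ℂ × Matrix (Fin n) (Fin n) ℂ → Fin m →
    Matrix (Fin n) (Fin n) ℂ} (hv : Continuous v) : IsOpen {p | LinearIndependent ℝ (v p)} :=
  (isOpen_setOfPred_linearIndependent (𝕜 := ℝ) (E := Matrix (Fin n) (Fin n) ℂ)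
    (ι := Fin m)).preimage hv

lemma dense_good {n : ℕ} {A C : Matrix (Fin n) (Fin n) ℂ} (hA : A.det ≠ 0) (hC : C.det ≠ 0) :
    (A, C) ∈ closure {p : Matrix (Fin n) (Fin n) ℂ × Matrix (Fin n) (Fin n) ℂ | Good p.1 p.2} := by
  have o1 : IsOpen {p : Matrix (Fin n) (Fin n) ℂ × Matrix (Fin n) (Fin n) ℂ |
      LinearIndependent ℝ (fun j : Fin n => (p.1 * p.1ᴴ) ^ (j : ℕ))} := by
    apply isOpen_linInd (v := fun p j => (p.1 * p.1ᴴ) ^ (j : ℕ))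
    refine continuous_pi fun j => ?_
    exact (continuous_fst.mul ((ctL n).continuous.comp continuous_fst)).pow _
  have o2 : IsOpen {p : Matrix (Fin n) (Fin n) ℂ × Matrix (Fin n) (Fin n) ℂ |
      LinearIndependent ℝ (fun j : Fin n => (p.2ᴴ * p.2) ^ (j : ℕ))} := by
    apply isOpen_linInd (v := fun p j => (p.2ᴴ * p.2) ^ (j : ℕ))
    refine continuous_pi fun j => ?_
    exact (((ctL n).continuous.comp continuous_snd).mul continuous_snd).pow _
  have o4 : IsOpen {p : Matrix (Fin n) (Fin n) ℂ × Matrix (Fin n) (Fin n) ℂ |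
      p.1.det ≠ 0 ∧ p.2.det ≠ 0} := by
    apply IsOpen.inter
    · exact isOpen_ne_fun (Continuous.matrix_det continuous_fst) continuous_const
    · exact isOpen_ne_fun (Continuous.matrix_det continuous_snd) continuous_const
  have d := ((dense_a n).inter_of_isOpen_left ((dense_b n).inter_of_isOpen_left (dense_d n) o2) o1)
  have d2 := d.open_subset_closure_inter o4
  refine closure_mono ?_ (d2 (show (A, C) ∈ _ from ⟨hA, hC⟩))
  rintro p ⟨⟨h1, h2⟩, h3, h4, h5⟩
  exact ⟨h1, h2, h3, h4, h5⟩

end dens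
end Horn


namespace Horn
open Filter Topology

lemma gen_smul {n : ℕ} {x : (Fin n → ℝ) × (Fin n → ℝ) × (Fin n → ℝ)} (hx : Gen x) {s : ℝ}
    (hs : 0 < s) : Gen (s • x) := by
  obtain ⟨h1, h2, h3, h4⟩ := hx
  refine ⟨fun i j hij => ?_, fun i j hij => ?_, fun i j hij => ?_, fun I J K hK hK' h => ?_⟩
  · exact mul_lt_mul_of_pos_left (h1 hij) hs
  · exact mul_lt_mul_of_pos_left (h2 hij) hs
  · exact mul_lt_mul_of_pos_left (h3 hij) hs
  · apply h4 I J K hK hK'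
    simp only [Prod.smul_fst, Prod.smul_snd, Pi.smul_apply, smul_eq_mul] at h
    rw [← Finset.mul_sum, ← Finset.mul_sum, ← Finset.mul_sum, ← mul_add] at h
    exact mul_left_cancel₀ hs.ne' h

lemma scale_gen {n : ℕ} {x : (Fin n → ℝ) × (Fin n → ℝ) × (Fin n → ℝ)} (hx : x ∈ Cone n)
    (hg : Gen x) {s : ℝ} (hs : 0 < s) : s • x ∈ Cone n := by
  let u : Set ℝ := {s | 0 < s ∧ s • x ∈ Cone n}
  have hu : IsOpen u := by
    rw [isOpen_iff_mem_nhds]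
    rintro s ⟨hs, hsx⟩
    have hsx' := hsx
    obtain ⟨-, -, -, A, C, hAC⟩ := hsx
    have hg' := gen_smul hg hs
    have h1 := open_of_good hAC (good_of_gen hAC hg')
    have h2 : Tendsto (fun s : ℝ => s • x) (𝓝 s) (𝓝 (s • x)) :=
      (continuous_id.smul continuous_const).tendsto s
    have ht := cone_trace hAC
    filter_upwards [h2.eventually h1, lt_mem_nhds hs] with r hr hr0
    refine ⟨hr0, hr (gen_smul hg hr0).1.antitone (gen_smul hg hr0).2.1.antitone
      (gen_smul hg hr0).2.2.1.antitone ?_⟩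
    simp only [Prod.smul_fst, Prod.smul_snd, Pi.smul_apply, smul_eq_mul] at ht ⊢
    rw [← Finset.mul_sum, ← Finset.mul_sum, ← Finset.mul_sum, ← mul_add] at ht ⊢
    rw [mul_left_cancel₀ hs.ne' ht]
  have hsub := (isPreconnected_Ioi (a := (0:ℝ))).subset_of_closure_inter_subset hu
    ⟨1, Set.mem_Ioi.mpr one_pos, one_pos, by rw [one_smul]; exact hx⟩ (by
      rintro r ⟨hr, hr0⟩
      refine ⟨hr0, ?_⟩
      have hc : Continuous (fun s : ℝ => s • x) := continuous_id.smul continuous_const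
      have := map_mem_closure hc hr (t := Cone n) (fun s hs => hs.2)
      rwa [(isClosed_cone n).closure_eq] at this)
  exact (hsub hs).2

/-- perturbation direction -/
noncomputable def dir (n : ℕ) : (Fin n → ℝ) × (Fin n → ℝ) × (Fin n → ℝ) :=
  (fun i => -((i:ℕ):ℝ), fun i => -((i:ℕ):ℝ),
    fun i => √2 * (((if (i:ℕ) = 0 then ∑ j : Fin n, ((j:ℕ):ℤ) else 0) - ((i:ℕ):ℤ) : ℤ) : ℝ) +
      ((-2 * (∑ j : Fin n, ((j:ℕ):ℚ)) / n : ℚ) : ℝ))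

lemma dir_strict (n : ℕ) : StrictAnti (dir n).1 ∧ StrictAnti (dir n).2.1 ∧
    StrictAnti (dir n).2.2 := by
  have h : StrictAnti (fun i : Fin n => -((i:ℕ):ℝ)) := by
    intro i j hij
    have : ((i:ℕ):ℝ) < (j:ℕ) := by exact_mod_cast hij
    simpa using this
  refine ⟨h, h, ?_⟩
  intro i j hij
  have hj : (j:ℕ) ≠ 0 := by
    have : (i:ℕ) < j := hij
    omega
  simp only [dir]
  rw [add_lt_add_iff_right]
  apply mul_lt_mul_of_pos_left _ (by positivity)
  rw [Int.cast_lt, if_neg hj]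
  have h1 : ((i:ℕ):ℤ) < (j:ℕ) := by exact_mod_cast hij
  have h2 : (0:ℤ) ≤ ∑ j : Fin n, ((j:ℕ):ℤ) := Finset.sum_nonneg fun j _ => by positivity
  split_ifs <;> linarith

lemma dir_trace {n : ℕ} (hn : 0 < n) :
    ∑ i, (dir n).2.2 i = ∑ i, (dir n).1 i + ∑ i, (dir n).2.1 i := by
  obtain ⟨n, rfl⟩ := Nat.exists_eq_succ_of_ne_zero hn.ne'
  simp only [dir]
  rw [Finset.sum_add_distrib, ← Finset.mul_sum, ← Int.cast_sum, Finset.sum_sub_distrib]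
  have : ∑ x : Fin (n+1), (if (x:ℕ) = 0 then ∑ j : Fin (n+1), ((j:ℕ):ℤ) else 0) =
      ∑ j : Fin (n+1), ((j:ℕ):ℤ) := by
    rw [Finset.sum_eq_single 0]
    · simp
    · intro b _ hb
      rw [if_neg]
      intro h; exact hb (Fin.ext h)
    · simp
  rw [this, sub_self]
  simp only [Int.cast_zero, mul_zero, zero_add, Finset.sum_const, Finset.card_univ,
    Fintype.card_fin, nsmul_eq_mul, Finset.sum_neg_distrib]
  push_cast
  have : ((n:ℝ) + 1) ≠ 0 := by positivity
  field_simp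
  ring

lemma dir_wall {n : ℕ} (I J K : Finset (Fin n)) (hK : K.Nonempty) (hK' : K ≠ Finset.univ) :
    ∑ i ∈ K, (dir n).2.2 i - (∑ i ∈ I, (dir n).1 i + ∑ i ∈ J, (dir n).2.1 i) ≠ 0 := by
  simp only [dir]
  rw [Finset.sum_add_distrib, ← Finset.mul_sum, ← Int.cast_sum, Finset.sum_sub_distrib]
  set m : ℤ := ∑ x ∈ K, (if (x:ℕ) = 0 then ∑ j : Fin n, ((j:ℕ):ℤ) else 0) - ∑ x ∈ K, ((x:ℕ):ℤ)
    with hm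
  have hm0 : m ≠ 0 := by
    by_cases h0 : ∃ z ∈ K, (z:ℕ) = 0
    · obtain ⟨z, hz, hz0⟩ := h0
      have e1 : ∑ x ∈ K, (if (x:ℕ) = 0 then ∑ j : Fin n, ((j:ℕ):ℤ) else 0) =
          ∑ j : Fin n, ((j:ℕ):ℤ) := by
        rw [Finset.sum_eq_single_of_mem z hz]
        · rw [if_pos hz0]
        · intro b _ hb
          rw [if_neg]
          intro h; exact hb (Fin.ext (by omega))
      rw [hm, e1, ← Finset.sum_add_sum_compl K, add_sub_cancel_left]
      have hne : Kᶜ.Nonempty := by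
        rw [Finset.nonempty_iff_ne_empty, ne_eq, Finset.compl_eq_empty_iff]; exact hK'
      refine (Finset.sum_pos (fun i hi => ?_) hne).ne'
      have : (i:ℕ) ≠ 0 := by
        intro h
        apply Finset.mem_compl.mp hi
        have : i = z := Fin.ext (by omega)
        rwa [this]
      omega
    · have e1 : ∑ x ∈ K, (if (x:ℕ) = 0 then ∑ j : Fin n, ((j:ℕ):ℤ) else 0) = 0 := by
        apply Finset.sum_eq_zero
        intro x hx
        rw [if_neg]
        intro h; exact h0 ⟨x, hx, h⟩
      rw [hm, e1, zero_sub, neg_ne_zero]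
      refine (Finset.sum_pos (fun i hi => ?_) hK).ne'
      have : (i:ℕ) ≠ 0 := fun h => h0 ⟨i, hi, h⟩
      omega
  intro h
  have hirr := (irrational_sqrt_two.mul_intCast hm0)
  apply hirr
  refine ⟨-((∑ i ∈ K, (-2 * (∑ j : Fin n, ((j:ℕ):ℚ)) / n : ℚ)) -
    (∑ i ∈ I, (-((i:ℕ):ℚ)) + ∑ i ∈ J, (-((i:ℕ):ℚ)))), ?_⟩
  push_cast
  push_cast at h
  linarith

lemma mem_closure_gen {n : ℕ} {x : (Fin n → ℝ) × (Fin n → ℝ) × (Fin n → ℝ)} (hx : x ∈ Cone n)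
    {A C : Matrix (Fin n) (Fin n) ℂ} (h : Over A C x) (hg : Good A C) :
    x ∈ closure (Cone n ∩ {x | Gen x}) := by
  rcases Nat.eq_zero_or_pos n with rfl | hn
  · apply subset_closure
    refine ⟨hx, fun i => i.elim0, fun i => i.elim0, fun i => i.elim0, fun I J K hK => ?_⟩
    obtain ⟨i, _⟩ := hK
    exact i.elim0
  have hc : Continuous (fun ε : ℝ => x + ε • dir n) := by fun_prop
  have ht : Tendsto (fun ε : ℝ => x + ε • dir n) (𝓝[>] 0) (𝓝 x) := by
    have := hc.tendsto 0
    simp only [zero_smul, add_zero] at this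
    exact this.mono_left nhdsWithin_le_nhds
  refine mem_closure_of_tendsto ht ?_
  have e1 := ht.eventually (open_of_good h hg)
  have e2 : ∀ᶠ ε in 𝓝[>] (0:ℝ), ∀ I J K : Finset (Fin n), K.Nonempty → K ≠ Finset.univ →
      ∑ i ∈ K, (x + ε • dir n).2.2 i ≠
        ∑ i ∈ I, (x + ε • dir n).1 i + ∑ i ∈ J, (x + ε • dir n).2.1 i := by
    rw [eventually_all]; intro I
    rw [eventually_all]; intro J
    rw [eventually_all]; intro K
    by_cases hK : K.Nonempty
    swap
    · exact Eventually.of_forall fun _ h => absurd h hK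
    by_cases hK' : K = Finset.univ
    · exact Eventually.of_forall fun _ _ h => absurd hK' h
    have hw := dir_wall I J K hK hK'
    set w := ∑ i ∈ K, (dir n).2.2 i - (∑ i ∈ I, (dir n).1 i + ∑ i ∈ J, (dir n).2.1 i) with hwdef
    set v := ∑ i ∈ K, x.2.2 i - (∑ i ∈ I, x.1 i + ∑ i ∈ J, x.2.1 i) with hvdef
    have hne : ∀ᶠ ε in 𝓝[>] (0:ℝ), ε ≠ -v / w := by
      by_cases h0 : -v / w = 0
      · rw [h0]
        filter_upwards [self_mem_nhdsWithin] with ε hε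
        exact (Set.mem_Ioi.mp hε).ne'
      · exact (eventually_ne_nhds (Ne.symm h0)).filter_mono nhdsWithin_le_nhds
    filter_upwards [hne] with ε hε _ _ heq
    apply hε
    rw [eq_div_iff hw]
    simp only [Prod.snd_add, Prod.fst_add, Prod.smul_fst, Prod.smul_snd, Pi.add_apply,
      Pi.smul_apply, smul_eq_mul, Finset.sum_add_distrib] at heq
    rw [← Finset.mul_sum, ← Finset.mul_sum, ← Finset.mul_sum] at heq
    rw [hwdef, hvdef]
    linarith
  filter_upwards [e1, e2, self_mem_nhdsWithin] with ε h1 h2 h3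
  have h3' : 0 < ε := h3
  obtain ⟨d1, d2, d3⟩ := dir_strict n
  obtain ⟨x1, x2, x3, -⟩ := hx
  have str : ∀ a d : Fin n → ℝ, Antitone a → StrictAnti d → StrictAnti (a + ε • d) := by
    intro a d ha hd i j hij
    exact add_lt_add_of_le_of_lt (ha hij.le) (mul_lt_mul_of_pos_left (hd hij) h3')
  have s1 := str _ _ x1 d1
  have s2 := str _ _ x2 d2
  have s3 := str _ _ x3 d3
  refine ⟨h1 s1.antitone s2.antitone s3.antitone ?_, s1, s2, s3, h2⟩
  have t1 := cone_trace h
  have t2 := dir_trace hn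
  simp only [Prod.snd_add, Prod.fst_add, Prod.smul_fst, Prod.smul_snd, Pi.add_apply,
      Pi.smul_apply, smul_eq_mul, Finset.sum_add_distrib]
  rw [← Finset.mul_sum, ← Finset.mul_sum, ← Finset.mul_sum, t1, t2]
  ring

lemma cone_subset_closure {n : ℕ} {x : (Fin n → ℝ) × (Fin n → ℝ) × (Fin n → ℝ)}
    (hx : x ∈ Cone n) : x ∈ closure (Cone n ∩ {x | Gen x}) := by
  obtain ⟨x1, x2, x3, A, C, h⟩ := hx
  have dA := det_ne_zero_of_hasSpec h.1
  have dC := det_ne_zero_of_hasSpec h.2.1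
  haveI : FirstCountableTopology (Matrix (Fin n) (Fin n) ℂ) :=
    inferInstanceAs (FirstCountableTopology (Fin n → Fin n → ℂ))
  obtain ⟨p, hp, hl⟩ := mem_closure_iff_seq_limit.mp (dense_good dA dC)
  have hAC : ∀ m, ((p m).1 * (p m).2).det ≠ 0 := fun m => by
    rw [Matrix.det_mul]; exact mul_ne_zero (hp m).1 (hp m).2.1
  choose a ha sa _ using fun m => exists_log_spec (posDef_mul_conj (hp m).1)
  choose c hc sc _ using fun m => exists_log_spec (posDef_mul_conj (hp m).2.1)
  choose t ht st _ using fun m => exists_log_spec (posDef_mul_conj (hAC m))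
  have l1 : Tendsto (fun m => (p m).1) atTop (𝓝 A) := hl.fst_nhds
  have l2 : Tendsto (fun m => (p m).2) atTop (𝓝 C) := hl.snd_nhds
  have hm : ∀ m, (a m, c m, t m) ∈ closure (Cone n ∩ {x | Gen x}) := by
    intro m
    have ho : Over (p m).1 (p m).2 (a m, c m, t m) := ⟨sa m, sc m, st m⟩
    exact mem_closure_gen ⟨ha m, hc m, ht m, _, _, ho⟩ ho (hp m)
  have hlim : ∀ {B : ℕ → Matrix (Fin n) (Fin n) ℂ} {B₀ : Matrix (Fin n) (Fin n) ℂ},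
      Tendsto B atTop (𝓝 B₀) → Tendsto (fun m => B m * (B m)ᴴ) atTop (𝓝 (B₀ * B₀ᴴ)) := by
    intro B B₀ hB
    have hcont : Continuous (fun B : Matrix (Fin n) (Fin n) ℂ => B * Bᴴ) :=
      continuous_id.mul continuous_id.matrix_conjTranspose
    exact (hcont.tendsto B₀).comp hB
  have t1 := log_spec_tendsto (fun m => Matrix.isHermitian_mul_conjTranspose_self (p m).1)
    (Matrix.isHermitian_mul_conjTranspose_self A) sa h.1 ha x1 (hlim l1)
  have t2 := log_spec_tendsto (fun m => Matrix.isHermitian_mul_conjTranspose_self (p m).2)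
    (Matrix.isHermitian_mul_conjTranspose_self C) sc h.2.1 hc x2 (hlim l2)
  have t3 := log_spec_tendsto (fun m => Matrix.isHermitian_mul_conjTranspose_self ((p m).1 * (p m).2))
    (Matrix.isHermitian_mul_conjTranspose_self (A * C)) st h.2.2 ht x3 (hlim (l1.mul l2))
  have : Tendsto (fun m => (a m, c m, t m)) atTop (𝓝 x) := t1.prodMk_nhds (t2.prodMk_nhds t3)
  exact isClosed_closure.mem_of_tendsto this (Eventually.of_forall hm)

/-- scale invariance of the cone -/
theorem cone_smul {n : ℕ} {x : (Fin n → ℝ) × (Fin n → ℝ) × (Fin n → ℝ)} (hx : x ∈ Cone n)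
    {s : ℝ} (hs : 0 < s) : s • x ∈ Cone n := by
  have hc : Continuous (fun y : (Fin n → ℝ) × (Fin n → ℝ) × (Fin n → ℝ) => s • y) :=
    continuous_const_smul s
  have := map_mem_closure hc (cone_subset_closure hx) (t := Cone n)
    (fun y hy => scale_gen hy.1 hy.2 hs)
  rwa [(isClosed_cone n).closure_eq] at this

end Horn


namespace Horn
open MvPolynomial in
/-- A strictly stable, real, homogeneous ternary form of degree `d`. -/
structure SS (d : ℕ) (q : MvPolynomial (Fin 3) ℂ) : Prop where
  hom : q.IsHomogeneous d
  conj : MvPolynomial.map (starRingEnd ℂ) q = q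
  stab : ∀ z : Fin 3 → ℂ, (∀ i, 0 ≤ (z i).im) → (∃ i, (z i).im ≠ 0) → eval z q ≠ 0
  pos : ∀ e : Fin 3 → ℝ, (∀ i, 0 ≤ e i) → e ≠ 0 → 0 < (eval (fun i => (e i : ℂ)) q).re

open MvPolynomial

lemma hom_eval {d : ℕ} {q : MvPolynomial (Fin 3) ℂ} (h : q.IsHomogeneous d) (u : ℂ)
    (z : Fin 3 → ℂ) : eval (fun i => u * z i) q = u ^ d * eval z q := by
  rw [eval_eq, eval_eq, Finset.mul_sum]
  refine Finset.sum_congr rfl fun m hm => ?_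
  have hd : ∑ i ∈ m.support, m i = d := (h.degree_eq_sum_deg_support hm).symm
  rw [← hd, ← Finset.prod_pow_eq_pow_sum]
  simp only [mul_pow, Finset.prod_mul_distrib]
  ring

lemma real_eval {q : MvPolynomial (Fin 3) ℂ} (h : MvPolynomial.map (starRingEnd ℂ) q = q)
    (e : Fin 3 → ℝ) : (eval (fun i => (e i : ℂ)) q).im = 0 := by
  rw [← Complex.conj_eq_iff_im]
  have := MvPolynomial.eval₂_comp_left (starRingEnd ℂ) (RingHom.id ℂ) (fun i => (e i : ℂ)) q
  have h2 : eval (fun i => (e i : ℂ)) (MvPolynomial.map (starRingEnd ℂ) q)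
      = (starRingEnd ℂ) (eval (fun i => (e i : ℂ)) q) := by
    rw [MvPolynomial.eval_map]
    change _ = (starRingEnd ℂ) (eval₂ (RingHom.id ℂ) _ q)
    rw [this]
    congr 1
    ext i
    simp
  rw [← h2, h]

/-- restriction to a coordinate line -/
noncomputable def lineP (z : Fin 3 → ℂ) (j : Fin 3) (q : MvPolynomial (Fin 3) ℂ) : Polynomial ℂ :=
  aeval (fun i => Polynomial.C (z i) + if i = j then Polynomial.X else 0) q

lemma lineP_eval (z : Fin 3 → ℂ) (j : Fin 3) (q : MvPolynomial (Fin 3) ℂ) (w : ℂ) :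
    (lineP z j q).eval w = eval (fun i => z i + if i = j then w else 0) q := by
  unfold lineP
  induction q using MvPolynomial.induction_on with
  | C a => simp [← Polynomial.C_eq_algebraMap]
  | add p q hp hq => simp [hp, hq]
  | mul_X p i hp =>
    simp only [map_mul, aeval_X, Polynomial.eval_mul, hp, eval_X]
    by_cases h : i = j <;> simp [h]

lemma lineP_deriv (z : Fin 3 → ℂ) (j : Fin 3) (q : MvPolynomial (Fin 3) ℂ) :
    Polynomial.derivative (lineP z j q) = lineP z j (pderiv j q) := by
  unfold lineP
  induction q using MvPolynomial.induction_on with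
  | C a => simp [← Polynomial.C_eq_algebraMap]
  | add p q hp hq => simp [hp, hq]
  | mul_X p i hp =>
    simp only [map_mul, aeval_X, Polynomial.derivative_mul, hp, pderiv_mul, map_add, pderiv_X]
    by_cases h : i = j
    · subst h; simp
    · simp [h, Pi.single_apply, Ne.symm h]

lemma SS.exists_root {d : ℕ} {q : MvPolynomial (Fin 3) ℂ} (h : SS (d+1) q) (z : Fin 3 → ℂ)
    (j : Fin 3) : (lineP z j q).roots ≠ 0 := by
  intro hr
  have hdeg : (lineP z j q).natDegree = 0 := by
    have := (Polynomial.splits_iff_card_roots.mp (IsAlgClosed.splits (lineP z j q)))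
    rw [hr] at this; simpa using this.symm
  have hc : ∀ w, eval (fun i => z i + if i = j then w else 0) q = eval z q := by
    intro w
    have e := Polynomial.eq_C_of_natDegree_eq_zero hdeg
    have h1 := lineP_eval z j q w
    have h2 := lineP_eval z j q 0
    rw [e] at h1 h2
    simp at h1 h2
    rw [← h1, h2]
  have key : (fun u : ℂ => eval (fun i => u * z i + if i = j then 1 else 0) q)
      = fun u => u ^ (d+1) * eval z q := by
    refine Continuous.ext_on (dense_compl_singleton (0:ℂ)) ?_ (by fun_prop) ?_
    · exact (MvPolynomial.continuous_eval q).comp (by fun_prop)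
    · intro u hu
      have hu : u ≠ 0 := hu
      simp only
      rw [← hc u⁻¹, ← hom_eval h.hom]
      congr 2
      funext i
      by_cases hi : i = j <;> simp [hi, mul_add, hu]
  have k0 := congrFun key 0
  simp at k0
  have hp := h.pos (fun i => if i = j then 1 else 0) (fun i => by split_ifs <;> norm_num)
    (fun h => by have := congrFun h j; simp at this)
  have : (fun i => (((if i = j then 1 else 0 : ℝ)) : ℂ)) = fun i : Fin 3 => if i = j then (1:ℂ) else 0 := by
    funext i; split_ifs <;> simp
  rw [this, k0] at hp
  simp at hp

lemma SS.div_eq {d : ℕ} {q : MvPolynomial (Fin 3) ℂ} (_h : SS (d+1) q) (z : Fin 3 → ℂ)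
    (j : Fin 3) (h0 : eval z q ≠ 0) : eval z (pderiv j q) / eval z q
      = ((lineP z j q).roots.map fun w => 1 / (0 - w)).sum := by
  have e : ∀ p, (lineP z j p).eval 0 = eval z p := by
    intro p; rw [lineP_eval]; simp
  have := (IsAlgClosed.splits (lineP z j q)).eval_derivative_div_eval_of_ne_zero (x := 0)
    (by rwa [e])
  rw [lineP_deriv, e, e] at this
  exact this

lemma multiset_sum_pos {s : Multiset ℂ} (hs : s ≠ 0) (φ : ℂ →+ ℝ) (h : ∀ w ∈ s, 0 < φ w) :
    0 < φ s.sum := by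
  induction s using Multiset.induction_on with
  | empty => exact absurd rfl hs
  | cons a s ih =>
    rw [Multiset.sum_cons, map_add]
    by_cases h0 : s = 0
    · subst h0; simpa using h a (by simp)
    · exact add_pos (h a (by simp)) (ih h0 (fun w hw => h w (by simp [hw])))

lemma SS.pderiv {d : ℕ} {q : MvPolynomial (Fin 3) ℂ} (h : SS (d+1) q) (j : Fin 3) :
    SS d (MvPolynomial.pderiv j q) := by
  refine ⟨by simpa using h.hom.pderiv (i := j), by rw [← pderiv_map, h.conj], ?_, ?_⟩
  · intro z hz hz' h0
    have hq := h.stab z hz hz'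
    have e := h.div_eq z j hq
    rw [h0, zero_div] at e
    have := multiset_sum_pos (s := (lineP z j q).roots.map fun w => 1 / (0 - w))
      (by simpa using h.exists_root z j) (-Complex.imAddGroupHom) (by
        intro w hw
        rw [Multiset.mem_map] at hw
        obtain ⟨v, hv, rfl⟩ := hw
        have hv0 : (lineP z j q).eval v = 0 := (Polynomial.mem_roots'.mp hv).2
        have hvi : v.im < 0 := by
          by_contra hc
          push Not at hc
          rw [lineP_eval] at hv0
          refine h.stab _ ?_ ?_ hv0
          · intro i; by_cases hi : i = j <;> simp [hi, hz] ; linarith [hz j]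
          · obtain ⟨i, hi⟩ := hz'
            refine ⟨i, ?_⟩
            have := lt_of_le_of_ne (hz i) (Ne.symm hi)
            by_cases hij : i = j <;> simp [hij]
            · subst hij; linarith
            · exact hi
        have hn : 0 < Complex.normSq v := Complex.normSq_pos.mpr (by rintro rfl; simp at hvi)
        simp [Complex.inv_im]
        exact div_pos (neg_pos.mpr hvi) hn)
    rw [← e] at this
    simp at this
  · intro e he hne
    have hqp := h.pos e he hne
    set z : Fin 3 → ℂ := fun i => (e i : ℂ) with hz
    have hq : eval z q ≠ 0 := by intro h0; rw [h0] at hqp; simp at hqp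
    have ed := h.div_eq z j hq
    have := multiset_sum_pos (s := (lineP z j q).roots.map fun w => 1 / (0 - w))
      (by simpa using h.exists_root z j) (Complex.reAddGroupHom) (by
        intro w hw
        rw [Multiset.mem_map] at hw
        obtain ⟨v, hv, rfl⟩ := hw
        have hv0 : (lineP z j q).eval v = 0 := (Polynomial.mem_roots'.mp hv).2
        have hvi : v.re < 0 := by
          by_contra hc
          push Not at hc
          rw [lineP_eval] at hv0
          have := hom_eval h.hom Complex.I (fun i => z i + if i = j then v else 0)
          rw [hv0, mul_zero] at this
          refine h.stab _ ?_ ?_ this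
          · intro i; by_cases hi : i = j <;> simp [hi, hz, he] ; linarith [he j]
          · obtain ⟨i, hi⟩ := Function.ne_iff.mp hne
            refine ⟨i, ?_⟩
            have := lt_of_le_of_ne (he i) (Ne.symm hi)
            by_cases hij : i = j <;> simp [hij, hz]
            · subst hij; linarith
            · simpa using hi
        have hn : 0 < Complex.normSq v := Complex.normSq_pos.mpr (by rintro rfl; simp at hvi)
        simp [Complex.inv_re]
        apply div_neg_of_neg_of_pos hvi hn)
    rw [← ed] at this
    have him := real_eval h.conj e
    have e1 : eval z q = (((eval z q).re : ℝ) : ℂ) := by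
      apply Complex.ext <;> simp [him, hz]
    rw [e1] at this
    have h2 : 0 < (eval z (MvPolynomial.pderiv j q)).re / (eval z q).re := by
      rw [← Complex.div_ofReal_re]; exact this
    have := mul_pos h2 hqp
    rwa [div_mul_cancel₀ _ hqp.ne'] at this

end Horn


namespace Horn
open MvPolynomial
open scoped ComplexOrder

noncomputable def mon (a b c : ℕ) : Fin 3 →₀ ℕ :=
  Finsupp.single 0 a + Finsupp.single 1 b + Finsupp.single 2 c

/-- factorially normalised coefficients -/
noncomputable def W (q : MvPolynomial (Fin 3) ℂ) (a b c : ℕ) : ℂ :=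
  (a.factorial * b.factorial * c.factorial : ℕ) * coeff (mon a b c) q

lemma W_pderiv0 (q : MvPolynomial (Fin 3) ℂ) (a b c : ℕ) : W (pderiv 0 q) a b c = W q (a+1) b c := by
  unfold W
  rw [coeff_pderiv]
  have : mon a b c + Finsupp.single 0 1 = mon (a+1) b c := by
    simp only [mon, Finsupp.single_add]; abel
  rw [this]
  simp [mon, Nat.factorial_succ]; ring

lemma W_pderiv1 (q : MvPolynomial (Fin 3) ℂ) (a b c : ℕ) : W (pderiv 1 q) a b c = W q a (b+1) c := by
  unfold W
  rw [coeff_pderiv]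
  have : mon a b c + Finsupp.single 1 1 = mon a (b+1) c := by
    simp only [mon, Finsupp.single_add]; abel
  rw [this]
  simp [mon, Nat.factorial_succ]; ring

lemma W_pderiv2 (q : MvPolynomial (Fin 3) ℂ) (a b c : ℕ) : W (pderiv 2 q) a b c = W q a b (c+1) := by
  unfold W
  rw [coeff_pderiv]
  have : mon a b c + Finsupp.single 2 1 = mon a b (c+1) := by
    simp only [mon, Finsupp.single_add]; abel
  rw [this]
  simp [mon, Nat.factorial_succ]; ring

lemma exists_shift (a b c : ℕ) : ∀ (d : ℕ) (q : MvPolynomial (Fin 3) ℂ), SS (d + (a+b+c)) q →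
    ∃ q', SS d q' ∧ ∀ i j k, W q' i j k = W q (i+a) (j+b) (k+c) := by
  induction a with
  | zero =>
    induction b with
    | zero =>
      induction c with
      | zero => intro d q h; exact ⟨q, by simpa using h, fun i j k => rfl⟩
      | succ c ih =>
        intro d q h
        obtain ⟨q', h1, h2⟩ := ih d (pderiv 2 q) (SS.pderiv (by convert h using 1; ring) 2)
        exact ⟨q', h1, fun i j k => by rw [h2, W_pderiv2]; rfl⟩
    | succ b ih =>
      intro d q h
      obtain ⟨q', h1, h2⟩ := ih d (pderiv 1 q) (SS.pderiv (by convert h using 1; ring) 1)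
      exact ⟨q', h1, fun i j k => by rw [h2, W_pderiv1]; rfl⟩
  | succ a ih =>
    intro d q h
    obtain ⟨q', h1, h2⟩ := ih d (pderiv 0 q) (SS.pderiv (by convert h using 1; ring) 0)
    exact ⟨q', h1, fun i j k => by rw [h2, W_pderiv0]; rfl⟩

lemma SS.zero_pos {q : MvPolynomial (Fin 3) ℂ} (h : SS 0 q) :
    q = C (W q 0 0 0) ∧ ∃ r : ℝ, 0 < r ∧ W q 0 0 0 = r := by
  have e : W q 0 0 0 = coeff 0 q := by simp [W, mon]
  have hq : q = C (coeff 0 q) := by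
    rw [← totalDegree_eq_zero_iff_eq_C, totalDegree_zero_iff_isHomogeneous]; exact h.hom
  rw [e]
  refine ⟨hq, (coeff 0 q).re, ?_, ?_⟩
  · have := h.pos (fun _ => 1) (fun _ => zero_le_one) (fun h => by simpa using congrFun h 0)
    rw [hq] at this
    simpa using this
  · have := real_eval h.conj (fun _ => 1)
    rw [hq] at this
    simp only [eval_C] at this
    apply Complex.ext <;> simp [this]

lemma SS.W_pos {d a b c : ℕ} {q : MvPolynomial (Fin 3) ℂ} (h : SS d q) (hd : a + b + c = d) :
    0 < (W q a b c).re ∧ (W q a b c).im = 0 := by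
  obtain ⟨q', h1, h2⟩ := exists_shift a b c 0 q (by subst hd; simpa using h)
  obtain ⟨-, r, hr, e⟩ := h1.zero_pos
  have := h2 0 0 0
  simp only [zero_add] at this
  rw [← this, e]; simp [hr]

lemma SS.quad_eval {q : MvPolynomial (Fin 3) ℂ} (h : SS 2 q) (z : Fin 3 → ℂ) :
    2 * eval z q = z 0 ^ 2 * W q 2 0 0 + z 1 ^ 2 * W q 0 2 0 + z 2 ^ 2 * W q 0 0 2
      + 2 * (z 0 * z 1 * W q 1 1 0 + z 0 * z 2 * W q 1 0 1 + z 1 * z 2 * W q 0 1 1) := by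
  have e1 := h.hom.sum_X_mul_pderiv
  have e2 := fun i => ((h.pderiv i).hom.sum_X_mul_pderiv)
  have e3 := fun i j => (((h.pderiv i).pderiv j).zero_pos).1
  apply_fun eval z at e1
  have e2' := fun i => congrArg (eval z) (e2 i)
  have e3' := fun i j => congrArg (eval z) (e3 i j)
  simp only [eval_C] at e3'
  simp only [Fin.sum_univ_three, map_add, map_mul, eval_X, e3', nsmul_eq_mul] at e1 e2'
  have a0 := e2' 0
  have a1 := e2' 1
  have a2 := e2' 2
  simp only [W_pderiv0, W_pderiv1, W_pderiv2] at a0 a1 a2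
  have E1 : eval z 1 = 1 := map_one _
  have E2 : eval z 2 = 2 := map_ofNat _ _
  push_cast at a0 a1 a2 e1
  rw [E1] at a0 a1 a2
  rw [E2] at e1
  linear_combination -e1 - z 0 * a0 - z 1 * a1 - z 2 * a2

lemma quad_key {A B c m11 m12 m22 : ℝ} (hA : 0 < A) (hB : 0 < B) (hc : 0 < c) (h11 : 0 < m11)
    (h22 : 0 < m22)
    (h : ∀ s r : ℝ, 0 < s → 0 < r → c * (s^2 * m11 + 2 * s * r * m12 + r^2 * m22) ≤ (s * A + r * B)^2) :
    m12 * c ≤ 2 * (A * B) := by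
  have := h (1/A) (1/B) (by positivity) (by positivity)
  field_simp at this
  have p1 : 0 < c * (B^2 * m11) := by positivity
  have p2 : 0 < c * (A^2 * m22) := by positivity
  have hAB : 0 < A * B := by positivity
  have : (m12 * c) * (A*B) ≤ 2 * (A * B) * (A * B) := by nlinarith
  exact le_of_mul_le_mul_right this hAB

lemma disc_key {c b d : ℝ} (hc : 0 < c)
    (h : ∀ t : ℂ, 0 < t.im → (c:ℂ) * t^2 + 2 * b * t + d ≠ 0) : c * d ≤ b^2 := by
  by_contra hlt
  push Not at hlt
  set D := Real.sqrt (c * d - b^2) with hD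
  have hD2 : D^2 = c * d - b^2 := Real.sq_sqrt (by linarith)
  have hDp : 0 < D := Real.sqrt_pos.mpr (by linarith)
  refine h ⟨-b/c, D/c⟩ (by simp; positivity) ?_
  apply Complex.ext
  · simp [pow_two]
    field_simp
    nlinarith
  · simp [pow_two]
    field_simp
    ring

lemma SS.quad2 {q : MvPolynomial (Fin 3) ℂ} (h : SS 2 q) :
    (W q 1 1 0).re * (W q 0 0 2).re ≤ 2 * ((W q 1 0 1).re * (W q 0 1 1).re) ∧
    (W q 1 0 1).re * (W q 0 2 0).re ≤ 2 * ((W q 1 1 0).re * (W q 0 1 1).re) ∧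
    (W q 0 1 1).re * (W q 2 0 0).re ≤ 2 * ((W q 1 1 0).re * (W q 1 0 1).re) := by
  obtain ⟨p200, i200⟩ := h.W_pos (a := 2) (b := 0) (c := 0) rfl
  obtain ⟨p020, i020⟩ := h.W_pos (a := 0) (b := 2) (c := 0) rfl
  obtain ⟨p002, i002⟩ := h.W_pos (a := 0) (b := 0) (c := 2) rfl
  obtain ⟨p110, i110⟩ := h.W_pos (a := 1) (b := 1) (c := 0) rfl
  obtain ⟨p101, i101⟩ := h.W_pos (a := 1) (b := 0) (c := 1) rfl
  obtain ⟨p011, i011⟩ := h.W_pos (a := 0) (b := 1) (c := 1) rfl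
  have re : ∀ {w : ℂ}, w.im = 0 → w = (w.re : ℂ) := fun hw => by apply Complex.ext <;> simp [hw]
  have E := h.quad_eval
  rw [re i200, re i020, re i002, re i110, re i101, re i011] at E
  generalize (W q 2 0 0).re = m200 at *
  generalize (W q 0 2 0).re = m020 at *
  generalize (W q 0 0 2).re = m002 at *
  generalize (W q 1 1 0).re = m110 at *
  generalize (W q 1 0 1).re = m101 at *
  generalize (W q 0 1 1).re = m011 at *
  refine ⟨quad_key p101 p011 p002 p200 p020 ?_, ?_, quad_key p110 p101 p200 p020 p002 ?_⟩
  · intro s r hs hr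
    apply disc_key p002
    intro t ht h0
    refine h.stab ![(s:ℂ), (r:ℂ), t] ?_ ⟨2, by simpa using ht.ne'⟩ ?_
    · intro i; fin_cases i <;> simp [ht.le]
    · have := E ![(s:ℂ), (r:ℂ), t]
      simp at this
      push_cast at h0
      have h3 : 2 * eval ![(s:ℂ), (r:ℂ), t] q = 0 := by rw [this, ← h0]; ring
      simpa using h3
  · refine quad_key p110 p011 p020 p200 p002 ?_
    intro s r hs hr
    apply disc_key p020
    intro t ht h0
    refine h.stab ![(s:ℂ), t, (r:ℂ)] ?_ ⟨1, by simpa using ht.ne'⟩ ?_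
    · intro i; fin_cases i <;> simp [ht.le]
    · have := E ![(s:ℂ), t, (r:ℂ)]
      simp at this
      push_cast at h0
      have h3 : 2 * eval ![(s:ℂ), t, (r:ℂ)] q = 0 := by rw [this, ← h0]; ring
      simpa using h3
  · intro s r hs hr
    apply disc_key p200
    intro t ht h0
    refine h.stab ![t, (s:ℂ), (r:ℂ)] ?_ ⟨0, by simpa using ht.ne'⟩ ?_
    · intro i; fin_cases i <;> simp [ht.le]
    · have := E ![t, (s:ℂ), (r:ℂ)]
      simp at this
      push_cast at h0
      have h3 : 2 * eval ![t, (s:ℂ), (r:ℂ)] q = 0 := by rw [this, ← h0]; ring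
      simpa using h3

/-- log-concavity type (rhombus) inequalities -/
lemma SS.rhombi {a b c : ℕ} {q : MvPolynomial (Fin 3) ℂ} (h : SS (2 + (a + b + c)) q) :
    (W q (1+a) (1+b) c).re * (W q a b (2+c)).re ≤ 2 * ((W q (1+a) b (1+c)).re * (W q a (1+b) (1+c)).re) ∧
    (W q (1+a) b (1+c)).re * (W q a (2+b) c).re ≤ 2 * ((W q (1+a) (1+b) c).re * (W q a (1+b) (1+c)).re) ∧
    (W q a (1+b) (1+c)).re * (W q (2+a) b c).re ≤ 2 * ((W q (1+a) (1+b) c).re * (W q (1+a) b (1+c)).re) := by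
  obtain ⟨q', h1, h2⟩ := exists_shift a b c 2 q h
  have := h1.quad2
  simp only [h2, zero_add] at this
  exact this

/-- the determinantal polynomial -/
noncomputable def detP {n : ℕ} (Y Z : Matrix (Fin n) (Fin n) ℂ) : MvPolynomial (Fin 3) ℂ :=
  Matrix.det (Matrix.of fun i j => C ((1 : Matrix (Fin n) (Fin n) ℂ) i j) * X 0 + C (Y i j) * X 1 + C (Z i j) * X 2)

lemma detP_map {n : ℕ} (Y Z : Matrix (Fin n) (Fin n) ℂ) {R : Type*} [CommRing R] [Algebra ℂ R]
    (g : Fin 3 → R) : aeval g (detP Y Z) = Matrix.det (g 0 • (1 : Matrix (Fin n) (Fin n) R)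
      + g 1 • Y.map (algebraMap ℂ R) + g 2 • Z.map (algebraMap ℂ R)) := by
  unfold detP
  rw [AlgHom.map_det]
  congr 1
  ext i j
  simp [Matrix.one_apply, apply_ite, mul_comm]

lemma detP_eval {n : ℕ} (Y Z : Matrix (Fin n) (Fin n) ℂ) (z : Fin 3 → ℂ) :
    eval z (detP Y Z) = Matrix.det (z 0 • (1 : Matrix (Fin n) (Fin n) ℂ) + z 1 • Y + z 2 • Z) := by
  have := detP_map Y Z z
  rw [MvPolynomial.aeval_eq_eval] at this
  simpa using this

lemma detP_hom {n : ℕ} (Y Z : Matrix (Fin n) (Fin n) ℂ) : (detP Y Z).IsHomogeneous n := by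
  unfold detP
  rw [Matrix.det_apply']
  refine IsHomogeneous.sum _ _ _ fun σ _ => ?_
  have : ((Equiv.Perm.sign σ : ℤ) : MvPolynomial (Fin 3) ℂ) = C ((Equiv.Perm.sign σ : ℤ) : ℂ) := by simp
  rw [this]
  apply IsHomogeneous.C_mul
  have := IsHomogeneous.prod Finset.univ (fun i => (Matrix.of fun i j => (C ((1 : Matrix (Fin n) (Fin n) ℂ) i j) * X 0 + C (Y i j) * X 1 + C (Z i j) * X 2 : MvPolynomial (Fin 3) ℂ)) (σ i) i) (fun _ => 1)
    (fun i _ => by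
      simp only [Matrix.of_apply]
      exact ((isHomogeneous_C_mul_X _ _).add (isHomogeneous_C_mul_X _ _)).add (isHomogeneous_C_mul_X _ _))
  simpa using this

lemma detP_conj {n : ℕ} {Y Z : Matrix (Fin n) (Fin n) ℂ} (hY : Y.IsHermitian) (hZ : Z.IsHermitian) :
    MvPolynomial.map (starRingEnd ℂ) (detP Y Z) = detP Y Z := by
  unfold detP
  rw [RingHom.map_det]
  conv_rhs => rw [← Matrix.det_transpose]
  congr 1
  ext1 i j
  have h1 : (starRingEnd ℂ) (Y i j) = Y j i := hY.apply j i
  have h2 : (starRingEnd ℂ) (Z i j) = Z j i := hZ.apply j i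
  simp only [RingHom.mapMatrix_apply, Matrix.map_apply, Matrix.of_apply, map_add, map_mul, map_C, map_X, h1, h2,
    Matrix.transpose_apply]
  simp [Matrix.one_apply, apply_ite, eq_comm]

lemma detP_SS {n : ℕ} {Y Z : Matrix (Fin n) (Fin n) ℂ} (hY : Y.PosDef) (hZ : Z.PosDef) :
    SS n (detP Y Z) := by
  refine ⟨detP_hom Y Z, detP_conj hY.1 hZ.1, ?_, ?_⟩
  · intro z hz hz' h0
    rw [detP_eval] at h0
    obtain ⟨v, hv, e⟩ := Matrix.exists_mulVec_eq_zero_iff.mpr h0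
    have e2 := congrArg (fun w => star v ⬝ᵥ w) e
    simp only [Matrix.add_mulVec, Matrix.smul_mulVec, Matrix.one_mulVec, dotProduct_add, dotProduct_smul,
      dotProduct_zero, smul_eq_mul] at e2
    have p0 := (Matrix.PosDef.one (n := Fin n) (R := ℂ)).dotProduct_mulVec_pos hv
    have p1 := hY.dotProduct_mulVec_pos hv
    have p2 := hZ.dotProduct_mulVec_pos hv
    rw [Matrix.one_mulVec] at p0
    rw [Complex.lt_def] at p0 p1 p2
    have := congrArg Complex.im e2
    simp [Complex.mul_im, ← p0.2, ← p1.2, ← p2.2] at this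
    simp at p0 p1 p2
    have a0 := mul_nonneg (hz 0) p0.1.le
    have a1 := mul_nonneg (hz 1) p1.1.le
    have a2 := mul_nonneg (hz 2) p2.1.le
    have b0 : (z 0).im * (star v ⬝ᵥ v).re = 0 := by linarith
    have b1 : (z 1).im * (star v ⬝ᵥ Y *ᵥ v).re = 0 := by linarith
    have b2 : (z 2).im * (star v ⬝ᵥ Z *ᵥ v).re = 0 := by linarith
    obtain ⟨i, hi⟩ := hz'
    fin_cases i
    · exact (mul_ne_zero hi p0.1.ne') b0
    · exact (mul_ne_zero hi p1.1.ne') b1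
    · exact (mul_ne_zero hi p2.1.ne') b2
  · intro e he hne
    rw [detP_eval]
    have : ((e 0 : ℂ) • (1 : Matrix (Fin n) (Fin n) ℂ) + (e 1 : ℂ) • Y + (e 2 : ℂ) • Z).PosDef := by
      have s0 : ((e 0 : ℂ) • (1 : Matrix (Fin n) (Fin n) ℂ)).PosSemidef :=
        Matrix.PosSemidef.one.smul (by exact_mod_cast he 0)
      have s1 : ((e 1 : ℂ) • Y).PosSemidef := hY.posSemidef.smul (by exact_mod_cast he 1)
      have s2 : ((e 2 : ℂ) • Z).PosSemidef := hZ.posSemidef.smul (by exact_mod_cast he 2)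
      obtain ⟨i, hi⟩ := Function.ne_iff.mp hne
      have hip : (0:ℂ) < (e i : ℂ) := by exact_mod_cast lt_of_le_of_ne (he i) (Ne.symm hi)
      fin_cases i
      · exact ((Matrix.PosDef.one.smul hip).add_posSemidef s1).add_posSemidef s2
      · exact (Matrix.PosDef.posSemidef_add s0 (hY.smul hip)).add_posSemidef s2
      · exact Matrix.PosDef.posSemidef_add (s0.add s1) (hZ.smul hip)
    have := this.det_pos
    rw [Complex.lt_def] at this
    exact this.1

end Horn


namespace Horn
open MvPolynomial
open scoped ComplexOrder

lemma edge_coeff {d : ℕ} {q : MvPolynomial (Fin 3) ℂ} (h : q.IsHomogeneous d) {a b c : Fin 3}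
    (hall : ∀ i, i = a ∨ i = b ∨ i = c) (hab : a ≠ b) (hac : a ≠ c) (hbc : b ≠ c)
    (g : Fin 3 → Polynomial ℂ) (ga : g a = 1) (gb : g b = Polynomial.X) (gc : g c = 0) {k : ℕ}
    (hk : k ≤ d) :
    (aeval g q).coeff k = coeff (Finsupp.single a (d-k) + Finsupp.single b k) q := by
  have huniv : (Finset.univ : Finset (Fin 3)) = {a, b, c} := by
    ext i; simpa using hall i
  rw [MvPolynomial.aeval_def, MvPolynomial.eval₂_eq', Polynomial.finsetSum_coeff]
  have key : ∀ m ∈ q.support, ((algebraMap ℂ (Polynomial ℂ)) (coeff m q) * ∏ i, g i ^ m i).coeff k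
      = if m = Finsupp.single a (d-k) + Finsupp.single b k then coeff m q else 0 := by
    intro m hm
    have hd : m a + m b + m c = d := by
      have := h.degree_eq_sum_deg_support hm
      rw [this, Finset.sum_subset (Finset.subset_univ m.support) (f := m) (by intro i _ hi; simpa using hi), huniv,
        Finset.sum_insert (by simp [hab, hac]), Finset.sum_insert (by simp [hbc]), Finset.sum_singleton]
      ring
    rw [huniv, Finset.prod_insert (by simp [hab, hac]), Finset.prod_insert (by simp [hbc]), Finset.prod_singleton,
      ga, gb, gc, one_pow, one_mul, ← Polynomial.C_eq_algebraMap, Polynomial.coeff_C_mul]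
    by_cases hc : m c = 0
    · rw [hc, pow_zero, mul_one, Polynomial.coeff_X_pow]
      by_cases hb : k = m b
      · have : m = Finsupp.single a (d-k) + Finsupp.single b k := by
          ext i
          rcases hall i with rfl | rfl | rfl
          · simp [hab]; omega
          · simp [hab.symm]; omega
          · simp [hac.symm, hbc.symm]; omega
        rw [if_pos hb, if_pos this, mul_one]
      · have : m ≠ Finsupp.single a (d-k) + Finsupp.single b k := by
          intro e; apply hb; rw [e]; simp [hab.symm]
        rw [if_neg hb, if_neg this, mul_zero]
    · have : m ≠ Finsupp.single a (d-k) + Finsupp.single b k := by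
        intro e; apply hc; rw [e]; simp [hac.symm, hbc.symm]
      rw [if_neg this, zero_pow hc]; simp
  rw [Finset.sum_congr rfl key, Finset.sum_ite_eq']
  split_ifs with h1
  · rfl
  · simpa using (notMem_support_iff.mp h1).symm

/-- elementary symmetric sums -/
noncomputable def esum {n : ℕ} (a : Fin n → ℝ) (k : ℕ) : ℝ :=
  ∑ s ∈ Finset.powersetCard k (Finset.univ : Finset (Fin n)), ∏ i ∈ s, a i

lemma prod_coeff {n : ℕ} (a : Fin n → ℝ) (k : ℕ) :
    (∏ i, (1 + Polynomial.C ((a i : ℝ):ℂ) * Polynomial.X)).coeff k = (esum a k : ℂ) := by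
  rw [Finset.prod_one_add, Polynomial.finsetSum_coeff]
  unfold esum
  push_cast

  rw [Finset.powersetCard_eq_filter, Finset.sum_filter]
  refine Finset.sum_congr (by simp) fun s _ => ?_
  rw [Finset.prod_mul_distrib, Finset.prod_const, ← map_prod, Polynomial.coeff_C_mul, Polynomial.coeff_X_pow]
  by_cases h : k = s.card
  · simp [h]
  · simp [h, Ne.symm h]

lemma det_one_add {n : ℕ} {S : Matrix (Fin n) (Fin n) ℂ} (hS : S.IsHermitian) {a : Fin n → ℝ}
    (h : HasSpec S a) (w : ℂ) : (1 + w • S).det = ∏ i, (1 + (a i : ℂ) * w) := by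
  obtain ⟨U, h1, h2, h3⟩ := exists_diag hS
  have e : ∏ i, (1 + (a i : ℂ) * w) = ∏ i, (1 + (hS.eigenvalues i : ℂ) * w) := by
    have := congrArg (fun m => (m.map (fun x : ℝ => 1 + (x:ℂ) * w)).prod) ((hasSpec_eigenvalues hS).multiset_eq h)
    simp only [Multiset.map_map] at this
    exact this.symm
  rw [e]
  have : 1 + w • S = U * Matrix.diagonal (fun i => 1 + (hS.eigenvalues i : ℂ) * w) * Uᴴ := by
    have hd : Matrix.diagonal (fun i => 1 + (hS.eigenvalues i : ℂ) * w)
      = 1 + w • Matrix.diagonal (fun i => (hS.eigenvalues i : ℂ)) := by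
      rw [← Matrix.diagonal_one, ← Matrix.diagonal_smul, Matrix.diagonal_add]
      congr 1; funext i; simp [mul_comm]
    rw [hd, mul_add, add_mul, mul_one, h1, Matrix.mul_smul, Matrix.smul_mul, ← h3]
  rw [this, Matrix.det_mul, Matrix.det_mul, Matrix.det_diagonal, mul_right_comm, ← Matrix.det_mul, h1,
    Matrix.det_one, one_mul]

lemma aeval_eval {q : MvPolynomial (Fin 3) ℂ} (g : Fin 3 → Polynomial ℂ) (w : ℂ) :
    (aeval g q).eval w = eval (fun i => (g i).eval w) q := by
  induction q using MvPolynomial.induction_on with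
  | C a => simp
  | add p q hp hq => simp [hp, hq]
  | mul_X p i hp => simp [hp]

section
variable {n : ℕ} {Y Z : Matrix (Fin n) (Fin n) ℂ}

lemma coeff_edgeY (hY : Y.IsHermitian) {a : Fin n → ℝ} (h : HasSpec Y a) {k : ℕ} (hk : k ≤ n) :
    coeff (mon (n-k) k 0) (detP Y Z) = (esum a k : ℂ) := by
  have := edge_coeff (detP_hom Y Z) (a := 0) (b := 1) (c := 2) (by decide) (by decide) (by decide) (by decide)
    ![1, Polynomial.X, 0] rfl rfl rfl hk
  have e : aeval ![1, Polynomial.X, 0] (detP Y Z) = ∏ i, (1 + Polynomial.C ((a i : ℝ):ℂ) * Polynomial.X) := by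
    apply Polynomial.funext
    intro w
    rw [aeval_eval, detP_eval, Polynomial.eval_prod]
    simp
    rw [det_one_add hY h]
  rw [e, prod_coeff] at this
  rw [this]; congr 1; simp [mon]

lemma coeff_edgeZ (hZ : Z.IsHermitian) {a : Fin n → ℝ} (h : HasSpec Z a) {k : ℕ} (hk : k ≤ n) :
    coeff (mon (n-k) 0 k) (detP Y Z) = (esum a k : ℂ) := by
  have := edge_coeff (detP_hom Y Z) (a := 0) (b := 2) (c := 1) (by decide) (by decide) (by decide) (by decide)
    ![1, 0, Polynomial.X] rfl rfl rfl hk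
  have e : aeval ![1, 0, Polynomial.X] (detP Y Z) = ∏ i, (1 + Polynomial.C ((a i : ℝ):ℂ) * Polynomial.X) := by
    apply Polynomial.funext
    intro w
    rw [aeval_eval, detP_eval, Polynomial.eval_prod]
    simp
    rw [det_one_add hZ h]
  rw [e, prod_coeff] at this
  rw [this]; congr 1; simp [mon]

lemma coeff_edgeYZ {A S : Matrix (Fin n) (Fin n) ℂ} (hS : S.IsHermitian) {a : Fin n → ℝ} (h : HasSpec S a)
    {k : ℕ} (hk : k ≤ n) :
    coeff (mon 0 (n-k) k) (detP (A * Aᴴ) (A * S * Aᴴ)) = (A * Aᴴ).det * (esum a k : ℂ) := by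
  have := edge_coeff (detP_hom (A * Aᴴ) (A * S * Aᴴ)) (a := 1) (b := 2) (c := 0) (by decide) (by decide) (by decide) (by decide)
    ![0, 1, Polynomial.X] rfl rfl rfl hk
  have e : aeval ![0, 1, Polynomial.X] (detP (A * Aᴴ) (A * S * Aᴴ)) =
      Polynomial.C (A * Aᴴ).det * ∏ i, (1 + Polynomial.C ((a i : ℝ):ℂ) * Polynomial.X) := by
    apply Polynomial.funext
    intro w
    rw [aeval_eval, detP_eval, Polynomial.eval_mul, Polynomial.eval_prod]
    have e2 : A * Aᴴ + w • (A * S * Aᴴ) = A * (1 + w • S) * Aᴴ := by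
      rw [mul_add, add_mul, mul_one, Matrix.mul_smul, Matrix.smul_mul]
    simp only [Matrix.cons_val_zero, Matrix.cons_val_one, Matrix.cons_val_two, Matrix.head_cons, Matrix.tail_cons,
      Polynomial.eval_zero, Polynomial.eval_one, Polynomial.eval_X, zero_smul, one_smul, zero_add]
    rw [e2, Matrix.det_mul, Matrix.det_mul, det_one_add hS h, Matrix.det_mul]
    simp
    ring
  rw [e, Polynomial.coeff_C_mul, prod_coeff] at this
  rw [this]; congr 1; simp [mon]

end

/-- partial sums -/
noncomputable def ps {n : ℕ} (a : Fin n → ℝ) (k : ℕ) : ℝ := ∑ i : Fin n, if i.val < k then a i else 0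

lemma sum_le_ps {n : ℕ} {a : Fin n → ℝ} (ha : Antitone a) (s : Finset (Fin n)) :
    ∑ i ∈ s, a i ≤ ps a s.card := by
  have hc : s.card ≤ n := by simpa using Finset.card_le_univ s
  set t : Finset (Fin n) := Finset.univ.filter (fun i => i.val < s.card) with ht
  have htc : t.card = s.card := by
    have := Fin.card_filter_val_lt (n := n) (m := s.card)
    rw [ht, this]; omega
  have e : ps a s.card = ∑ i ∈ t, a i := by rw [ps, ht, Finset.sum_filter]
  rw [e]
  by_cases h0 : (s \ t) = ∅
  · have hsub : s ⊆ t := Finset.sdiff_eq_empty_iff_subset.mp h0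
    rw [Finset.eq_of_subset_of_card_le hsub htc.le]
  have hdc : (t \ s).card = (s \ t).card := by
    have h1 := Finset.card_sdiff_add_card_inter s t
    have h2 := Finset.card_sdiff_add_card_inter t s
    rw [Finset.inter_comm] at h2; omega
  obtain ⟨i0, hi0⟩ := Finset.nonempty_iff_ne_empty.mpr h0
  have hlt : s.card < n := by
    have h5 : ¬ (i0.val < s.card) := by
      have := (Finset.mem_sdiff.mp hi0).2
      simpa [ht] using this
    omega
  set p : Fin n := ⟨s.card, hlt⟩
  have h1 : ∑ i ∈ s \ t, a i ≤ (s \ t).card • a p := by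
    apply Finset.sum_le_card_nsmul
    intro i hi
    apply ha
    have := (Finset.mem_sdiff.mp hi).2
    simp [ht] at this
    exact this
  have h2 : (t \ s).card • a p ≤ ∑ i ∈ t \ s, a i := by
    apply Finset.card_nsmul_le_sum
    intro i hi
    apply ha
    have := (Finset.mem_sdiff.mp hi).1
    simp [ht] at this
    exact this.le
  rw [hdc] at h2
  have e1 := Finset.sum_inter_add_sum_sdiff s t a
  have e2 := Finset.sum_inter_add_sum_sdiff t s a
  rw [Finset.inter_comm] at e2
  linarith

lemma esum_bounds {n : ℕ} {a : Fin n → ℝ} (ha : Antitone a) {k : ℕ} (hk : k ≤ n) :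
    Real.exp (2 * ps a k) ≤ esum (fun i => Real.exp (2 * a i)) k ∧
    esum (fun i => Real.exp (2 * a i)) k ≤ 2 ^ n * Real.exp (2 * ps a k) := by
  have hp : ∀ s : Finset (Fin n), ∏ i ∈ s, Real.exp (2 * a i) = Real.exp (2 * ∑ i ∈ s, a i) := by
    intro s; rw [Finset.mul_sum, Real.exp_sum]
  constructor
  · set t : Finset (Fin n) := Finset.univ.filter (fun i => i.val < k) with ht
    have htc : t.card = k := by
      have := Fin.card_filter_val_lt (n := n) (m := k)
      rw [ht, this]; omega
    have e : ps a k = ∑ i ∈ t, a i := by rw [ps, ht, Finset.sum_filter]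
    rw [e, ← hp]
    unfold esum
    apply Finset.single_le_sum (f := fun s : Finset (Fin n) => ∏ i ∈ s, Real.exp (2 * a i))
    · intro s _; positivity
    · simp [Finset.mem_powersetCard, htc]
  · unfold esum
    calc _ ≤ ∑ s ∈ Finset.powersetCard k (Finset.univ : Finset (Fin n)), Real.exp (2 * ps a k) := by
          apply Finset.sum_le_sum
          intro s hs
          rw [hp]
          have := sum_le_ps ha s
          rw [(Finset.mem_powersetCard.mp hs).2] at this
          gcongr
      _ = (n.choose k) * Real.exp (2 * ps a k) := by
          rw [Finset.sum_const, Finset.card_powersetCard]; simp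
      _ ≤ _ := by
          gcongr
          exact_mod_cast Nat.choose_le_two_pow n k

end Horn


namespace Horn
open MvPolynomial
open scoped ComplexOrder

/-- The hive-type system of inequalities, with slack `K`. -/
structure Sys (n : ℕ) (K : ℝ) (x : (Fin n → ℝ) × (Fin n → ℝ) × (Fin n → ℝ)) (h : ℕ → ℕ → ℝ) : Prop where
  rz : ∀ j k, j + k + 2 ≤ n → -K ≤ h j (k+1) + h (j+1) (k+1) - h (j+1) k - h j (k+2)
  ry : ∀ j k, j + k + 2 ≤ n → -K ≤ h (j+1) k + h (j+1) (k+1) - h j (k+1) - h (j+2) k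
  rx : ∀ j k, j + k + 2 ≤ n → -K ≤ h (j+1) k + h j (k+1) - h j k - h (j+1) (k+1)
  a1 : ∀ k ≤ n, -K ≤ h k 0 - ps x.1 k
  a2 : ∀ k ≤ n, -K ≤ ps x.1 k - h k 0
  t1 : ∀ k ≤ n, -K ≤ h 0 k - ps x.2.2 k
  t2 : ∀ k ≤ n, -K ≤ ps x.2.2 k - h 0 k
  c1 : ∀ k ≤ n, -K ≤ h (n-k) k - (ps x.1 n + ps x.2.1 k)
  c2 : ∀ k ≤ n, -K ≤ (ps x.1 n + ps x.2.1 k) - h (n-k) k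
  ma : ∀ i, i + 2 ≤ n → -K ≤ 2 * ps x.1 (i+1) - ps x.1 i - ps x.1 (i+2)
  mc : ∀ i, i + 2 ≤ n → -K ≤ 2 * ps x.2.1 (i+1) - ps x.2.1 i - ps x.2.1 (i+2)
  mt : ∀ i, i + 2 ≤ n → -K ≤ 2 * ps x.2.2 (i+1) - ps x.2.2 i - ps x.2.2 (i+2)

/-- `ps` as a linear map -/
noncomputable def psL (n k : ℕ) : (Fin n → ℝ) →ₗ[ℝ] ℝ where
  toFun a := ps a k
  map_add' a b := by
    unfold ps; rw [← Finset.sum_add_distrib]; refine Finset.sum_congr rfl fun i _ => ?_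
    split_ifs <;> simp
  map_smul' r a := by
    unfold ps; simp [Finset.mul_sum]

lemma ps_succ {n : ℕ} (a : Fin n → ℝ) (i : Fin n) : ps a (i.val+1) = ps a i.val + a i := by
  unfold ps
  have : a i = ∑ j : Fin n, if j = i then a i else 0 := by simp
  rw [this, ← Finset.sum_add_distrib]
  refine Finset.sum_congr rfl fun j _ => ?_
  by_cases h1 : j = i
  · subst h1; simp
  · have : j.val ≠ i.val := fun h => h1 (Fin.ext h)
    by_cases h2 : j.val < i.val
    · have : j.val < i.val + 1 := by omega
      simp [h1, h2, this]
    · have : ¬ j.val < i.val + 1 := by omega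
      simp [h1, h2, this]

lemma ps_zero {n : ℕ} (a : Fin n → ℝ) : ps a 0 = 0 := by simp [ps]

lemma antitone_of_ps {n : ℕ} {a : Fin n → ℝ} (h : ∀ i, i + 2 ≤ n → 0 ≤ 2 * ps a (i+1) - ps a i - ps a (i+2)) :
    Antitone a := by
  cases n with
  | zero => intro i; exact i.elim0
  | succ n =>
    rw [Fin.antitone_iff_succ_le]
    intro i
    have h1 := h i.val (by omega)
    have h2 := ps_succ a i.castSucc
    have h3 := ps_succ a i.succ
    simp at h2 h3
    rw [show i.val + 1 + 1 = i.val + 2 by ring] at h3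
    linarith

lemma ps_of_antitone {n : ℕ} {a : Fin n → ℝ} (ha : Antitone a) (i : ℕ) (hi : i + 2 ≤ n) :
    0 ≤ 2 * ps a (i+1) - ps a i - ps a (i+2) := by
  have h2 := ps_succ a ⟨i, by omega⟩
  have h3 := ps_succ a ⟨i+1, by omega⟩
  have : a ⟨i+1, by omega⟩ ≤ a ⟨i, by omega⟩ := ha (by simp)
  simp only at h2 h3
  rw [show i + 1 + 1 = i + 2 by ring] at h3
  linarith

lemma sys_poly (n : ℕ) : ∃ (m : ℕ) (f : Fin m → ((Fin n → ℝ) × (Fin n → ℝ) × (Fin n → ℝ)) →ₗ[ℝ] ℝ),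
    (∀ x, (∀ j, 0 ≤ f j x) → ∃ h, Sys n 0 x h) ∧
    (∀ K : ℝ, ∃ K' : ℝ, ∀ x, (∃ h, 0 ≤ K ∧ Sys n K x h) → ∀ j, -K' ≤ f j x) := by
  let E := (Fin n → ℝ) × (Fin n → ℝ) × (Fin n → ℝ)
  let F := Fin (n+1) × Fin (n+1) → ℝ
  let H : ℕ → ℕ → (E × F) →ₗ[ℝ] ℝ := fun j k =>
    LinearMap.proj (Fin.ofNat (n+1) j, Fin.ofNat (n+1) k) ∘ₗ LinearMap.snd ℝ E F
  let A : ℕ → (E × F) →ₗ[ℝ] ℝ := fun k => psL n k ∘ₗ LinearMap.fst ℝ _ _ ∘ₗ LinearMap.fst ℝ E F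
  let B : ℕ → (E × F) →ₗ[ℝ] ℝ := fun k => psL n k ∘ₗ LinearMap.fst ℝ _ _ ∘ₗ LinearMap.snd ℝ _ _ ∘ₗ LinearMap.fst ℝ E F
  let T : ℕ → (E × F) →ₗ[ℝ] ℝ := fun k => psL n k ∘ₗ LinearMap.snd ℝ _ _ ∘ₗ LinearMap.snd ℝ _ _ ∘ₗ LinearMap.fst ℝ E F
  have eA : ∀ k x h, A k (x, h) = ps x.1 k := fun k x h => rfl
  have eB : ∀ k x h, B k (x, h) = ps x.2.1 k := fun k x h => rfl
  have eT : ∀ k x h, T k (x, h) = ps x.2.2 k := fun k x h => rfl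
  have eH : ∀ j k x h, H j k (x, h) = h (Fin.ofNat (n+1) j, Fin.ofNat (n+1) k) := fun j k x h => rfl
  let g : Fin 12 × Fin (n+1) × Fin (n+1) → (E × F) →ₗ[ℝ] ℝ := fun c =>
    let j : ℕ := c.2.1
    let k : ℕ := c.2.2
    match c.1 with
    | 0 => if j + k + 2 ≤ n then H j (k+1) + H (j+1) (k+1) - H (j+1) k - H j (k+2) else 0
    | 1 => if j + k + 2 ≤ n then H (j+1) k + H (j+1) (k+1) - H j (k+1) - H (j+2) k else 0
    | 2 => if j + k + 2 ≤ n then H (j+1) k + H j (k+1) - H j k - H (j+1) (k+1) else 0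
    | 3 => H k 0 - A k
    | 4 => A k - H k 0
    | 5 => H 0 k - T k
    | 6 => T k - H 0 k
    | 7 => H (n-k) k - (A n + B k)
    | 8 => (A n + B k) - H (n-k) k
    | 9 => if k + 2 ≤ n then (2:ℝ) • A (k+1) - A k - A (k+2) else 0
    | 10 => if k + 2 ≤ n then (2:ℝ) • B (k+1) - B k - B (k+2) else 0
    | 11 => if k + 2 ≤ n then (2:ℝ) • T (k+1) - T k - T (k+2) else 0
  obtain ⟨m, f, h1, h2⟩ := projection_polyhedral (E := E) (F := F) _ g
  refine ⟨m, f, ?_, ?_⟩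
  · intro x hx
    obtain ⟨h, hh⟩ := h1 x hx
    refine ⟨fun j k => h (Fin.ofNat (n+1) j, Fin.ofNat (n+1) k), ?_, ?_, ?_, ?_, ?_, ?_, ?_, ?_, ?_, ?_, ?_, ?_⟩
    · intro j k hjk
      have := hh (0, ⟨j, by omega⟩, ⟨k, by omega⟩)
      simp only [g, hjk, if_true, LinearMap.sub_apply, LinearMap.add_apply, eH] at this
      simpa using this
    · intro j k hjk
      have := hh (1, ⟨j, by omega⟩, ⟨k, by omega⟩)
      simp only [g, hjk, if_true, LinearMap.sub_apply, LinearMap.add_apply, eH] at this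
      simpa using this
    · intro j k hjk
      have := hh (2, ⟨j, by omega⟩, ⟨k, by omega⟩)
      simp only [g, hjk, if_true, LinearMap.sub_apply, LinearMap.add_apply, eH] at this
      simpa using this
    · intro k hk
      have := hh (3, 0, ⟨k, by omega⟩)
      simp only [g, LinearMap.sub_apply, eH, eA] at this
      simpa using this
    · intro k hk
      have := hh (4, 0, ⟨k, by omega⟩)
      simp only [g, LinearMap.sub_apply, eH, eA] at this
      simpa using this
    · intro k hk
      have := hh (5, 0, ⟨k, by omega⟩)
      simp only [g, LinearMap.sub_apply, eH, eT] at this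
      simpa using this
    · intro k hk
      have := hh (6, 0, ⟨k, by omega⟩)
      simp only [g, LinearMap.sub_apply, eH, eT] at this
      simpa using this
    · intro k hk
      have := hh (7, 0, ⟨k, by omega⟩)
      simp only [g, LinearMap.sub_apply, LinearMap.add_apply, eH, eA, eB] at this
      simpa using this
    · intro k hk
      have := hh (8, 0, ⟨k, by omega⟩)
      simp only [g, LinearMap.sub_apply, LinearMap.add_apply, eH, eA, eB] at this
      simpa using this
    · intro k hk
      have := hh (9, 0, ⟨k, by omega⟩)
      simp only [g, hk, if_true, LinearMap.sub_apply, LinearMap.smul_apply, eA, smul_eq_mul] at this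
      simpa using this
    · intro k hk
      have := hh (10, 0, ⟨k, by omega⟩)
      simp only [g, hk, if_true, LinearMap.sub_apply, LinearMap.smul_apply, eB, smul_eq_mul] at this
      simpa using this
    · intro k hk
      have := hh (11, 0, ⟨k, by omega⟩)
      simp only [g, hk, if_true, LinearMap.sub_apply, LinearMap.smul_apply, eT, smul_eq_mul] at this
      simpa using this
  · intro K
    obtain ⟨K', hK'⟩ := h2 K
    refine ⟨K', fun x hx => hK' x ?_⟩
    obtain ⟨h, hK, hs⟩ := hx
    have ev : ∀ j k, j ≤ n → k ≤ n → ∀ x, H j k (x, fun p => h p.1.val p.2.val) = h j k := by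
      intro j k hj hk x
      rw [eH]
      simp [Nat.mod_eq_of_lt (Nat.lt_succ_of_le hj), Nat.mod_eq_of_lt (Nat.lt_succ_of_le hk)]
    refine ⟨fun p => h p.1.val p.2.val, ?_⟩
    rintro ⟨c, ⟨j, hj⟩, ⟨k, hk⟩⟩
    have hz : -K ≤ (0 : (E × F) →ₗ[ℝ] ℝ) (x, fun p => h p.1.val p.2.val) := by simpa using hK
    fin_cases c <;> simp only [g]
    · by_cases hjk : j + k + 2 ≤ n
      · simp only [hjk, if_true, LinearMap.sub_apply, LinearMap.add_apply]
        rw [ev, ev, ev, ev] <;> try omega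
        exact hs.rz j k hjk
      · simpa only [hjk, if_false] using hz
    · by_cases hjk : j + k + 2 ≤ n
      · simp only [hjk, if_true, LinearMap.sub_apply, LinearMap.add_apply]
        rw [ev, ev, ev, ev] <;> try omega
        exact hs.ry j k hjk
      · simpa only [hjk, if_false] using hz
    · by_cases hjk : j + k + 2 ≤ n
      · simp only [hjk, if_true, LinearMap.sub_apply, LinearMap.add_apply]
        rw [ev, ev, ev, ev] <;> try omega
        exact hs.rx j k hjk
      · simpa only [hjk, if_false] using hz
    · simp only [LinearMap.sub_apply, eA]
      rw [ev] <;> try omega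
      exact hs.a1 k (by omega)
    · simp only [LinearMap.sub_apply, eA]
      rw [ev] <;> try omega
      exact hs.a2 k (by omega)
    · simp only [LinearMap.sub_apply, eT]
      rw [ev] <;> try omega
      exact hs.t1 k (by omega)
    · simp only [LinearMap.sub_apply, eT]
      rw [ev] <;> try omega
      exact hs.t2 k (by omega)
    · simp only [LinearMap.sub_apply, LinearMap.add_apply, eA, eB]
      rw [ev] <;> try omega
      exact hs.c1 k (by omega)
    · simp only [LinearMap.sub_apply, LinearMap.add_apply, eA, eB]
      rw [ev] <;> try omega
      exact hs.c2 k (by omega)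
    · by_cases hjk : k + 2 ≤ n
      · simp only [hjk, if_true, LinearMap.sub_apply, LinearMap.smul_apply, eA, smul_eq_mul]
        exact hs.ma k hjk
      · simpa only [hjk, if_false] using hz
    · by_cases hjk : k + 2 ≤ n
      · simp only [hjk, if_true, LinearMap.sub_apply, LinearMap.smul_apply, eB, smul_eq_mul]
        exact hs.mc k hjk
      · simpa only [hjk, if_false] using hz
    · by_cases hjk : k + 2 ≤ n
      · simp only [hjk, if_true, LinearMap.sub_apply, LinearMap.smul_apply, eT, smul_eq_mul]
        exact hs.mt k hjk
      · simpa only [hjk, if_false] using hz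

end Horn

set_option linter.unusedSimpArgs false
namespace Horn
open MvPolynomial
open scoped ComplexOrder

lemma half_log_ineq {x y u v : ℝ} (hx : 0 < x) (hy : 0 < y) (hu : 0 < u) (hv : 0 < v) (h : x * y ≤ 2 * (u * v)) :
    -(1/2 * Real.log 2) ≤ 1/2 * Real.log u + 1/2 * Real.log v - 1/2 * Real.log x - 1/2 * Real.log y := by
  have := Real.log_le_log (by positivity) h
  rw [Real.log_mul hx.ne' hy.ne', Real.log_mul (by norm_num) (by positivity), Real.log_mul hu.ne' hv.ne'] at this
  linarith

lemma ps_full {n : ℕ} (a : Fin n → ℝ) : ps a n = ∑ i, a i := by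
  unfold ps; refine Finset.sum_congr rfl fun i _ => by simp

lemma edge_log {n m M : ℕ} {E P R : ℝ} (hm : 1 ≤ m) (hM : m ≤ M) (h1 : Real.exp (2 * P) ≤ E)
    (h2 : E ≤ 2 ^ n * Real.exp (2 * P)) :
    0 ≤ 1/2 * Real.log ((m:ℝ) * (Real.exp (2 * R) * E)) - (R + P) ∧
    1/2 * Real.log ((m:ℝ) * (Real.exp (2 * R) * E)) - (R + P) ≤ Real.log M + n * Real.log 2 := by
  have hE : 0 < E := lt_of_lt_of_le (Real.exp_pos _) h1
  have hm0 : (0:ℝ) < m := by exact_mod_cast hm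
  have hM0 : (m:ℝ) ≤ M := by exact_mod_cast hM
  rw [Real.log_mul hm0.ne' (by positivity), Real.log_mul (by positivity) hE.ne', Real.log_exp]
  have l1 := Real.log_le_log (Real.exp_pos _) h1
  have l2 := Real.log_le_log hE h2
  rw [Real.log_exp] at l1
  rw [Real.log_mul (by positivity) (by positivity), Real.log_exp, Real.log_pow] at l2
  have l3 := Real.log_le_log hm0 hM0
  have l4 : 0 ≤ Real.log m := Real.log_nonneg (by exact_mod_cast hm)
  have l5 : 0 ≤ n * Real.log 2 := mul_nonneg (by positivity) (Real.log_nonneg (by norm_num))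
  constructor <;> linarith

lemma fact_bound {n a b c : ℕ} (ha : a ≤ n) (hb : b ≤ n) (hc : c ≤ n) :
    1 ≤ a.factorial * b.factorial * c.factorial ∧
    a.factorial * b.factorial * c.factorial ≤ n.factorial * n.factorial * n.factorial := by
  refine ⟨Nat.succ_le_of_lt (by positivity), ?_⟩
  gcongr

lemma necessity (n : ℕ) : ∃ K : ℝ, 0 ≤ K ∧ ∀ x ∈ Cone n, ∃ h, Sys n K x h := by
  set M : ℕ := n.factorial * n.factorial * n.factorial with hM
  have l0 : 0 ≤ Real.log 2 := Real.log_nonneg (by norm_num)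
  have l1 : 0 ≤ Real.log M := Real.log_nonneg (by
    have : 1 ≤ M := Nat.succ_le_of_lt (by positivity)
    exact_mod_cast this)
  have l2 : 0 ≤ n * Real.log 2 := mul_nonneg (by positivity) l0
  refine ⟨Real.log 2 + (Real.log M + n * Real.log 2), by linarith, ?_⟩
  rintro x ⟨m1, m2, m3, A, C, o1, o2, o3⟩
  have dA := det_ne_zero_of_hasSpec o1
  have dC := det_ne_zero_of_hasSpec o2
  have pY := posDef_mul_conj dA
  have pS := posDef_mul_conj dC
  have pZ := posDef_conj_same pS dA
  have eZ : A * C * (A * C)ᴴ = A * (C * Cᴴ) * Aᴴ := by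
    rw [Matrix.conjTranspose_mul]; simp only [Matrix.mul_assoc]
  rw [eZ] at o3
  set p := detP (A * Aᴴ) (A * (C * Cᴴ) * Aᴴ) with hp
  have hSS : SS n p := detP_SS pY pZ
  have W0 : ∀ a b c, a + b + c = n → 0 < (W p a b c).re := fun a b c h => (hSS.W_pos h).1
  have rh : ∀ j k, j + k + 2 ≤ n → ∃ a, n - j - k = 2 + a ∧ n - (j+1) - k = 1 + a ∧ n - j - (k+1) = 1 + a ∧
      n - (j+1) - (k+1) = a ∧ n - (j+2) - k = a ∧ n - j - (k+2) = a ∧ 2 + (a + j + k) = n := by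
    intro j k h; exact ⟨n - j - k - 2, by omega⟩
  have detA : (A * Aᴴ).det = ((Real.exp (2 * ps x.1 n) : ℝ) : ℂ) := by
    rw [o1.det, ps_full, Finset.mul_sum, Real.exp_sum]
  have eW : ∀ a b c : ℕ, ∀ r : ℝ, coeff (mon a b c) p = (r : ℂ) →
      (W p a b c).re = ((a.factorial * b.factorial * c.factorial : ℕ) : ℝ) * r := by
    intro a b c r h
    unfold W
    rw [h, ← Complex.ofReal_natCast, ← Complex.ofReal_mul, Complex.ofReal_re]
  have edgeA : ∀ k ≤ n, 0 ≤ 1/2 * Real.log (W p (n-k-0) k 0).re - ps x.1 k ∧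
      1/2 * Real.log (W p (n-k-0) k 0).re - ps x.1 k ≤ Real.log M + n * Real.log 2 := by
    intro k hk
    rw [Nat.sub_zero, eW _ _ _ _ (coeff_edgeY pY.1 o1 hk)]
    have b := esum_bounds m1 hk
    have f := fact_bound (n := n) (a := n - k) (b := k) (c := 0) (by omega) hk (by omega)
    have := edge_log (R := 0) f.1 f.2 b.1 b.2
    rw [← hM] at this
    simpa using this
  have edgeT : ∀ k ≤ n, 0 ≤ 1/2 * Real.log (W p (n-0-k) 0 k).re - ps x.2.2 k ∧
      1/2 * Real.log (W p (n-0-k) 0 k).re - ps x.2.2 k ≤ Real.log M + n * Real.log 2 := by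
    intro k hk
    rw [Nat.sub_zero, eW _ _ _ _ (coeff_edgeZ pZ.1 o3 hk)]
    have b := esum_bounds m3 hk
    have f := fact_bound (n := n) (a := n - k) (b := 0) (c := k) (by omega) (by omega) hk
    have := edge_log (R := 0) f.1 f.2 b.1 b.2
    rw [← hM] at this
    simpa using this
  have edgeC : ∀ k ≤ n, 0 ≤ 1/2 * Real.log (W p (n-(n-k)-k) (n-k) k).re - (ps x.1 n + ps x.2.1 k) ∧
      1/2 * Real.log (W p (n-(n-k)-k) (n-k) k).re - (ps x.1 n + ps x.2.1 k) ≤ Real.log M + n * Real.log 2 := by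
    intro k hk
    have e := coeff_edgeYZ (A := A) pS.1 o2 hk
    rw [detA, ← Complex.ofReal_mul] at e
    rw [show n - (n-k) - k = 0 by omega, eW _ _ _ _ e]
    have b := esum_bounds m2 hk
    have f := fact_bound (n := n) (a := 0) (b := n-k) (c := k) (by omega) (by omega) hk
    exact edge_log (R := ps x.1 n) f.1 f.2 b.1 b.2
  refine ⟨fun j k => 1/2 * Real.log (W p (n-j-k) j k).re, ?_, ?_, ?_, ?_, ?_, ?_, ?_, ?_, ?_, ?_, ?_, ?_⟩
  · intro j k hjk
    obtain ⟨a, e1, e2, e3, e4, e5, e6, e7⟩ := rh j k hjk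
    have := (SS.rhombi (a := a) (b := j) (c := k) (q := p) (by rw [e7]; exact hSS)).1
    have := half_log_ineq (W0 _ _ _ (by omega)) (W0 _ _ _ (by omega)) (W0 _ _ _ (by omega)) (W0 _ _ _ (by omega)) this
    simp only [add_comm 1 j, add_comm 1 k, add_comm 2 j, add_comm 2 k] at this
    simp only [e1, e2, e3, e4, e5, e6]
    linarith
  · intro j k hjk
    obtain ⟨a, e1, e2, e3, e4, e5, e6, e7⟩ := rh j k hjk
    have := (SS.rhombi (a := a) (b := j) (c := k) (q := p) (by rw [e7]; exact hSS)).2.1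
    have := half_log_ineq (W0 _ _ _ (by omega)) (W0 _ _ _ (by omega)) (W0 _ _ _ (by omega)) (W0 _ _ _ (by omega)) this
    simp only [add_comm 1 j, add_comm 1 k, add_comm 2 j, add_comm 2 k] at this
    simp only [e1, e2, e3, e4, e5, e6]
    linarith
  · intro j k hjk
    obtain ⟨a, e1, e2, e3, e4, e5, e6, e7⟩ := rh j k hjk
    have := (SS.rhombi (a := a) (b := j) (c := k) (q := p) (by rw [e7]; exact hSS)).2.2
    have := half_log_ineq (W0 _ _ _ (by omega)) (W0 _ _ _ (by omega)) (W0 _ _ _ (by omega)) (W0 _ _ _ (by omega)) this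
    simp only [add_comm 1 j, add_comm 1 k, add_comm 2 j, add_comm 2 k] at this
    simp only [e1, e2, e3, e4, e5, e6]
    linarith
  · intro k hk; have := edgeA k hk; linarith
  · intro k hk; have := edgeA k hk; linarith
  · intro k hk; have := edgeT k hk; linarith
  · intro k hk; have := edgeT k hk; linarith
  · intro k hk; have := edgeC k hk; linarith
  · intro k hk; have := edgeC k hk; linarith
  · intro i hi; have := ps_of_antitone m1 i hi; linarith
  · intro i hi; have := ps_of_antitone m2 i hi; linarith
  · intro i hi; have := ps_of_antitone m3 i hi; linarith

end Horn


namespace Horn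

section ops
variable {n : ℕ}

/-- extension by zero -/
noncomputable def ex (v : Fin n → ℂ) (q : ℕ) : ℂ := if h : q < n then v ⟨q, h⟩ else 0

lemma ex_add (v w : Fin n → ℂ) (q : ℕ) : ex (v + w) q = ex v q + ex w q := by
  unfold ex; split_ifs <;> simp
lemma ex_smul (r : ℂ) (v : Fin n → ℂ) (q : ℕ) : ex (r • v) q = r * ex v q := by
  unfold ex; split_ifs <;> simp
lemma ex_lt (v : Fin n → ℂ) {q : ℕ} (h : q < n) : ex v q = v ⟨q, h⟩ := by simp [ex, h]
lemma ex_val (v : Fin n → ℂ) (q : Fin n) : ex v q.val = v q := by simp [ex]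
lemma ex_ge (v : Fin n → ℂ) {q : ℕ} (h : n ≤ q) : ex v q = 0 := by simp [ex, Nat.not_lt.mpr h]
lemma ex_norm (v : Fin n → ℂ) (q : ℕ) : ‖ex v q‖ ≤ ‖v‖ := by
  unfold ex; split_ifs with h
  · exact norm_le_pi_norm v _
  · simp

/-- boundedly invertible operator -/
def Bd (c : ℝ) (L : (Fin n → ℂ) →ₗ[ℂ] (Fin n → ℂ)) : Prop :=
  ∀ v, ‖L v‖ ≤ c * ‖v‖ ∧ ‖v‖ ≤ c * ‖L v‖

lemma Bd.id : Bd 1 (LinearMap.id : (Fin n → ℂ) →ₗ[ℂ] (Fin n → ℂ)) := by intro v; simp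

lemma Bd.comp {c d : ℝ} (hc : 0 ≤ c) (hd : 0 ≤ d) {L M : (Fin n → ℂ) →ₗ[ℂ] (Fin n → ℂ)} (hL : Bd c L) (hM : Bd d M) :
    Bd (c * d) (L ∘ₗ M) := by
  intro v
  have h1 := hL (M v)
  have h2 := hM v
  simp only [LinearMap.comp_apply]
  constructor
  · calc _ ≤ c * ‖M v‖ := h1.1
      _ ≤ c * (d * ‖v‖) := by gcongr; exact h2.1
      _ = _ := by ring
  · calc _ ≤ d * ‖M v‖ := h2.2
      _ ≤ d * (c * ‖L (M v)‖) := by gcongr; exact h1.2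
      _ = _ := by ring

lemma Bd.mono {c d : ℝ} (h : c ≤ d) {L : (Fin n → ℂ) →ₗ[ℂ] (Fin n → ℂ)} (hL : Bd c L) : Bd d L := by
  intro v
  exact ⟨(hL v).1.trans (by gcongr), (hL v).2.trans (by gcongr)⟩

variable (F : ℕ → ℕ → ℝ)

def sF (i p : ℕ) : ℝ := F (i+1) p - F i p
def kF (i q : ℕ) : ℝ := sF F i (q+1) - sF F i q
/-- e^{-x} as a complex number -/
noncomputable def em (x : ℝ) : ℂ := ((Real.exp (-x) : ℝ) : ℂ)

lemma em_add (x y : ℝ) : em (x + y) = em x * em y := by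
  unfold em; rw [← Complex.ofReal_mul, ← Real.exp_add]; congr 2; ring
lemma em_norm (x : ℝ) : ‖em x‖ = Real.exp (-x) := by
  unfold em; rw [Complex.norm_real, Real.norm_eq_abs, abs_of_pos (Real.exp_pos _)]
lemma em_ne (x : ℝ) : em x ≠ 0 := by
  unfold em; exact_mod_cast (Real.exp_pos _).ne'
lemma em_norm_le {x : ℝ} (h : 0 ≤ x) : ‖em x‖ ≤ 1 := by
  rw [em_norm, Real.exp_le_one_iff]; linarith
lemma em_zero : em 0 = 1 := by simp [em]

/-- diagonal operator -/
noncomputable def dg (d : ℕ → ℂ) : (Fin n → ℂ) →ₗ[ℂ] (Fin n → ℂ) where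
  toFun v := fun q => d q.val * v q
  map_add' v w := by ext q; simp [mul_add]
  map_smul' r v := by ext q; simp; ring

noncomputable def Nop (i : ℕ) : (Fin n → ℂ) →ₗ[ℂ] (Fin n → ℂ) where
  toFun v := fun q => if q.val < i then v q else em (kF F i q.val) * v q + ex v (q.val+1)
  map_add' v w := by ext q; simp only [ex_add, Pi.add_apply]; split_ifs <;> ring
  map_smul' r v := by
    ext q; simp only [ex_smul, Pi.smul_apply, smul_eq_mul, RingHom.id_apply]; split_ifs <;> ring

lemma Nop_apply (i : ℕ) (v : Fin n → ℂ) (q : Fin n) :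
    Nop F i v q = if q.val < i then v q else em (kF F i q.val) * v q + ex v (q.val+1) := rfl

/-- downward induction over coordinates -/
lemma down_ind {P : ℕ → Prop} (h0 : P n) (hs : ∀ q, q < n → P (q+1) → P q) : ∀ q, q ≤ n → P q := by
  intro q hq
  induction hq using Nat.decreasingInduction with
  | self => exact h0
  | of_succ k hk ih => exact hs k hk ih

lemma Nop_injective (i : ℕ) : Function.Injective (Nop F i : (Fin n → ℂ) →ₗ[ℂ] (Fin n → ℂ)) := by
  rw [← LinearMap.ker_eq_bot, LinearMap.ker_eq_bot']
  intro v hv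
  have : ∀ q, q ≤ n → ex v q = 0 := by
    apply down_ind
    · exact ex_ge v le_rfl
    · intro q hq ih
      have := congrFun hv ⟨q, hq⟩
      rw [Nop_apply] at this
      simp only [Pi.zero_apply] at this
      rw [ex_lt v hq]
      split_ifs at this with h
      · exact this
      · rw [ih, add_zero] at this
        exact (mul_eq_zero.mp this).resolve_left (em_ne _)
  ext q
  have h := this q.val q.2.le
  rwa [ex_val] at h

/-- suffix products -/
noncomputable def Tsuf (n : ℕ) (F : ℕ → ℕ → ℝ) : ℕ → (Fin n → ℂ) →ₗ[ℂ] (Fin n → ℂ)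
  | 0 => LinearMap.id
  | (m+1) => Nop F (n - (m+1)) ∘ₗ Tsuf n F m

noncomputable def Top (n : ℕ) (F : ℕ → ℕ → ℝ) (j : ℕ) : (Fin n → ℂ) →ₗ[ℂ] (Fin n → ℂ) := Tsuf n F (n - j)

lemma Top_self : Top n F n = LinearMap.id := by simp [Top, Tsuf]

lemma Top_step {j : ℕ} (hj : j < n) : Top n F j = Nop F j ∘ₗ Top n F (j+1) := by
  unfold Top
  have : n - j = (n - (j+1)) + 1 := by omega
  rw [this]
  change Nop F (n - ((n - (j+1)) + 1)) ∘ₗ _ = _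
  congr 2
  omega

lemma Top_coord : ∀ j, j ≤ n → ∀ (v : Fin n → ℂ) (q : Fin n), q.val < j → Top n F j v q = v q := by
  apply down_ind
  · intro v q _; rw [Top_self]; rfl
  · intro j hj ih v q hq
    rw [Top_step F hj, LinearMap.comp_apply, Nop_apply, if_pos hq]
    exact ih v q (by omega)

lemma Nop_single (i : ℕ) (q : Fin n) (hq : q.val < i) (r : ℂ) : Nop F i (Pi.single q r) = Pi.single q r := by
  ext p
  rw [Nop_apply]
  split_ifs with h
  · rfl
  · have h1 : p ≠ q := by rintro rfl; exact h hq
    have h2 : ex (Pi.single q r : Fin n → ℂ) (p.val+1) = 0 := by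
      unfold ex; split_ifs with h3
      · rw [Pi.single_apply, if_neg]; intro e; have := congrArg Fin.val e; simp at this; omega
      · rfl
    rw [h2, Pi.single_apply, if_neg h1]; simp

lemma Top_single : ∀ j, j ≤ n → ∀ (q : Fin n) (r : ℂ), q.val < j → Top n F j (Pi.single q r) = Pi.single q r := by
  apply down_ind
  · intro q r _; rw [Top_self]; rfl
  · intro j hj ih q r hq
    rw [Top_step F hj, LinearMap.comp_apply, ih q r (by omega), Nop_single F j q hq]

/-- the key solvability estimate -/
lemma solve (hz : ∀ i p, p + 1 ≤ n → sF F (i+1) (p+1) ≤ sF F i p) (h0 : ∀ i p, p ≤ i → sF F i p = 0) :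
    ∀ j, j ≤ n → ∀ (c : ℝ) (v : Fin n → ℂ), 0 ≤ c → (∀ q : Fin n, q.val < j → v q = 0) →
      (∀ q : Fin n, ‖v q‖ ≤ c * Real.exp (-sF F j (q.val+1))) →
      ∃ w, Top n F j w = v ∧ (∀ q : Fin n, q.val < j → w q = 0) ∧ ‖w‖ ≤ c * (n+1)^(n-j) := by
  apply down_ind
  · intro c v hc h1 h2
    refine ⟨v, by rw [Top_self]; rfl, h1, ?_⟩
    have : v = 0 := by ext q; exact h1 q q.2
    rw [this]; simp [hc]
  · intro j hj ih c v hc h1 h2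
    obtain ⟨y, hy⟩ := (LinearMap.injective_iff_surjective.mp (Nop_injective (n := n) F j)) v
    have hy0 : ∀ q : Fin n, q.val < j → y q = 0 := by
      intro q hq
      have := congrFun hy q
      rw [Nop_apply, if_pos hq] at this
      rw [this, h1 q hq]
    have hyb : ∀ q, q ≤ n → ‖ex y q‖ ≤ c * (n - q) * Real.exp (-sF F j q) := by
      apply down_ind
      · rw [ex_ge y le_rfl]; simp
      · intro q hq ihq
        have hqn : (q:ℝ) + 1 ≤ n := by exact_mod_cast hq
        rw [ex_lt y hq]
        by_cases hqj : q < j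
        · rw [hy0 ⟨q, hq⟩ hqj, norm_zero]
          have : 0 ≤ (n:ℝ) - q := by linarith
          positivity
        · have e := congrFun hy ⟨q, hq⟩
          rw [Nop_apply, if_neg hqj] at e
          simp only at e
          have e2 : y ⟨q, hq⟩ = em (-kF F j q) * (v ⟨q, hq⟩ - ex y (q+1)) := by
            rw [← e, add_sub_cancel_right, ← mul_assoc, ← em_add]
            simp [em_zero]
          rw [e2, norm_mul, em_norm, neg_neg]
          calc Real.exp (kF F j q) * ‖v ⟨q, hq⟩ - ex y (q+1)‖
              ≤ Real.exp (kF F j q) * (‖v ⟨q, hq⟩‖ + ‖ex y (q+1)‖) := by gcongr; exact norm_sub_le _ _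
            _ ≤ Real.exp (kF F j q) * (c * Real.exp (-sF F j (q+1)) +
                  c * (n - (q+1 : ℕ)) * Real.exp (-sF F j (q+1))) := by
                gcongr
                exact h2 ⟨q, hq⟩
            _ = c * (n - q) * (Real.exp (kF F j q) * Real.exp (-sF F j (q+1))) := by
                push_cast; ring
            _ = _ := by rw [← Real.exp_add]; congr 2; unfold kF; ring
    set y' : Fin n → ℂ := fun q => if q.val < j + 1 then 0 else y q with hy'
    have hyy : y = y' + Pi.single ⟨j, hj⟩ (y ⟨j, hj⟩) := by
      ext q
      simp only [hy', Pi.add_apply, Pi.single_apply]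
      by_cases h1 : q = ⟨j, hj⟩
      · subst h1; simp
      · have : q.val ≠ j := fun h => h1 (Fin.ext h)
        by_cases h2 : q.val < j
        · rw [hy0 q h2, if_pos (by omega), if_neg h1]; simp
        · rw [if_neg (by omega), if_neg h1, add_zero]
    have hcn : 0 ≤ c * (n+1) := by positivity
    obtain ⟨w', a1, a2, a3⟩ := ih (c * (n+1)) y' hcn (by intro q hq; simp only [hy']; rw [if_pos hq]) (by
      intro q
      simp only [hy']
      split_ifs with hq
      · rw [norm_zero]; positivity
      · have b := hyb q.val q.2.le
        rw [ex_val] at b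
        have hqn : (q.val:ℝ) ≤ n := by exact_mod_cast q.2.le
        calc ‖y q‖ ≤ c * (n - q.val) * Real.exp (-sF F j q.val) := b
          _ ≤ c * (n+1) * Real.exp (-sF F (j+1) (q.val+1)) := by
            have := hz j q.val q.2
            have h5 : (0:ℝ) ≤ q.val := by positivity
            gcongr
            linarith)
    refine ⟨w' + Pi.single ⟨j, hj⟩ (y ⟨j, hj⟩), ?_, ?_, ?_⟩
    · rw [Top_step F hj, LinearMap.comp_apply, map_add, a1, Top_single F (j+1) hj _ _ (by simp), ← hyy, hy]
    · intro q hq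
      rw [Pi.add_apply, a2 q (by omega), Pi.single_apply, if_neg (by rintro rfl; simp at hq), add_zero]
    · have e : n - j = n - (j+1) + 1 := by omega
      have hexp : c * ((n:ℝ)+1)^(n-j) = c * (n+1) * (n+1)^(n-(j+1)) := by rw [e, pow_succ]; ring
      rw [hexp]
      rw [pi_norm_le_iff_of_nonneg (by positivity)]
      intro q
      by_cases hq : q = ⟨j, hj⟩
      · subst hq
        rw [Pi.add_apply, a2 _ (by simp), zero_add, Pi.single_eq_same]
        have b := hyb j hj.le
        rw [ex_lt y hj, h0 j j le_rfl, neg_zero, Real.exp_zero, mul_one] at b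
        calc _ ≤ _ := b
          _ ≤ c * (n+1) * 1 := by
            rw [mul_one]; gcongr; 
            have : (0:ℝ) ≤ j := by positivity
            linarith
          _ ≤ _ := by
            gcongr
            apply one_le_pow₀
            have : (0:ℝ) ≤ n := by positivity
            linarith
      · rw [Pi.add_apply, Pi.single_apply, if_neg hq, add_zero]
        exact (norm_le_pi_norm w' q).trans a3

end ops
end Horn


namespace Horn

section left
variable {n : ℕ} (F : ℕ → ℕ → ℝ)

/-- The combinatorial properties of the array used in the construction. -/
structure FP (n : ℕ) (F : ℕ → ℕ → ℝ) : Prop where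
  p0 : ∀ i p, p ≤ i → sF F i p = 0
  py : ∀ i q, i < q → q < n → 0 ≤ kF F i q
  px : ∀ i q, i ≤ q → q + 1 < n → F (i+1) (q+2) - F (i+1) (q+1) ≤ F i (q+1) - F i q
  pz : ∀ i p, p + 1 ≤ n → sF F (i+1) (p+1) ≤ sF F i p

def LF (i q : ℕ) : ℝ := F i (q+1) - F i q

noncomputable def Uop (i : ℕ) : (Fin n → ℂ) →ₗ[ℂ] (Fin n → ℂ) where
  toFun v := fun q => v q + (if q.val < i then 0 else em (LF F i q.val - LF F (i+1) (q.val+1))) * ex v (q.val+1)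
  map_add' v w := by ext q; simp only [ex_add, Pi.add_apply]; ring
  map_smul' r v := by
    ext q; simp only [ex_smul, Pi.smul_apply, smul_eq_mul, RingHom.id_apply]; ring

lemma Uop_apply (i : ℕ) (v : Fin n → ℂ) (q : Fin n) : Uop F i v q =
  v q + (if q.val < i then 0 else em (LF F i q.val - LF F (i+1) (q.val+1))) * ex v (q.val+1) := rfl

lemma dg_apply (d : ℕ → ℂ) (v : Fin n → ℂ) (q : Fin n) : dg d v q = d q.val * v q := rfl

lemma ex_dg (d : ℕ → ℂ) (v : Fin n → ℂ) (q : ℕ) : ex (dg d v) q = d q * ex v q := by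
  unfold ex; split_ifs
  · rw [dg_apply]
  · simp

lemma D_Nop (hF : FP n F) (i : ℕ) : (dg (fun q => em (LF F i q)) : (Fin n → ℂ) →ₗ[ℂ] (Fin n → ℂ)) ∘ₗ Nop F i =
    Uop F i ∘ₗ dg (fun q => em (LF F (i+1) q)) := by
  ext1 j
  ext1
  ext q
  simp only [LinearMap.comp_apply]
  generalize (LinearMap.single ℂ (fun _ : Fin n => ℂ) j) 1 = v
  rw [dg_apply, Nop_apply, Uop_apply, dg_apply, ex_dg]
  by_cases h : q.val < i
  · rw [if_pos h, if_pos h, zero_mul, add_zero]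
    have e1 := hF.p0 i q.val h.le
    have e2 := hF.p0 i (q.val+1) h
    have : LF F i q.val = LF F (i+1) q.val := by unfold LF; unfold sF at e1 e2; linarith
    rw [this]
  · rw [if_neg h, if_neg h, mul_add, ← mul_assoc, ← em_add, ← mul_assoc, ← em_add]
    congr 3
    · unfold LF kF sF; ring
    · ring

lemma Uop_bd (hF : FP n F) (i : ℕ) : Bd (n+1) (Uop F i : (Fin n → ℂ) →ₗ[ℂ] (Fin n → ℂ)) := by
  have hb : ∀ (v : Fin n → ℂ) (q : Fin n), ‖(if q.val < i then 0 else em (LF F i q.val - LF F (i+1) (q.val+1))) * ex v (q.val+1)‖ ≤ ‖ex v (q.val+1)‖ := by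
    intro v q
    rw [norm_mul]
    by_cases h : q.val + 1 < n
    · apply mul_le_of_le_one_left (norm_nonneg _)
      split_ifs with h1
      · simp
      · apply em_norm_le
        have := hF.px i q.val (by omega) h
        unfold LF; linarith
    · rw [ex_ge v (by omega)]; simp
  intro v
  constructor
  · rw [pi_norm_le_iff_of_nonneg (by positivity)]
    intro q
    rw [Uop_apply]
    have h1 : (1:ℝ) ≤ n := by exact_mod_cast q.pos
    calc _ ≤ ‖v q‖ + ‖ex v (q.val+1)‖ := (norm_add_le _ _).trans (by gcongr; exact hb v q)
      _ ≤ ‖v‖ + ‖v‖ := add_le_add (norm_le_pi_norm v q) (ex_norm v _)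
      _ ≤ _ := by nlinarith [norm_nonneg v]
  · have : ∀ q, q ≤ n → ‖ex v q‖ ≤ (n - q) * ‖Uop F i v‖ := by
      apply down_ind
      · rw [ex_ge v le_rfl]; simp
      · intro q hq ih
        rw [ex_lt v hq]
        have e := Uop_apply F i v ⟨q, hq⟩
        have h2 := hb v ⟨q, hq⟩
        have h3 := norm_le_pi_norm (Uop F i v) ⟨q, hq⟩
        have e' := eq_sub_of_add_eq e.symm
        rw [e']
        push_cast at ih
        calc _ ≤ _ := norm_sub_le _ _
          _ ≤ ‖Uop F i v‖ + (n - (q + 1)) * ‖Uop F i v‖ := add_le_add h3 (h2.trans ih)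
          _ = _ := by ring
    rw [pi_norm_le_iff_of_nonneg (by positivity)]
    intro q
    have := this q.val q.2.le
    rw [ex_val] at this
    refine this.trans ?_
    gcongr
    have : (0:ℝ) ≤ q.val := by positivity
    linarith

lemma left_fact (hF : FP n F) : ∀ j, j ≤ n → ∃ U : (Fin n → ℂ) →ₗ[ℂ] (Fin n → ℂ), Bd ((n+1)^j) U ∧
    dg (fun q => em (LF F 0 q)) ∘ₗ Top n F 0 = U ∘ₗ dg (fun q => em (LF F j q)) ∘ₗ Top n F j := by
  intro j
  induction j with
  | zero => intro _; exact ⟨LinearMap.id, by simpa using Bd.id, by rw [LinearMap.id_comp]⟩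
  | succ j ih =>
    intro hj
    obtain ⟨U, h1, h2⟩ := ih (by omega)
    refine ⟨U ∘ₗ Uop F j, ?_, ?_⟩
    · rw [pow_succ]; exact h1.comp (by positivity) (by positivity) (Uop_bd F hF j)
    · rw [h2, Top_step F (by omega : j < n), ← LinearMap.comp_assoc (Top n F (j+1)), D_Nop F hF]
      simp only [LinearMap.comp_assoc]

end left

section right
variable {n : ℕ} (F : ℕ → ℕ → ℝ)

noncomputable def Pop (i : ℕ) : (Fin n → ℂ) →ₗ[ℂ] (Fin n → ℂ) where
  toFun z := fun q => if q.val < i then z q else if q.val + 1 < n then ex z (q.val+1) else (-1)^(n-1-i) * ex z i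
  map_add' v w := by ext q; simp only [ex_add, Pi.add_apply]; split_ifs <;> ring
  map_smul' r v := by
    ext q; simp only [ex_smul, Pi.smul_apply, smul_eq_mul, RingHom.id_apply]; split_ifs <;> ring

lemma Pop_apply (i : ℕ) (z : Fin n → ℂ) (q : Fin n) : Pop i z q =
  if q.val < i then z q else if q.val + 1 < n then ex z (q.val+1) else (-1)^(n-1-i) * ex z i := rfl

lemma Pop_bd {i : ℕ} (hi : i < n) : Bd 1 (Pop i : (Fin n → ℂ) →ₗ[ℂ] (Fin n → ℂ)) := by
  intro z
  rw [one_mul, one_mul]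
  constructor
  · rw [pi_norm_le_iff_of_nonneg (by positivity)]
    intro q
    rw [Pop_apply]
    split_ifs
    · exact norm_le_pi_norm z q
    · exact ex_norm z _
    · rw [norm_mul]; simpa using ex_norm z _
  · rw [pi_norm_le_iff_of_nonneg (by positivity)]
    intro q
    rcases lt_trichotomy q.val i with h | h | h
    · have e := Pop_apply i z q
      rw [if_pos h] at e
      rw [← e]; exact norm_le_pi_norm _ _
    · have e := Pop_apply i z ⟨n-1, by omega⟩
      rw [if_neg (by simp; omega), if_neg (by simp; omega)] at e
      have e2 : ex z i = z q := by rw [← h, ex_val]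
      have := norm_le_pi_norm (Pop i z) ⟨n-1, by omega⟩
      rw [e, norm_mul, e2] at this
      simpa using this
    · have e := Pop_apply i z ⟨q.val-1, by omega⟩
      rw [if_neg (by simp; omega), if_pos (by simp; omega)] at e
      have e3 : q.val - 1 + 1 = q.val := by omega
      simp only [e3, ex_val] at e
      rw [← e]; exact norm_le_pi_norm _ _

noncomputable def Rop (i : ℕ) : (Fin n → ℂ) →ₗ[ℂ] (Fin n → ℂ) where
  toFun x := fun q => if q.val ≤ i then x q else x q + em (kF F i q.val) * ex x (q.val-1)
  map_add' v w := by ext q; simp only [ex_add, Pi.add_apply]; split_ifs <;> ring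
  map_smul' r v := by
    ext q; simp only [ex_smul, Pi.smul_apply, smul_eq_mul, RingHom.id_apply]; split_ifs <;> ring

lemma Rop_apply (i : ℕ) (x : Fin n → ℂ) (q : Fin n) : Rop F i x q =
  if q.val ≤ i then x q else x q + em (kF F i q.val) * ex x (q.val-1) := rfl

lemma Rop_bd (hF : FP n F) (i : ℕ) : Bd (n+1) (Rop F i : (Fin n → ℂ) →ₗ[ℂ] (Fin n → ℂ)) := by
  have hb : ∀ (v : Fin n → ℂ) (q : Fin n), ¬ q.val ≤ i → ‖em (kF F i q.val) * ex v (q.val-1)‖ ≤ ‖ex v (q.val-1)‖ := by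
    intro v q hq
    rw [norm_mul]
    exact mul_le_of_le_one_left (norm_nonneg _) (em_norm_le (hF.py i q.val (by omega) q.2))
  intro v
  constructor
  · rw [pi_norm_le_iff_of_nonneg (by positivity)]
    intro q
    have h1 : (1:ℝ) ≤ n := by exact_mod_cast q.pos
    rw [Rop_apply]
    split_ifs with h
    · have := norm_le_pi_norm v q
      nlinarith [norm_nonneg v]
    · calc _ ≤ ‖v q‖ + ‖ex v (q.val-1)‖ := (norm_add_le _ _).trans (by gcongr; exact hb v q h)
        _ ≤ ‖v‖ + ‖v‖ := add_le_add (norm_le_pi_norm v q) (ex_norm v _)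
        _ ≤ _ := by nlinarith [norm_nonneg v]
  · have : ∀ q, ∀ hq : q < n, ‖v ⟨q, hq⟩‖ ≤ (q+1) * ‖Rop F i v‖ := by
      intro q
      induction q with
      | zero =>
        intro hq
        have e := Rop_apply F i v ⟨0, hq⟩
        rw [if_pos (by simp)] at e
        rw [← e]; simpa using norm_le_pi_norm (Rop F i v) ⟨0, hq⟩
      | succ q ih =>
        intro hq
        have e := Rop_apply F i v ⟨q+1, hq⟩
        have h3 := norm_le_pi_norm (Rop F i v) ⟨q+1, hq⟩
        have h4 := ih (by omega)
        by_cases h : q + 1 ≤ i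
        · rw [if_pos h] at e
          rw [← e]; refine h3.trans ?_
          push_cast
          have : 0 ≤ ((q:ℝ)+1) * ‖Rop F i v‖ := by positivity
          linarith
        · rw [if_neg h] at e
          have e' := eq_sub_of_add_eq e.symm
          rw [e']
          have h2 := hb v ⟨q+1, hq⟩ h
          simp only [Nat.add_sub_cancel] at h2
          rw [ex_lt v (by omega : q < n)] at h2
          calc _ ≤ _ := norm_sub_le _ _
            _ ≤ ‖Rop F i v‖ + ((q:ℝ)+1) * ‖Rop F i v‖ := add_le_add h3 (by
                simp only [Nat.add_sub_cancel]
                rw [ex_lt v (by omega : q < n)]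
                exact h2.trans h4)
            _ = _ := by push_cast; ring
    rw [pi_norm_le_iff_of_nonneg (by positivity)]
    intro q
    refine (this q.val q.2).trans ?_
    gcongr
    exact_mod_cast q.2.le

/-- the sign-alternating vector -/
noncomputable def vp (i q : ℕ) : ℂ := (-1)^(q-i) * em (sF F i q)

lemma vp_step {i q : ℕ} (h : i ≤ q) : em (kF F i q) * vp F i q = - vp F i (q+1) := by
  unfold vp
  have e : q + 1 - i = (q - i) + 1 := by omega
  have e2 : sF F i (q+1) = kF F i q + sF F i q := by unfold kF; ring
  rw [e, e2, em_add, pow_succ]; ring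

lemma vp_self (hF : FP n F) (i : ℕ) : vp F i i = 1 := by
  unfold vp; rw [hF.p0 i i le_rfl, em_zero]; simp

lemma vp_norm (i q : ℕ) : ‖vp F i q‖ = Real.exp (-sF F i q) := by
  unfold vp; rw [norm_mul, em_norm]; simp

noncomputable def vpv (i : ℕ) : Fin n → ℂ := fun q => if q.val ≤ i then 0 else vp F i q.val

lemma Nop_fact (hF : FP n F) {i : ℕ} (hi : i < n) (y : Fin n → ℂ) :
    Nop F i y = Rop F i (Pop i (dg (fun q => if q = i then em (sF F i n) else 1) (y - y ⟨i, hi⟩ • vpv F i))) := by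
  set z := dg (fun q => if q = i then em (sF F i n) else 1) (y - y ⟨i, hi⟩ • vpv F i) with hz
  have z1 : ∀ q : Fin n, q.val < i → z q = y q := by
    intro q hq
    rw [hz, dg_apply, if_neg (by omega)]; simp [vpv, hq.le]
  have z2 : ex z i = em (sF F i n) * y ⟨i, hi⟩ := by
    rw [hz, ex_dg, if_pos rfl, ex_lt _ hi]; simp [vpv]
  have z3 : ∀ q, i < q → q < n → ex z q = ex y q - y ⟨i, hi⟩ * vp F i q := by
    intro q h1 h2
    rw [hz, ex_dg, if_neg (by omega), ex_lt _ h2, ex_lt _ h2]; simp [vpv, Nat.not_le.mpr h1]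
  have x2 : ∀ q, i ≤ q → q < n → ex (Pop i z) q = ex y (q+1) - y ⟨i, hi⟩ * vp F i (q+1) := by
    intro q h1 h2
    rw [ex_lt _ h2, Pop_apply, if_neg (by simpa using h1)]
    simp only
    split_ifs with h3
    · exact z3 _ (by omega) h3
    · have : q + 1 = n := by omega
      rw [this, ex_ge y le_rfl, z2]
      unfold vp
      have e : n - i = (n - 1 - i) + 1 := by omega
      rw [e, pow_succ]; ring
  ext q
  rw [Nop_apply, Rop_apply]
  rcases lt_trichotomy q.val i with h | h | h
  · rw [if_pos h, if_pos h.le, Pop_apply, if_pos h, z1 q h]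
  · rw [if_neg (by omega), if_pos h.le]
    have hq : q = ⟨i, hi⟩ := Fin.ext h
    rw [← ex_val (Pop i z) q, x2 _ h.ge q.2, h]
    have e := vp_step F (le_refl i)
    rw [vp_self F hF, mul_one] at e
    rw [e, hq]; ring
  · rw [if_neg (by omega), if_neg (by omega)]
    have e3 : q.val - 1 + 1 = q.val := by omega
    rw [← ex_val (Pop i z) q, x2 _ h.le q.2, x2 (q.val-1) (by omega) (by omega), e3, ex_val]
    have e := vp_step F h.le
    linear_combination y ⟨i, hi⟩ * e

lemma RP_comm (i : ℕ) (d : ℕ → ℂ) (hd : ∀ q, i ≤ q → d q = 1) (z : Fin n → ℂ) :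
    Rop F i (Pop i (dg d z)) = dg d (Rop F i (Pop i z)) := by
  have x1 : ∀ q : Fin n, Pop i (dg d z) q = d q.val * Pop i z q := by
    intro q
    rw [Pop_apply, Pop_apply, dg_apply, ex_dg, ex_dg]
    split_ifs with h1 h2
    · rfl
    · rw [hd _ (by omega), hd _ (by omega)]
    · rw [hd _ (by omega), hd _ (by omega)]; ring
  ext q
  rw [dg_apply, Rop_apply, Rop_apply]
  split_ifs with h
  · exact x1 q
  · have hq : q.val - 1 < n := by omega
    rw [ex_lt _ hq, ex_lt _ hq, x1, x1, hd _ (by omega), hd _ (by simp; omega)]; ring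

/-- rank one perturbation -/
noncomputable def Wop (i : Fin n) (w : Fin n → ℂ) : (Fin n → ℂ) →ₗ[ℂ] (Fin n → ℂ) where
  toFun v := v - v i • w
  map_add' v u := by simp only [Pi.add_apply, add_smul]; abel
  map_smul' r v := by simp [smul_sub, smul_smul]

lemma Wop_apply (i : Fin n) (w v : Fin n → ℂ) : Wop i w v = v - v i • w := rfl

lemma Wop_bd (i : Fin n) (w : Fin n → ℂ) (hw : w i = 0) {c : ℝ} (hc : ‖w‖ ≤ c) : Bd (1 + c) (Wop i w) := by
  intro v
  have key : ∀ u : Fin n → ℂ, ‖u i • w‖ ≤ c * ‖u‖ := by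
    intro u
    rw [norm_smul, mul_comm]
    exact mul_le_mul hc (norm_le_pi_norm u i) (norm_nonneg _) ((norm_nonneg _).trans hc)
  constructor
  · rw [Wop_apply]
    calc _ ≤ _ := norm_sub_le _ _
      _ ≤ ‖v‖ + c * ‖v‖ := by gcongr; exact key v
      _ = _ := by ring
  · have e : v = Wop i w v + (Wop i w v) i • w := by
      rw [Wop_apply]; simp [hw]
    calc ‖v‖ = ‖Wop i w v + (Wop i w v) i • w‖ := by rw [← e]
      _ ≤ _ := norm_add_le _ _
      _ ≤ ‖Wop i w v‖ + c * ‖Wop i w v‖ := by gcongr; exact key _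
      _ = _ := by ring

lemma right_fact (hF : FP n F) : ∀ j, j ≤ n → ∃ K K' : (Fin n → ℂ) →ₗ[ℂ] (Fin n → ℂ),
    Bd ((n+1)^j) K ∧ Bd ((1 + (n+1)^n)^j) K' ∧
    Top n F 0 = K ∘ₗ dg (fun q => if q < j then em (sF F q n) else 1) ∘ₗ Top n F j ∘ₗ K' := by
  intro j
  induction j with
  | zero =>
    intro _
    refine ⟨LinearMap.id, LinearMap.id, by simpa using Bd.id, by simpa using Bd.id, ?_⟩
    have : dg (fun q => if q < 0 then em (sF F q n) else 1) = (LinearMap.id : (Fin n → ℂ) →ₗ[ℂ] (Fin n → ℂ)) := by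
      apply LinearMap.ext; intro v; ext q; rw [dg_apply]; simp
    rw [this]; rfl
  | succ j ih =>
    intro hj
    obtain ⟨K, K', h1, h2, h3⟩ := ih (by omega)
    have hj' : j < n := by omega
    obtain ⟨w, a1, a2, a3⟩ := solve F hF.pz hF.p0 (j+1) hj 1 (vpv F j) zero_le_one
      (by intro q hq; simp only [vpv]; rw [if_pos (by omega)])
      (by
        intro q
        simp only [vpv]
        split_ifs with hq
        · rw [norm_zero]; positivity
        · rw [vp_norm, one_mul, Real.exp_le_exp]
          have := hF.pz j q.val q.2
          linarith)
    refine ⟨K ∘ₗ (Rop F j ∘ₗ Pop j), Wop ⟨j, hj'⟩ w ∘ₗ K', ?_, ?_, ?_⟩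
    · rw [pow_succ]
      apply h1.comp (by positivity) (by positivity)
      simpa using (Rop_bd F hF j).comp (by positivity) (by positivity) (Pop_bd hj')
    · rw [pow_succ, mul_comm]
      apply Bd.comp (by positivity) (by positivity) _ h2
      apply Wop_bd _ _ (a2 _ (by simp))
      rw [one_mul] at a3
      refine a3.trans ?_
      apply pow_le_pow_right₀
      · have : (0:ℝ) ≤ n := by positivity
        linarith
      · omega
    · rw [h3]
      apply LinearMap.ext
      intro v
      simp only [LinearMap.comp_apply]
      congr 1
      generalize K' v = u
      rw [Top_step F hj', LinearMap.comp_apply, Nop_fact F hF hj', ← RP_comm F j _ (by intro q hq; rw [if_neg (by omega)])]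
      congr 2
      rw [Wop_apply, map_sub (Top n F (j+1)), map_smul (Top n F (j+1)), a1, Top_coord F (j+1) hj u ⟨j, hj'⟩ (by simp)]
      ext q
      simp only [dg_apply]
      rw [← mul_assoc]
      congr 1
      rcases lt_trichotomy q.val j with h | h | h
      · rw [if_pos h, if_neg (by omega), if_pos (by omega), mul_one]
      · rw [if_neg (by omega), if_pos h, if_pos (by omega), one_mul, h]
      · rw [if_neg (by omega), if_neg (by omega), if_neg (by omega), mul_one]

end right

section build
variable {n : ℕ}

/-- rearranged array -/
noncomputable def Fh (h : ℕ → ℕ → ℝ) (i p : ℕ) : ℝ := if p ≤ i then h 0 p else h (p - i) i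

lemma Fh_le (h : ℕ → ℕ → ℝ) {i p : ℕ} (hp : p ≤ i) : Fh h i p = h 0 p := by simp [Fh, hp]
lemma Fh_add (h : ℕ → ℕ → ℝ) (i j : ℕ) : Fh h i (i + j) = h j i := by
  unfold Fh
  split_ifs with h1
  · have : j = 0 := by omega
    subst this; simp
  · congr 1; omega

lemma Fh_FP {x : (Fin n → ℝ) × (Fin n → ℝ) × (Fin n → ℝ)} {h : ℕ → ℕ → ℝ} (hs : Sys n 0 x h) : FP n (Fh h) where
  p0 i p hp := by unfold sF; rw [Fh_le h hp, Fh_le h (by omega), sub_self]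
  py i q h1 h2 := by
    obtain ⟨j, rfl⟩ : ∃ j, q = i + 1 + j := ⟨q - i - 1, by omega⟩
    have := hs.ry j i (by omega)
    unfold kF sF
    rw [show i + 1 + j + 1 = (i+1) + (j+1) by ring, Fh_add, Fh_add,
      show (i+1) + (j+1) = i + (j+2) by ring, Fh_add, show i + 1 + j = i + (j+1) by ring, Fh_add]
    linarith
  px i q h1 h2 := by
    obtain ⟨j, rfl⟩ : ∃ j, q = i + j := ⟨q - i, by omega⟩
    have := hs.rx j i (by omega)
    rw [show i + j + 2 = (i+1) + (j+1) by ring, Fh_add, show i + j + 1 = (i+1) + j by ring, Fh_add,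
      show i + 1 + j = i + (j+1) by ring, Fh_add, Fh_add]
    linarith
  pz i p hp := by
    by_cases hpi : p ≤ i
    · unfold sF
      rw [Fh_le h hpi, Fh_le h (by omega : p ≤ i + 1), Fh_le h (by omega : p + 1 ≤ i + 1), Fh_le h (by omega : p + 1 ≤ i + 1 + 1)]
      linarith
    · obtain ⟨j, rfl⟩ : ∃ j, p = i + 1 + j := ⟨p - i - 1, by omega⟩
      have := hs.rz j i (by omega)
      unfold sF
      rw [Fh_add, show i + 1 + j + 1 = (i+1+1) + j by ring, Fh_add, show i + 1 + 1 + j = (i+1) + (j+1) by ring, Fh_add,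
        show i + 1 + j = i + (j+1) by ring, Fh_add]
      linarith

/-- The operator built from a solution of the system. -/
lemma construct {x : (Fin n → ℝ) × (Fin n → ℝ) × (Fin n → ℝ)} {h : ℕ → ℕ → ℝ} (hs : Sys n 0 x h) :
    ∃ T U K K' : (Fin n → ℂ) →ₗ[ℂ] (Fin n → ℂ), Bd ((1 + (n+1)^n)^n) U ∧ Bd ((1 + (n+1)^n)^n) K ∧ Bd ((1 + (n+1)^n)^n) K' ∧
      (∀ v q, Real.exp (- x.1 q) * T v q = U (fun p => Real.exp (- x.2.2 p) * v p) q) ∧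
      (∀ v, T v = K (fun p => Real.exp (- x.2.1 p) * K' v p)) := by
  have hF := Fh_FP hs
  obtain ⟨U, u1, u2⟩ := left_fact (Fh h) hF n le_rfl
  obtain ⟨K, K', k1, k2, k3⟩ := right_fact (Fh h) hF n le_rfl
  have hc : ((n:ℝ)+1)^n ≤ (1 + (n+1)^n)^n := by
    rcases Nat.eq_zero_or_pos n with h0 | h0
    · subst h0; simp
    · apply pow_le_pow_left₀ (by positivity)
      have : ((n:ℝ)+1)^1 ≤ (n+1)^n := by
        apply pow_le_pow_right₀ _ h0
        have : (0:ℝ) ≤ n := by positivity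
        linarith
      linarith [this, pow_one ((n:ℝ)+1)]
  have A : ∀ k ≤ n, h k 0 = ps x.1 k := fun k hk => by linarith [hs.a1 k hk, hs.a2 k hk]
  have Tt : ∀ k ≤ n, h 0 k = ps x.2.2 k := fun k hk => by linarith [hs.t1 k hk, hs.t2 k hk]
  have Cc : ∀ k ≤ n, h (n-k) k = ps x.1 n + ps x.2.1 k := fun k hk => by linarith [hs.c1 k hk, hs.c2 k hk]
  have eA : ∀ q : Fin n, LF (Fh h) 0 q.val = x.1 q := by
    intro q
    unfold LF
    have e1 := Fh_add h 0 (q.val+1)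
    have e2 := Fh_add h 0 q.val
    rw [Nat.zero_add] at e1 e2
    rw [e1, e2, A _ q.2, A _ q.2.le, ps_succ]; ring
  have eT : ∀ q : Fin n, LF (Fh h) n q.val = x.2.2 q := by
    intro q
    unfold LF
    rw [Fh_le h q.2, Fh_le h q.2.le, Tt _ q.2, Tt _ q.2.le, ps_succ]; ring
  have eC : ∀ q : Fin n, sF (Fh h) q.val n = x.2.1 q := by
    intro q
    unfold sF
    have e1 := Fh_add h (q.val+1) (n-(q.val+1))
    have e2 := Fh_add h q.val (n-q.val)
    rw [Nat.add_sub_cancel' q.2] at e1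
    rw [Nat.add_sub_cancel' q.2.le] at e2
    rw [e1, e2, Cc _ q.2, Cc _ q.2.le, ps_succ]; ring
  refine ⟨Top n (Fh h) 0, U, K, K', u1.mono hc, k1.mono hc, k2, ?_, ?_⟩
  · intro v q
    have := congrFun (LinearMap.congr_fun u2 v) q
    simp only [LinearMap.comp_apply, Top_self, LinearMap.id_apply] at this
    rw [dg_apply, eA] at this
    have e : dg (fun q => em (LF (Fh h) n q)) v = fun p => (Real.exp (- x.2.2 p) : ℂ) * v p := by
      ext p; rw [dg_apply, eT]; simp [em]
    rw [e] at this
    rw [← this]; simp [em]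
  · intro v
    rw [k3]
    simp only [LinearMap.comp_apply, Top_self, LinearMap.id_apply]
    congr 1
    ext p
    rw [dg_apply, if_pos p.2, eC]; simp [em]

end build
end Horn


namespace Horn
open scoped ComplexOrder

/-- approximate Weyl inequality, from the system of inequalities -/
lemma weyl_sys {n : ℕ} {K : ℝ} {x : (Fin n → ℝ) × (Fin n → ℝ) × (Fin n → ℝ)} {h : ℕ → ℕ → ℝ} (hK : 0 ≤ K)
    (hs : Sys n K x h) (k l : Fin n) (hl : l.val + 1 = n) :
    x.2.1 k + x.1 l - (2 * n + 6) * K ≤ x.2.2 k := by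
  have ha : ∀ j, j + k.val + 1 ≤ n → h j (k.val+1) - h j k.val - j * K ≤ h 0 (k.val+1) - h 0 k.val := by
    intro j
    induction j with
    | zero => intro _; simp
    | succ j ih =>
      intro hj
      have h1 := ih (by omega)
      have h2 := hs.rx j k.val (by omega)
      push_cast; linarith
  have hg : ∀ i, i + 1 ≤ n → h n 0 - h (n-1) 0 - i * K ≤ h (n-i) i - h (n-i-1) i := by
    intro i
    induction i with
    | zero => intro _; simp
    | succ i ih =>
      intro hi
      have h1 := ih (by omega)
      have h2 := hs.ry (n-i-2) i (by omega)
      have e1 : n - i - 2 + 1 = n - (i+1) := by omega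
      have e2 : n - i - 2 + 2 = n - i := by omega
      have e3 : n - (i+1) - 1 = n - i - 2 := by omega
      have e4 : n - i - 1 = n - (i+1) := by omega
      rw [e1, e2] at h2
      rw [e4] at h1
      rw [e3]
      push_cast; linarith
  have hk := k.2
  have h1 := ha (n - k.val - 1) (by omega)
  have h2 := hg k.val (by omega)
  have s1 := ps_succ x.2.2 k
  have s2 := ps_succ x.2.1 k
  have s3 := ps_succ x.1 l
  rw [hl] at s3
  have el : n - 1 = l.val := by omega
  rw [el] at h2
  have t2 := hs.t2 (k.val+1) k.2
  have t1 := hs.t1 k.val k.2.le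
  have c1 := hs.c1 (k.val+1) k.2
  have c2 := hs.c2 k.val k.2.le
  have a1 := hs.a1 n le_rfl
  have a2 := hs.a2 l.val l.2.le
  have e5 : n - (k.val + 1) = n - k.val - 1 := by omega
  rw [e5] at c1
  have b1 : ((n - k.val - 1 : ℕ) : ℝ) * K ≤ n * K := by
    gcongr; omega
  have b2 : (k.val : ℝ) * K ≤ n * K := by
    gcongr
  linarith

lemma weyl (n : ℕ) : ∃ K : ℝ, 0 ≤ K ∧ ∀ (U X : Matrix (Fin n) (Fin n) ℂ) (u a b : Fin n → ℝ), Antitone u → Antitone a → Antitone b →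
    HasSpec (U * Uᴴ) (fun i => Real.exp (2 * u i)) → HasSpec (X * Xᴴ) (fun i => Real.exp (2 * a i)) →
    HasSpec ((U * X) * (U * X)ᴴ) (fun i => Real.exp (2 * b i)) → ∀ k l : Fin n, l.val + 1 = n → a k + u l - K ≤ b k := by
  obtain ⟨K, hK, h⟩ := necessity n
  refine ⟨(2 * n + 6) * K, by positivity, ?_⟩
  intro U X u a b hu ha hb h1 h2 h3 k l hl
  obtain ⟨g, hg⟩ := h (u, a, b) ⟨hu, ha, hb, U, X, h1, h2, h3⟩
  exact weyl_sys hK hg k l hl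

lemma smin {n : ℕ} {U V : Matrix (Fin n) (Fin n) ℂ} {u : Fin n → ℝ} (hu : Antitone u)
    (h : HasSpec (U * Uᴴ) (fun i => Real.exp (2 * u i))) (hV : V * U = 1) {c : ℝ}
    (hc : ∀ i j, ‖V i j‖ ≤ c) (k : Fin n) : Real.exp (-(2 * u k)) ≤ n ^ 2 * c ^ 2 := by
  obtain ⟨Q, q1, q2, q3⟩ := exists_diag' (Matrix.isHermitian_mul_conjTranspose_self U) h
    (fun i j hij => Real.exp_le_exp.mpr (by linarith [hu hij]))
  set D := Matrix.diagonal (fun i => ((Real.exp (2 * u i) : ℝ) : ℂ)) with hD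
  have e1 : (V * Q) * (D * (V * Q)ᴴ) = 1 := by
    calc (V * Q) * (D * (V * Q)ᴴ) = V * (Q * D * Qᴴ) * Vᴴ := by
          rw [Matrix.conjTranspose_mul]; simp only [Matrix.mul_assoc]
      _ = (V * U) * (V * U)ᴴ := by rw [← q3, Matrix.conjTranspose_mul]; simp only [Matrix.mul_assoc]
      _ = 1 := by rw [hV]; simp
  have e2 := mul_eq_one_comm.mp e1
  rw [Matrix.mul_assoc] at e2
  set D' := Matrix.diagonal (fun i => ((Real.exp (-(2 * u i)) : ℝ) : ℂ)) with hD'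
  have e3 : D' * D = 1 := by
    rw [hD, hD', Matrix.diagonal_mul_diagonal, ← Matrix.diagonal_one]
    congr 1; ext i
    rw [← Complex.ofReal_mul, ← Real.exp_add]; simp
  have e4 : (V * Q)ᴴ * (V * Q) = D' := by
    calc _ = (D' * D) * ((V * Q)ᴴ * (V * Q)) := by rw [e3, Matrix.one_mul]
      _ = D' * (D * ((V * Q)ᴴ * (V * Q))) := by rw [Matrix.mul_assoc]
      _ = _ := by rw [e2, Matrix.mul_one]
  have e5 : (V * Vᴴ).trace = D'.trace := by
    rw [← e4, Matrix.trace_mul_comm ((V*Q)ᴴ), Matrix.conjTranspose_mul, Matrix.mul_assoc, ← Matrix.mul_assoc Q, q1, Matrix.one_mul]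
  have h2 : (V * Vᴴ).trace = ((∑ i, ∑ j, ‖V i j‖ ^ 2 : ℝ) : ℂ) := by
    simp only [Matrix.trace, Matrix.diag, Matrix.mul_apply, Matrix.conjTranspose_apply]
    push_cast
    refine Finset.sum_congr rfl fun i _ => Finset.sum_congr rfl fun j _ => ?_
    exact Complex.mul_conj' (V i j)
  rw [h2, hD', Matrix.trace_diagonal, ← Complex.ofReal_sum] at e5
  have e6 := Complex.ofReal_injective e5
  calc Real.exp (-(2 * u k)) ≤ ∑ i, Real.exp (-(2 * u i)) :=
        Finset.single_le_sum (f := fun i => Real.exp (-(2 * u i))) (fun i _ => (Real.exp_pos _).le) (Finset.mem_univ k)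
    _ = _ := e6.symm
    _ ≤ ∑ i : Fin n, ∑ j : Fin n, c ^ 2 := by
        refine Finset.sum_le_sum fun i _ => Finset.sum_le_sum fun j _ => ?_
        exact pow_le_pow_left₀ (norm_nonneg _) (hc i j) 2
    _ = _ := by simp; ring

/-- matrices with bounded entries and bounded inverse -/
def MB {n : ℕ} (c : ℝ) (U V : Matrix (Fin n) (Fin n) ℂ) : Prop :=
  U * V = 1 ∧ V * U = 1 ∧ (∀ i j, ‖U i j‖ ≤ c) ∧ ∀ i j, ‖V i j‖ ≤ c

lemma MB.symm {n : ℕ} {c : ℝ} {U V : Matrix (Fin n) (Fin n) ℂ} (h : MB c U V) : MB c V U :=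
  ⟨h.2.1, h.1, h.2.2.2, h.2.2.1⟩

lemma MB.conj {n : ℕ} {c : ℝ} {U V : Matrix (Fin n) (Fin n) ℂ} (h : MB c U V) : MB c Uᴴ Vᴴ := by
  refine ⟨?_, ?_, ?_, ?_⟩
  · rw [← Matrix.conjTranspose_mul, h.2.1, Matrix.conjTranspose_one]
  · rw [← Matrix.conjTranspose_mul, h.1, Matrix.conjTranspose_one]
  · intro i j; rw [Matrix.conjTranspose_apply, norm_star]; exact h.2.2.1 _ _
  · intro i j; rw [Matrix.conjTranspose_apply, norm_star]; exact h.2.2.2 _ _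

lemma MB.det {n : ℕ} {c : ℝ} {U V : Matrix (Fin n) (Fin n) ℂ} (h : MB c U V) : U.det ≠ 0 := by
  intro h0
  have := congrArg Matrix.det h.1
  rw [Matrix.det_mul, h0, zero_mul, Matrix.det_one] at this
  exact zero_ne_one this

lemma cmp_left1 (n : ℕ) (c : ℝ) (hc : 1 ≤ c) : ∃ c' : ℝ, 0 ≤ c' ∧ ∀ (U V X : Matrix (Fin n) (Fin n) ℂ) (a b : Fin n → ℝ), MB c U V →
    Antitone a → Antitone b → HasSpec (X * Xᴴ) (fun i => Real.exp (2 * a i)) →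
    HasSpec ((U * X) * (U * X)ᴴ) (fun i => Real.exp (2 * b i)) → ∀ k, a k - c' ≤ b k := by
  obtain ⟨K, hK, h⟩ := weyl n
  refine ⟨K + |(1/2) * Real.log (n^2 * c^2)|, by positivity, ?_⟩
  intro U V X a b hU ha hb h1 h2 k
  obtain ⟨u, hu, hus, -⟩ := exists_log_spec (posDef_mul_conj hU.det)
  have hn : 0 < n := k.pos
  set l : Fin n := ⟨n-1, by omega⟩ with hl
  have h3 := h U X u a b hu ha hb hus h1 h2 k l (by simp [hl]; omega)
  have h4 := smin hu hus hU.2.1 hU.2.2.2 l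
  have hp : (0:ℝ) < n^2 * c^2 := by
    have : (0:ℝ) < n := by exact_mod_cast hn
    positivity
  have h5 := (Real.le_log_iff_exp_le hp).mpr h4
  have h6 := le_abs_self ((1/2) * Real.log (n^2 * c^2))
  linarith

lemma cmp_left (n : ℕ) (c : ℝ) (hc : 1 ≤ c) : ∃ c' : ℝ, 0 ≤ c' ∧ ∀ (U V X : Matrix (Fin n) (Fin n) ℂ) (a b : Fin n → ℝ), MB c U V →
    Antitone a → Antitone b → HasSpec (X * Xᴴ) (fun i => Real.exp (2 * a i)) →
    HasSpec ((U * X) * (U * X)ᴴ) (fun i => Real.exp (2 * b i)) → ∀ k, |b k - a k| ≤ c' := by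
  obtain ⟨c', h0, h⟩ := cmp_left1 n c hc
  refine ⟨c', h0, ?_⟩
  intro U V X a b hU ha hb h1 h2 k
  have h3 := h U V X a b hU ha hb h1 h2 k
  have h4 := h V U (U * X) b a hU.symm hb ha h2 (by
    rw [← Matrix.mul_assoc, hU.2.1, Matrix.one_mul]; exact h1) k
  rw [abs_le]; constructor <;> linarith

lemma spec_conj {n : ℕ} {X : Matrix (Fin n) (Fin n) ℂ} {a : Fin n → ℝ} (h : HasSpec (X * Xᴴ) a) :
    HasSpec (Xᴴ * Xᴴᴴ) a := by
  rw [Matrix.conjTranspose_conjTranspose]; exact hasSpec_mul_comm.mp h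

lemma diag_spec {n : ℕ} (a : Fin n → ℝ) :
    HasSpec (Matrix.diagonal (fun i => ((Real.exp (a i) : ℝ) : ℂ)) * (Matrix.diagonal (fun i => ((Real.exp (a i) : ℝ) : ℂ)))ᴴ)
      (fun i => Real.exp (2 * a i)) := by
  have : Matrix.diagonal (fun i => ((Real.exp (a i) : ℝ) : ℂ)) * (Matrix.diagonal (fun i => ((Real.exp (a i) : ℝ) : ℂ)))ᴴ =
      Matrix.diagonal (fun i => ((Real.exp (2 * a i) : ℝ) : ℂ)) := by
    rw [Matrix.diagonal_conjTranspose, Matrix.diagonal_mul_diagonal]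
    congr 1; ext i
    simp only [Pi.star_apply, Complex.star_def, Complex.conj_ofReal]
    rw [← Complex.ofReal_mul, ← Real.exp_add]; congr 2; ring
  rw [this]
  unfold HasSpec
  rw [Matrix.charpoly_diagonal]

/-- two sided comparison -/
lemma cmp_both (n : ℕ) (c : ℝ) (hc : 1 ≤ c) : ∃ c' : ℝ, 0 ≤ c' ∧ ∀ (U V U' V' : Matrix (Fin n) (Fin n) ℂ) (a b : Fin n → ℝ),
    MB c U V → MB c U' V' → Antitone a → Antitone b →
    HasSpec ((U * (Matrix.diagonal (fun i => ((Real.exp (a i) : ℝ) : ℂ)) * U')) *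
      (U * (Matrix.diagonal (fun i => ((Real.exp (a i) : ℝ) : ℂ)) * U'))ᴴ) (fun i => Real.exp (2 * b i)) →
    ∀ k, |b k - a k| ≤ c' := by
  obtain ⟨c', h0, h⟩ := cmp_left n c hc
  refine ⟨c' + c', by positivity, ?_⟩
  intro U V U' V' a b hU hU' ha hb hs k
  set D := Matrix.diagonal (fun i => ((Real.exp (a i) : ℝ) : ℂ)) with hD
  have hDdet : D.det ≠ 0 := by
    apply det_ne_zero_of_hasSpec (a := fun i => 2 * a i)
    exact diag_spec a
  obtain ⟨d, hd, hds, -⟩ := exists_log_spec (posDef_mul_conj (A := D * U') (by rw [Matrix.det_mul]; exact mul_ne_zero hDdet hU'.det))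
  have h1 := h U V (D * U') d b hU hd hb hds hs k
  have h2 := h U'ᴴ V'ᴴ Dᴴ a d hU'.conj ha hd (spec_conj (diag_spec a)) (by
    have := spec_conj hds
    rwa [Matrix.conjTranspose_mul] at this) k
  rw [abs_le] at *
  constructor <;> linarith [h1.1, h1.2, h2.1, h2.2]

lemma Bd.mat {n : ℕ} {c : ℝ} {L : (Fin n → ℂ) →ₗ[ℂ] (Fin n → ℂ)} (h : Bd c L) :
    ∃ V, MB c (LinearMap.toMatrix' L) V := by
  have hinj : Function.Injective L := by
    rw [← LinearMap.ker_eq_bot, LinearMap.ker_eq_bot']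
    intro v hv
    have := (h v).2
    rw [hv, norm_zero, mul_zero] at this
    exact norm_le_zero_iff.mp this
  set e := LinearEquiv.ofInjectiveEndo L hinj with he
  have h1 : L ∘ₗ e.symm.toLinearMap = LinearMap.id := by
    apply LinearMap.ext; intro v
    exact e.apply_symm_apply v
  have hsn : ∀ j : Fin n, ‖(Pi.single j 1 : Fin n → ℂ)‖ = 1 := by
    intro j; rw [Pi.norm_single, norm_one]
  have h2 := congrArg LinearMap.toMatrix' h1
  rw [LinearMap.toMatrix'_comp, LinearMap.toMatrix'_id] at h2
  refine ⟨LinearMap.toMatrix' e.symm.toLinearMap, h2, mul_eq_one_comm.mp h2, ?_, ?_⟩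
  · intro i j
    rw [LinearMap.toMatrix'_apply]
    refine (norm_le_pi_norm _ i).trans ?_
    have := (h (Pi.single j 1)).1
    rw [hsn, mul_one] at this
    exact this
  · intro i j
    rw [LinearMap.toMatrix'_apply]
    refine (norm_le_pi_norm _ i).trans ?_
    have := (h (e.symm (Pi.single j 1))).2
    have e2 : L (e.symm (Pi.single j 1)) = Pi.single j 1 := e.apply_symm_apply _
    rw [e2, hsn, mul_one] at this
    exact this

lemma toMatrix_eq {n : ℕ} {L : (Fin n → ℂ) →ₗ[ℂ] (Fin n → ℂ)} (v : Fin n → ℂ) :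
    LinearMap.toMatrix' L *ᵥ v = L v := by
  rw [← Matrix.toLin'_apply, Matrix.toLin'_toMatrix']

lemma diag_inv {n : ℕ} (a : Fin n → ℝ) : Matrix.diagonal (fun i => ((Real.exp (a i) : ℝ) : ℂ)) *
    Matrix.diagonal (fun i => ((Real.exp (-a i) : ℝ) : ℂ)) = 1 := by
  rw [Matrix.diagonal_mul_diagonal, ← Matrix.diagonal_one]
  congr 1; ext i
  rw [← Complex.ofReal_mul, ← Real.exp_add]; simp

lemma sufficiency (n : ℕ) : ∃ c : ℝ, 0 ≤ c ∧ ∀ x : (Fin n → ℝ) × (Fin n → ℝ) × (Fin n → ℝ),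
    Antitone x.1 → Antitone x.2.1 → Antitone x.2.2 → (∃ h, Sys n 0 x h) → ∃ y ∈ Cone n, ‖y - x‖ ≤ c := by
  set C : ℝ := (1 + (n+1)^n)^n with hC
  have hC1 : 1 ≤ C := by
    apply one_le_pow₀
    have : (0:ℝ) ≤ (n+1)^n := by positivity
    linarith
  obtain ⟨c, hc, H⟩ := cmp_both n C hC1
  refine ⟨c, hc, ?_⟩
  rintro ⟨α, γ, τ⟩ ha hg ht ⟨h, hs⟩
  obtain ⟨T, U, K, K', hU, hK, hK', e1, e2⟩ := construct hs
  simp only at ha hg ht e1 e2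
  obtain ⟨VU, bU⟩ := hU.mat
  obtain ⟨VK, bK⟩ := hK.mat
  obtain ⟨VK', bK'⟩ := hK'.mat
  set MT := LinearMap.toMatrix' T with hMT
  set MU := LinearMap.toMatrix' U with hMU
  set MK := LinearMap.toMatrix' K with hMK
  set MK' := LinearMap.toMatrix' K' with hMK'
  have E2 : MT = MK * (Matrix.diagonal (fun i => ((Real.exp (-γ i) : ℝ) : ℂ)) * MK') := by
    apply Matrix.toLin'.injective
    apply LinearMap.ext; intro v
    rw [Matrix.toLin'_apply, Matrix.toLin'_apply, ← Matrix.mulVec_mulVec, ← Matrix.mulVec_mulVec, hMT, hMK, hMK',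
      toMatrix_eq, toMatrix_eq, toMatrix_eq, e2]
    congr 1; ext p; rw [Matrix.mulVec_diagonal]
  have E1 : Matrix.diagonal (fun i => ((Real.exp (-α i) : ℝ) : ℂ)) * MT = MU * Matrix.diagonal (fun i => ((Real.exp (-τ i) : ℝ) : ℂ)) := by
    apply Matrix.toLin'.injective
    apply LinearMap.ext; intro v
    ext q
    rw [Matrix.toLin'_apply, Matrix.toLin'_apply, ← Matrix.mulVec_mulVec, ← Matrix.mulVec_mulVec, hMT, hMU,
      toMatrix_eq, toMatrix_eq, Matrix.mulVec_diagonal, e1]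
    have e3 : (Matrix.diagonal (fun i => ((Real.exp (-τ i) : ℝ) : ℂ))) *ᵥ v = fun p => ((Real.exp (-τ p) : ℝ) : ℂ) * v p := by
      ext p; rw [Matrix.mulVec_diagonal]
    rw [e3]
  set Da := Matrix.diagonal (fun i => ((Real.exp (α i) : ℝ) : ℂ)) with hDa
  set Dg := Matrix.diagonal (fun i => ((Real.exp (γ i) : ℝ) : ℂ)) with hDg
  set Dt := Matrix.diagonal (fun i => ((Real.exp (τ i) : ℝ) : ℂ)) with hDt
  have ia := diag_inv α
  have ig := diag_inv γ
  have it := diag_inv τ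
  rw [← hDa] at ia
  rw [← hDg] at ig
  rw [← hDt] at it
  set Da' := Matrix.diagonal (fun i => ((Real.exp (-α i) : ℝ) : ℂ)) with hDa'
  set Dg' := Matrix.diagonal (fun i => ((Real.exp (-γ i) : ℝ) : ℂ)) with hDg'
  set Dt' := Matrix.diagonal (fun i => ((Real.exp (-τ i) : ℝ) : ℂ)) with hDt'
  have ia' := mul_eq_one_comm.mp ia
  have ig' := mul_eq_one_comm.mp ig
  set Ti := VK' * (Dg * VK) with hTi
  have F1 : MT * Ti = 1 := by
    rw [E2, hTi]
    calc MK * (Dg' * MK') * (VK' * (Dg * VK)) = MK * (Dg' * (MK' * VK') * Dg) * VK := by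
          simp only [Matrix.mul_assoc]
      _ = 1 := by rw [bK'.1, Matrix.mul_one, ig', Matrix.mul_one, bK.1]
  have F2 : Ti * Da = Dt * VU := by
    have : Dt * VU * Da' * MT = 1 := by
      calc Dt * VU * Da' * MT = Dt * VU * (Da' * MT) := by simp only [Matrix.mul_assoc]
        _ = Dt * (VU * MU) * Dt' := by rw [E1]; simp only [Matrix.mul_assoc]
        _ = 1 := by rw [bU.2.1, Matrix.mul_one, it]
    have h3 : Dt * VU * Da' = Ti := by
      calc Dt * VU * Da' = Dt * VU * Da' * (MT * Ti) := by rw [F1, Matrix.mul_one]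
        _ = (Dt * VU * Da' * MT) * Ti := by simp only [Matrix.mul_assoc]
        _ = Ti := by rw [this, Matrix.one_mul]
    rw [← h3, Matrix.mul_assoc, ia', Matrix.mul_one]
  have sa : ∀ a : Fin n → ℝ, (Matrix.diagonal (fun i => ((Real.exp (a i) : ℝ) : ℂ)))ᴴ = Matrix.diagonal (fun i => ((Real.exp (a i) : ℝ) : ℂ)) := by
    intro a
    rw [Matrix.diagonal_conjTranspose]; congr 1; ext i
    simp only [Pi.star_apply, Complex.star_def, Complex.conj_ofReal]
  have G1 : Tiᴴ = VKᴴ * (Dg * VK'ᴴ) := by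
    rw [hTi, Matrix.conjTranspose_mul, Matrix.conjTranspose_mul, hDg, sa]; simp only [Matrix.mul_assoc]
  have G2 : Da * Tiᴴ = VUᴴ * (Dt * (1 : Matrix (Fin n) (Fin n) ℂ)) := by
    have := congrArg Matrix.conjTranspose F2
    rw [Matrix.conjTranspose_mul Ti Da, Matrix.conjTranspose_mul Dt VU, hDa, hDt, sa, sa] at this
    rw [Matrix.mul_one]; exact this
  have hTd : Tiᴴ.det ≠ 0 := by
    rw [Matrix.det_conjTranspose]
    intro h0
    have h1 := star_eq_zero.mp h0
    have := congrArg Matrix.det F1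
    rw [Matrix.det_mul, h1, mul_zero, Matrix.det_one] at this
    exact zero_ne_one this
  have hDad : Da.det ≠ 0 := det_ne_zero_of_hasSpec (a := fun i => 2 * α i) (diag_spec α)
  obtain ⟨g, hg1, hg2, -⟩ := exists_log_spec (posDef_mul_conj hTd)
  obtain ⟨t, ht1, ht2, -⟩ := exists_log_spec (posDef_mul_conj (A := Da * Tiᴴ) (by rw [Matrix.det_mul]; exact mul_ne_zero hDad hTd))
  have b1 : MB C (1 : Matrix (Fin n) (Fin n) ℂ) 1 := by
    refine ⟨by simp, by simp, ?_, ?_⟩ <;>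
    · intro i j
      rw [Matrix.one_apply]; split_ifs
      · simpa using hC1
      · simp; linarith
  have r1 := H VKᴴ MKᴴ VK'ᴴ MK'ᴴ γ g bK.symm.conj bK'.symm.conj hg hg1 (by rw [← hDg, ← G1]; exact hg2)
  have r2 := H VUᴴ MUᴴ 1 1 τ t bU.symm.conj b1 ht ht1 (by rw [← hDt, ← G2]; exact ht2)
  refine ⟨(α, g, t), ⟨ha, hg1, ht1, Da, Tiᴴ, diag_spec α, hg2, ht2⟩, ?_⟩
  rw [Prod.norm_def, Prod.norm_def]
  simp only [Prod.fst_sub, Prod.snd_sub, sub_self, norm_zero]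
  refine max_le hc (max_le ?_ ?_)
  · rw [pi_norm_le_iff_of_nonneg hc]; intro k; exact r1 k
  · rw [pi_norm_le_iff_of_nonneg hc]; intro k; exact r2 k

end Horn

open Horn Filter Topology in
/-- polyhedrality -/
theorem main_polyhedral (n : ℕ) :
    ∃ (m : ℕ) (f : Fin m → ((Fin n → ℝ) × (Fin n → ℝ) × (Fin n → ℝ)) →ₗ[ℝ] ℝ),
      HornConeB n = {x | ∀ j : Fin m, 0 ≤ f j x} := by
  obtain ⟨m, f, hf1, hf2⟩ := sys_poly n
  have key : ∀ x, x ∈ Cone n ↔ ∀ j, 0 ≤ f j x := by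
    intro x
    constructor
    · intro hx j
      obtain ⟨K, hK, hnec⟩ := necessity n
      obtain ⟨K', hK'⟩ := hf2 K
      by_contra hneg
      push Not at hneg
      obtain ⟨N, hN⟩ := exists_nat_gt (K' / (-(f j x)))
      have h2 := cone_smul hx (s := (N:ℝ)+1) (by positivity)
      obtain ⟨h, hh⟩ := hnec _ h2
      have h3 := hK' _ ⟨h, hK, hh⟩ j
      rw [map_smul, smul_eq_mul] at h3
      rw [div_lt_iff₀ (by linarith)] at hN
      nlinarith
    · intro hx
      obtain ⟨c, hc, hsuf⟩ := sufficiency n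
      have hy : ∀ N : ℕ, ∃ y ∈ Cone n, ‖y - x‖ ≤ c / ((N:ℝ)+1) := by
        intro N
        have hN : (0:ℝ) < (N:ℝ)+1 := by positivity
        have h1 : ∀ j, 0 ≤ f j (((N:ℝ)+1) • x) := by
          intro j; rw [map_smul, smul_eq_mul]; exact mul_nonneg hN.le (hx j)
        obtain ⟨h, hh⟩ := hf1 _ h1
        have anti : ∀ a : Fin n → ℝ, (∀ i, i + 2 ≤ n → -0 ≤ 2 * ps a (i+1) - ps a i - ps a (i+2)) → Antitone a := by
          intro a h
          exact antitone_of_ps (by intro i hi; have := h i hi; linarith)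
        obtain ⟨y, y1, y2⟩ := hsuf _ (anti _ hh.ma) (anti _ hh.mc) (anti _ hh.mt) ⟨h, hh⟩
        refine ⟨((N:ℝ)+1)⁻¹ • y, cone_smul y1 (by positivity), ?_⟩
        have e : ((N:ℝ)+1)⁻¹ • y - x = ((N:ℝ)+1)⁻¹ • (y - ((N:ℝ)+1) • x) := by
          rw [smul_sub, smul_smul, inv_mul_cancel₀ hN.ne', one_smul]
        rw [e, norm_smul, norm_inv, Real.norm_of_nonneg hN.le, div_eq_inv_mul]
        gcongr
      choose y hy1 hy2 using hy
      have hlim : Tendsto y atTop (𝓝 x) := by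
        rw [tendsto_iff_norm_sub_tendsto_zero]
        refine squeeze_zero (fun _ => norm_nonneg _) hy2 ?_
        have := (tendsto_one_div_add_atTop_nhds_zero_nat (𝕜 := ℝ)).const_mul c
        simpa [div_eq_mul_inv] using this
      exact (isClosed_cone n).mem_of_tendsto hlim (Eventually.of_forall hy1)
  refine ⟨m, fun j => (f j).comp (psumEquiv n).symm.toLinearMap, ?_⟩
  ext x
  have h1 := mem_hornCone_iff ((psumEquiv n).symm x)
  rw [LinearEquiv.apply_symm_apply] at h1
  rw [h1, key]
  rfl

/-- The multiplicative Horn cone is a polyhedral cone: it is the set of points where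
finitely many linear functionals are nonnegative. -/
theorem hornConeB_polyhedral (n : ℕ) (hn : 0 < n) :
    ∃ (m : ℕ) (f : Fin m → ((Fin n → ℝ) × (Fin n → ℝ) × (Fin n → ℝ)) →ₗ[ℝ] ℝ),
      HornConeB n = {x | ∀ j : Fin m, 0 ≤ f j x} := by
  exact main_polyhedral n
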